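/- Let n ≥ 22. Consider irreducible rigid triples (p = 2) of diagonalizable matrices A₁, A₂, A₃ ∈ gl(n,ℂ) with A₁ + A₂ + A₃ = 0 and generic eigenvalues, such that the maximal eigenvalue multiplicity of A₁ equals 2 and no A_j is scalar or has all eigenvalues distinct. Then, up to permutation of the three matrices, the triple of multiplicity vectors is one of the following, and conversely each of the following admits such triples for every compatible generic eigenvalues: for n even: Γ¹_n : (2,…,2), (2,…,2,1,1,1,1,1,1), (n−2,2); Γ²_n : (2,…,2,1,1), (2,…,2,1,1,1,1), (n−2,2); Γ³_n : (2,…,2,1,1), (2,…,2,1,1), (n−2,1,1); Γ⁴_n : (2,…,2), (2,…,2,1,1,1,1), (n−2,1,1); Y¹_n : (2,…,2,1,1,1,1), (m,m,2), (m+1,m+1) with n = 2m+2; Y²_n : (2,…,2,1,1), (m,m,1,1), (m+1,m+1) with n = 2m+2; Y³_n : (2,…,2,1,1,1,1), (m+2,m,1,1), (m+2,m+2) with n = 2m+4; Y⁴_n : (2,…,2,1,1,1,1,1,1), (m+2,m,2), (m+2,m+2) with n = 2m+4; Y⁵_n : (2,…,2,1,1), (m+1,m,1), (m+1,m,1) with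 n = 2m+2; Y⁶_n : (2,…,2,1,1,1,1), (m,m,1,1), (m+2,m) with n = 2m+2; Y⁷_n : (2,…,2,1,1,1,1,1,1), (m,m,2), (m+2,m) with n = 2m+2; for n odd: X¹_n : (2,…,2,1,1,1,1,1), (2,…,2,1), (n−2,2); X²_n : (2,…,2,1,1,1), (2,…,2,1,1,1), (n−2,2); OG_n : (2,…,2,1), (2,…,2,1,1,1), (n−2,1,1); Z¹_n : (2,…,2,1), (m,m,1), (m,m,1) with n = 2m+1; Z²_n : (2,…,2,1,1,1,1,1), (m,m−1,2), (m+1,m) with n = 2m+1; Z³_n : (2,…,2,1,1,1), (m,m−1,1,1), (m+1,m) with n = 2m+1; Z⁴_n : (2,…,2,1,1,1), (m,m,1), (m+1,m−1,1) with n = 2m+1. (In each MV the unspecified initial entries are all equal to 2, their number being determined by the total n.) -/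

import Mathlib

open Matrix BigOperators

/-- `B` lies in the conjugacy class of `A` (conjugation by an invertible matrix). -/
def MatConj {n : ℕ} (A B : Matrix (Fin n) (Fin n) ℂ) : Prop :=
  ∃ S : (Matrix (Fin n) (Fin n) ℂ)ˣ, B = S.val * A * (S⁻¹).val

/-- A tuple of `n × n` matrices is irreducible if no subspace of `ℂⁿ` other than `⊥` and `⊤`
is invariant under all of them. -/
def IrreducibleTuple {q n : ℕ} (M : Fin q → Matrix (Fin n) (Fin n) ℂ) : Prop :=
  ∀ V : Submodule ℂ (Fin n → ℂ),
    (∀ j, V.map (Matrix.mulVecLin (M j)) ≤ V) → V = ⊥ ∨ V = ⊤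

/-- The dimension of the conjugacy class of `A` : `n² - dim (centralizer of A)`. -/
noncomputable def classDim {n : ℕ} (A : Matrix (Fin n) (Fin n) ℂ) : ℕ :=
  n ^ 2 - Module.finrank ℂ
    (LinearMap.ker (LinearMap.mulLeft ℂ A - LinearMap.mulRight ℂ A))

/-- The multiset of multiplicities of the distinct values of `d : Fin n → ℂ`
(the multiplicity vector of the diagonal matrix with diagonal `d`). -/
noncomputable def evCounts {n : ℕ} (d : Fin n → ℂ) : Multiset ℕ := by
  classical exact (Finset.univ.image d).val.map fun σ => (Finset.univ.filter fun k => d k = σ).card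

/-- Genericity of the eigenvalue families `d j` (eigenvalues listed with multiplicity):
no partial sums, with `κ` eigenvalues chosen from each family, `1 ≤ κ ≤ n-1`, vanish. -/
def GenericAddEV {q n : ℕ} (d : Fin q → Fin n → ℂ) : Prop :=
  ∀ κ : ℕ, 1 ≤ κ → κ ≤ n - 1 →
    ∀ Φ : Fin q → Finset (Fin n), (∀ j, (Φ j).card = κ) →
      (∑ j, ∑ k ∈ Φ j, d j k) ≠ 0

/-- The list of PMVs of Theorem `p = 2` for `n ≥ 22`: the families
`Γ¹–Γ⁴, Y¹–Y⁷` (`n` even) and `X¹, X², OG, Z¹–Z⁴` (`n` odd). -/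
def TriFam (n : ℕ) (e : Fin 3 → Multiset ℕ) : Prop :=
  -- n = 2m : Γ¹, Γ², Γ³, Γ⁴
  (∃ m : ℕ, n = 2 * m ∧
    ((e 0 = Multiset.replicate m 2 ∧
        e 1 = Multiset.replicate (m - 3) 2 + Multiset.replicate 6 1 ∧
        e 2 = ({n - 2, 2} : Multiset ℕ)) ∨
     (e 0 = Multiset.replicate (m - 1) 2 + {1, 1} ∧
        e 1 = Multiset.replicate (m - 2) 2 + Multiset.replicate 4 1 ∧
        e 2 = ({n - 2, 2} : Multiset ℕ)) ∨
     (e 0 = Multiset.replicate (m - 1) 2 + {1, 1} ∧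
        e 1 = Multiset.replicate (m - 1) 2 + {1, 1} ∧
        e 2 = ({n - 2, 1, 1} : Multiset ℕ)) ∨
     (e 0 = Multiset.replicate m 2 ∧
        e 1 = Multiset.replicate (m - 2) 2 + Multiset.replicate 4 1 ∧
        e 2 = ({n - 2, 1, 1} : Multiset ℕ)))) ∨
  -- n = 2m + 2 : Y¹, Y², Y⁵, Y⁶, Y⁷
  (∃ m : ℕ, n = 2 * m + 2 ∧
    ((e 0 = Multiset.replicate (m - 1) 2 + Multiset.replicate 4 1 ∧
        e 1 = ({m, m, 2} : Multiset ℕ) ∧ e 2 = ({m + 1, m + 1} : Multiset ℕ)) ∨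
     (e 0 = Multiset.replicate m 2 + {1, 1} ∧
        e 1 = ({m, m, 1, 1} : Multiset ℕ) ∧ e 2 = ({m + 1, m + 1} : Multiset ℕ)) ∨
     (e 0 = Multiset.replicate m 2 + {1, 1} ∧
        e 1 = ({m + 1, m, 1} : Multiset ℕ) ∧ e 2 = ({m + 1, m, 1} : Multiset ℕ)) ∨
     (e 0 = Multiset.replicate (m - 1) 2 + Multiset.replicate 4 1 ∧
        e 1 = ({m, m, 1, 1} : Multiset ℕ) ∧ e 2 = ({m + 2, m} : Multiset ℕ)) ∨
     (e 0 = Multiset.replicate (m - 2) 2 + Multiset.replicate 6 1 ∧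
        e 1 = ({m, m, 2} : Multiset ℕ) ∧ e 2 = ({m + 2, m} : Multiset ℕ)))) ∨
  -- n = 2m + 4 : Y³, Y⁴
  (∃ m : ℕ, n = 2 * m + 4 ∧
    ((e 0 = Multiset.replicate m 2 + Multiset.replicate 4 1 ∧
        e 1 = ({m + 2, m, 1, 1} : Multiset ℕ) ∧ e 2 = ({m + 2, m + 2} : Multiset ℕ)) ∨
     (e 0 = Multiset.replicate (m - 1) 2 + Multiset.replicate 6 1 ∧
        e 1 = ({m + 2, m, 2} : Multiset ℕ) ∧ e 2 = ({m + 2, m + 2} : Multiset ℕ)))) ∨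
  -- n = 2m + 1 : X¹, X², OG, Z¹, Z², Z³, Z⁴
  (∃ m : ℕ, n = 2 * m + 1 ∧
    ((e 0 = Multiset.replicate (m - 2) 2 + Multiset.replicate 5 1 ∧
        e 1 = Multiset.replicate m 2 + {1} ∧ e 2 = ({n - 2, 2} : Multiset ℕ)) ∨
     (e 0 = Multiset.replicate (m - 1) 2 + Multiset.replicate 3 1 ∧
        e 1 = Multiset.replicate (m - 1) 2 + Multiset.replicate 3 1 ∧
        e 2 = ({n - 2, 2} : Multiset ℕ)) ∨
     (e 0 = Multiset.replicate m 2 + {1} ∧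
        e 1 = Multiset.replicate (m - 1) 2 + Multiset.replicate 3 1 ∧
        e 2 = ({n - 2, 1, 1} : Multiset ℕ)) ∨
     (e 0 = Multiset.replicate m 2 + {1} ∧
        e 1 = ({m, m, 1} : Multiset ℕ) ∧ e 2 = ({m, m, 1} : Multiset ℕ)) ∨
     (e 0 = Multiset.replicate (m - 2) 2 + Multiset.replicate 5 1 ∧
        e 1 = ({m, m - 1, 2} : Multiset ℕ) ∧ e 2 = ({m + 1, m} : Multiset ℕ)) ∨
     (e 0 = Multiset.replicate (m - 1) 2 + Multiset.replicate 3 1 ∧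
        e 1 = ({m, m - 1, 1, 1} : Multiset ℕ) ∧ e 2 = ({m + 1, m} : Multiset ℕ)) ∨
     (e 0 = Multiset.replicate (m - 1) 2 + Multiset.replicate 3 1 ∧
        e 1 = ({m, m, 1} : Multiset ℕ) ∧ e 2 = ({m + 1, m - 1, 1} : Multiset ℕ))))


section partA1
open Matrix BigOperators
open Module

def Sol {L : Type} (n : ℕ) (c : ℂ) (v : Fin 3 → L → ℂ) (m : Fin 3 → L → ℕ) : Prop :=
  ∃ (V : Type) (_ : AddCommGroup V) (_ : Module ℂ V) (_ : FiniteDimensional ℂ V)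
    (A : Fin 3 → Module.End ℂ V), finrank ℂ V = n ∧ ∑ j, A j = c • (1 : Module.End ℂ V) ∧
    ∀ j l, m j l ≤ finrank ℂ (Module.End.eigenspace (A j) (v j l))

theorem finrank_eig_le {V : Type} [AddCommGroup V] [Module ℂ V] [FiniteDimensional ℂ V]
    {L : Type} (A : Module.End ℂ V) (v : L → ℂ) (S : Finset L)
    (hv : ∀ l ∈ S, ∀ l' ∈ S, v l = v l' → l = l') :
    ∑ l ∈ S, finrank ℂ (Module.End.eigenspace A (v l)) ≤ finrank ℂ V := by
  classical
  have h1 : iSupIndep (fun l : S => Module.End.eigenspace A (v l)) := by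
    apply (Module.End.eigenspaces_iSupIndep A).comp (f := fun l : S => v l)
    intro a b h
    exact Subtype.ext (hv _ a.2 _ b.2 h)
  have h2 := iSupIndep.dfinsupp_lsum_injective h1
  have h3 := LinearMap.finrank_le_finrank_of_injective h2
  have h4 : finrank ℂ (Π₀ l : S, Module.End.eigenspace A (v l)) =
      ∑ l : S, finrank ℂ (Module.End.eigenspace A (v l)) := by
    have := Module.finrank_directSum (R := ℂ) (fun l : S => Module.End.eigenspace A (v l))
    exact this
  rw [h4] at h3
  rw [← Finset.sum_coe_sort]
  exact h3

theorem finrank_eig_exact {V : Type} [AddCommGroup V] [Module ℂ V] [FiniteDimensional ℂ V]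
    {L : Type} [Fintype L] [DecidableEq L] (A : Module.End ℂ V) (v : L → ℂ) (m : L → ℕ)
    (hm : ∑ l, m l = finrank ℂ V)
    (hle : ∀ l, m l ≤ finrank ℂ (Module.End.eigenspace A (v l)))
    (hv : ∀ l l', m l ≠ 0 → m l' ≠ 0 → v l = v l' → l = l') (a : L)
    (ha : ∀ l, m l ≠ 0 → v l = v a → l = a) :
    finrank ℂ (Module.End.eigenspace A (v a)) = m a := by
  classical
  set S : Finset L := insert a (Finset.univ.filter (fun l => m l ≠ 0)) with hS
  have h1 := finrank_eig_le A v S (by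
    intro l hl l' hl' h
    simp only [hS, Finset.mem_insert, Finset.mem_filter, Finset.mem_univ, true_and] at hl hl'
    rcases hl with rfl | hl <;> rcases hl' with rfl | hl'
    · rfl
    · exact (ha _ hl' h.symm).symm
    · exact ha _ hl h
    · exact hv _ _ hl hl' h)
  have h2 : ∑ l ∈ S, m l = finrank ℂ V := by
    rw [← hm]
    apply Finset.sum_subset (Finset.subset_univ _)
    intro x _ hx
    by_contra h
    exact hx (by simp [hS, h])
  have h3 : ∑ l ∈ S, m l ≤ ∑ l ∈ S, finrank ℂ (Module.End.eigenspace A (v l)) :=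
    Finset.sum_le_sum (fun l _ => hle l)
  have h4 := (Finset.sum_eq_sum_iff_of_le (fun l (_ : l ∈ S) => hle l)).1
    (le_antisymm h3 (by rw [h2]; exact h1)) a (by simp [hS])
  exact h4.symm

/-- The core reflection construction. -/
theorem core_reflect {V : Type} [AddCommGroup V] [Module ℂ V] [FiniteDimensional ℂ V]
    (B : Fin 3 → Module.End ℂ V) (s : ℂ) (hs : s ≠ 0) (hB : ∑ j, B j = s • (1 : Module.End ℂ V)) :
    ∃ (U : Type) (_ : AddCommGroup U) (_ : Module ℂ U) (_ : FiniteDimensional ℂ U)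
      (B' : Fin 3 → Module.End ℂ U), ∑ j, B' j = s • (1 : Module.End ℂ U) ∧
      finrank ℂ U + finrank ℂ V = ∑ j, finrank ℂ (LinearMap.range (B j)) ∧
      (∀ j, finrank ℂ U ≤ finrank ℂ (LinearMap.ker (B' j)) + finrank ℂ (LinearMap.range (B j))) ∧
      (∀ j ν, ν ≠ 0 → ν ≠ s → finrank ℂ (Module.End.eigenspace (B j) ν) ≤
        finrank ℂ (Module.End.eigenspace (B' j) (s - ν))) := by
  classical
  let W := ∀ j : Fin 3, LinearMap.range (B j)
  let Q : V →ₗ[ℂ] W := LinearMap.pi (fun j => (B j).rangeRestrict)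
  let P : W →ₗ[ℂ] V := ∑ j, (LinearMap.range (B j)).subtype ∘ₗ LinearMap.proj j
  have hP : ∀ w : W, P w = ∑ j, (w j : V) := by
    intro w; simp [P]; rfl
  have hQ : ∀ x j, ((Q x) j : V) = B j x := by
    intro x j; rfl
  have hB1 : ∀ x, ∑ j, B j x = s • x := by
    intro x
    have := congrArg (fun f : Module.End ℂ V => f x) hB
    simpa using this
  have hPQ : ∀ x, P (Q x) = s • x := by
    intro x
    rw [hP, ← hB1]; rfl
  let F : Fin 3 → W →ₗ[ℂ] W := fun j =>
    s • (LinearMap.single ℂ (fun j => LinearMap.range (B j)) j ∘ₗ LinearMap.proj j) -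
      Q ∘ₗ (LinearMap.range (B j)).subtype ∘ₗ LinearMap.proj j
  have hF : ∀ j w, F j w = s • (Pi.single j (w j) : W) - Q (w j) := by
    intro j w; rfl
  have hPs : ∀ j (x : LinearMap.range (B j)), P (Pi.single j x : W) = x := by
    intro j x
    rw [hP, Finset.sum_eq_single j]
    · simp
    · intro b _ hb; simp [Pi.single_eq_of_ne hb]
    · simp
  have hPF : ∀ j w, P (F j w) = 0 := by
    intro j w
    rw [hF, map_sub, map_smul, hPQ, hPs, sub_self]
  let U := LinearMap.ker P
  let B' : Fin 3 → Module.End ℂ U := fun j =>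
    LinearMap.codRestrict U (F j ∘ₗ U.subtype) (fun w => hPF j w)
  have hB' : ∀ j (w : U), ((B' j w : U) : W) = s • (Pi.single j ((w : W) j) : W) - Q ((w : W) j) := by
    intro j w; rfl
  refine ⟨U, inferInstance, inferInstance, inferInstance, B', ?_, ?_, ?_, ?_⟩
  · ext w : 1
    apply Subtype.ext
    have hw : ∑ j, ((w : W) j : V) = 0 := by rw [← hP]; exact w.2
    have : ((∑ j, B' j) w : U) = ∑ j, B' j w := by simp
    rw [this, Submodule.coe_sum]
    simp only [hB', Finset.sum_sub_distrib]
    rw [← map_sum, hw, map_zero, sub_zero, ← Finset.smul_sum, Finset.univ_sum_single]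
    rfl
  · have hsurj : Function.Surjective P := by
      intro x
      refine ⟨Q (s⁻¹ • x), ?_⟩
      rw [hPQ, smul_smul, mul_inv_cancel₀ hs, one_smul]
    have h1 := LinearMap.finrank_range_add_finrank_ker P
    rw [LinearMap.range_eq_top.2 hsurj, finrank_top, Module.finrank_pi_fintype] at h1
    rw [← h1, add_comm]
  · intro j
    have h1 := LinearMap.finrank_range_add_finrank_ker ((LinearMap.proj j : W →ₗ[ℂ] _) ∘ₗ U.subtype)
    have h2 : finrank ℂ (LinearMap.range ((LinearMap.proj j : W →ₗ[ℂ] _) ∘ₗ U.subtype)) ≤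
      finrank ℂ (LinearMap.range (B j)) := Submodule.finrank_le _
    have h3 : LinearMap.ker ((LinearMap.proj j : W →ₗ[ℂ] _) ∘ₗ U.subtype) ≤ LinearMap.ker (B' j) := by
      intro w hw
      rw [LinearMap.mem_ker] at hw ⊢
      have hw' : (w : W) j = 0 := hw
      apply Subtype.ext
      rw [hB', hw']
      simp
    have h4 := Submodule.finrank_mono h3
    omega
  · intro j ν h0 h1
    have hr : ∀ u : Module.End.eigenspace (B j) ν, (u : V) ∈ LinearMap.range (B j) := by
      intro u
      refine ⟨ν⁻¹ • (u : V), ?_⟩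
      rw [map_smul, Module.End.mem_eigenspace_iff.1 u.2, smul_smul, inv_mul_cancel₀ h0, one_smul]
    let i : Module.End.eigenspace (B j) ν →ₗ[ℂ] LinearMap.range (B j) :=
      LinearMap.codRestrict _ (Submodule.subtype _) hr
    let G : Module.End.eigenspace (B j) ν →ₗ[ℂ] W :=
      s • (LinearMap.single ℂ (fun j => LinearMap.range (B j)) j ∘ₗ i) - Q ∘ₗ Submodule.subtype _
    have hG : ∀ u, G u = s • (Pi.single j (i u) : W) - Q u := fun u => rfl
    have hGU : ∀ u, G u ∈ U := by
      intro u
      change P (G u) = 0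
      rw [hG, map_sub, map_smul, hPQ, hPs]
      exact sub_self _
    have hGj : ∀ u, (G u) j = (s - ν) • i u := by
      intro u
      apply Subtype.ext
      have : ((G u) j : V) = s • (u : V) - B j u := by
        rw [hG]
        change (((s • (Pi.single j (i u) : W) j - (Q u) j : LinearMap.range (B j))) : V) = _
        rw [Pi.single_eq_same]
        rfl
      rw [this, Module.End.mem_eigenspace_iff.1 u.2, ← sub_smul]
      rfl
    let G' : Module.End.eigenspace (B j) ν →ₗ[ℂ] U := LinearMap.codRestrict U G hGU
    have hG' : ∀ u, G' u ∈ Module.End.eigenspace (B' j) (s - ν) := by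
      intro u
      rw [Module.End.mem_eigenspace_iff]
      apply Subtype.ext
      rw [hB']
      have e1 : ((G' u : U) : W) = G u := rfl
      have e2 : (((s - ν) • G' u : U) : W) = (s - ν) • G u := rfl
      have e3 : ((((s - ν) • i u : LinearMap.range (B j))) : V) = (s - ν) • (u : V) := rfl
      rw [e1, e2, hGj, e3, hG, map_smul, smul_sub, smul_comm, Pi.single_smul]
    let G2 := LinearMap.codRestrict (Module.End.eigenspace (B' j) (s - ν)) G' hG'
    apply LinearMap.finrank_le_finrank_of_injective (f := G2)
    rw [injective_iff_map_eq_zero]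
    intro u hu
    have e1 : G u = 0 := by
      have := congrArg (fun x => ((x : U) : W)) (congrArg Subtype.val hu)
      exact this
    have e2 := hGj u
    rw [e1] at e2
    have e3 : i u = 0 := by
      have : (s - ν) ≠ 0 := sub_ne_zero.2 (Ne.symm h1)
      rcases smul_eq_zero.1 e2.symm with h | h
      · exact absurd h this
      · exact h
    apply Subtype.ext
    have e4 := congrArg (fun x : LinearMap.range (B j) => (x : V)) e3
    exact e4

theorem sol_reflect {L : Type} [Fintype L] [DecidableEq L] (n n' δ : ℕ) (c : ℂ)
    (v : Fin 3 → L → ℂ) (m m' : Fin 3 → L → ℕ) (a : Fin 3 → L) (ℓ : ℂ)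
    (hℓ : ℓ = ∑ j, v j (a j) - c) (hℓ0 : ℓ ≠ 0) (hn : n = n' + δ)
    (hsum : ∑ j, m j (a j) = n + δ) (hma : ∀ j, m j (a j) = m' j (a j) + δ)
    (hml : ∀ j l, l ≠ a j → m j l = m' j l) (hm' : ∀ j, ∑ l, m' j l = n')
    (hinj : ∀ j l l', m j l ≠ 0 → m j l' ≠ 0 → v j l = v j l' → l = l')
    (hmapos : ∀ j, m j (a j) ≠ 0)
    (hvar : ∀ j l, l ≠ a j → m j l ≠ 0 → v j l ≠ v j (a j) - ℓ)
    (h : Sol n' (c - ℓ) (fun j => Function.update (v j) (a j) (v j (a j) - ℓ)) m') :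
    Sol n c v m := by
  obtain ⟨V, _, _, _, A, hV, hA, hm⟩ := h
  set v' : Fin 3 → L → ℂ := (fun j => Function.update (v j) (a j) (v j (a j) - ℓ)) with hv'
  have hva : ∀ j, v' j (a j) = v j (a j) - ℓ := by intro j; simp [hv']
  have hvl : ∀ j l, l ≠ a j → v' j l = v j l := by intro j l h; simp [hv', h]
  have hex : ∀ j, finrank ℂ (Module.End.eigenspace (A j) (v' j (a j))) = m' j (a j) := by
    intro j
    have key : ∀ l, m' j l ≠ 0 → v' j l = v' j (a j) → l = a j := by
      intro l hl h
      by_contra hne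
      rw [hva, hvl j l hne] at h
      exact hvar j l hne (by rw [hml j l hne]; exact hl) h
    apply finrank_eig_exact (A j) (v' j) (m' j) (by rw [hm', hV]) (hm j) _ _ key
    intro l l' hl hl' h
    by_cases e : l = a j
    · subst e; exact (key l' hl' h.symm).symm
    by_cases e' : l' = a j
    · subst e'; exact key l hl h
    rw [hvl j l e, hvl j l' e'] at h
    exact hinj j l l' (by rw [hml j l e]; exact hl) (by rw [hml j l' e']; exact hl') h
  let B : Fin 3 → Module.End ℂ V := fun j => A j - (v' j (a j)) • 1
  have hker : ∀ j ν, Module.End.eigenspace (B j) ν = Module.End.eigenspace (A j) (v' j (a j) + ν) := by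
    intro j ν
    ext x
    simp only [Module.End.mem_eigenspace_iff, B, LinearMap.sub_apply, LinearMap.smul_apply,
      Module.End.one_apply, add_smul]
    rw [sub_eq_iff_eq_add, add_comm]
  have hBs : ∑ j, B j = ℓ • (1 : Module.End ℂ V) := by
    simp only [B, Finset.sum_sub_distrib, hA, ← Finset.sum_smul, hva]
    rw [← sub_smul]
    congr 1
    simp only [Finset.sum_const, Finset.card_univ, Fintype.card_fin, hℓ]
    simp
    ring
  obtain ⟨U, _, _, _, B', h1, h2, h3, h4⟩ := core_reflect B ℓ hℓ0 hBs
  have hr : ∀ j, finrank ℂ (LinearMap.range (B j)) + m' j (a j) = n' := by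
    intro j
    have := LinearMap.finrank_range_add_finrank_ker (B j)
    rw [← Module.End.eigenspace_zero, hker, add_zero, hex, hV] at this
    exact this
  have hU : finrank ℂ U = n := by
    have r0 := hr 0
    have r1 := hr 1
    have r2 := hr 2
    have a0 := hma 0
    have a1 := hma 1
    have a2 := hma 2
    rw [Fin.sum_univ_three] at h2 hsum
    rw [hV] at h2
    omega
  refine ⟨U, inferInstance, inferInstance, inferInstance, fun j => v j (a j) • 1 - B' j, hU, ?_, ?_⟩
  · rw [Finset.sum_sub_distrib, h1, ← Finset.sum_smul, ← sub_smul, hℓ]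
    congr 1
    ring
  · have hk : ∀ j μ, Module.End.eigenspace (v j (a j) • (1 : Module.End ℂ U) - B' j) μ
        = Module.End.eigenspace (B' j) (v j (a j) - μ) := by
      intro j μ
      ext x
      simp only [Module.End.mem_eigenspace_iff, LinearMap.sub_apply, LinearMap.smul_apply,
        Module.End.one_apply, sub_smul]
      constructor
      · intro h; rw [← h]; abel
      · intro h; rw [h]; abel
    intro j l
    rw [hk]
    by_cases e : l = a j
    · subst e
      rw [sub_self, Module.End.eigenspace_zero]
      have := h3 j
      have := hr j
      have := hma j
      omega
    · by_cases hz : m j l = 0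
      · rw [hz]; exact Nat.zero_le _
      have := h4 j (v j l - v j (a j) + ℓ) (by
          intro h
          apply hvar j l e hz
          linear_combination h) (by
          intro h
          apply e
          apply hinj j l (a j) hz (hmapos j)
          linear_combination h)
      rw [hker, hva] at this
      have e1 : v j (a j) - ℓ + (v j l - v j (a j) + ℓ) = v j l := by ring
      have e2 : ℓ - (v j l - v j (a j) + ℓ) = v j (a j) - v j l := by ring
      rw [e1, e2] at this
      refine le_trans ?_ this
      rw [hml j l e, ← hvl j l e]
      exact hm j l

end partA1

section partA2
open Matrix BigOperators
open Module

set_option linter.unusedSectionVars false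
set_option linter.unusedDecidableInType false

section refl
variable {L : Type} [Fintype L] [DecidableEq L]

def LForm (v : Fin 3 → L → ℂ) (c : ℂ) (κ : ℤ) (t : Fin 3 → L → ℤ) : ℂ :=
  ∑ j, ∑ l, (t j l : ℂ) * v j l - κ * c

def SolvR (n : ℕ) (m : Fin 3 → L → ℕ) (R : ℤ → (Fin 3 → L → ℤ) → Prop) : Prop :=
  ∀ (v : Fin 3 → L → ℂ) (c : ℂ),
    (∀ j l l', m j l ≠ 0 → m j l' ≠ 0 → v j l = v j l' → l = l') →
    LForm v c n (fun j l => (m j l : ℤ)) = 0 →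
    (∀ κ t, R κ t → LForm v c κ t ≠ 0) → Sol n c v m

def IsLeg (m : Fin 3 → L → ℕ) (κ : ℤ) (t : Fin 3 → L → ℤ) : Prop :=
  κ = 0 ∧ ∃ j l l', l ≠ l' ∧ m j l ≠ 0 ∧ m j l' ≠ 0 ∧
    ∀ j' x, t j' x = if j' = j then (if x = l then 1 else 0) - (if x = l' then 1 else 0) else 0

/-- `t` shifted by `ε` at the chosen labels -/
def tsh (a : Fin 3 → L) (ε : ℤ) (t : Fin 3 → L → ℤ) : Fin 3 → L → ℤ :=
  fun j l => t j l + if l = a j then ε else 0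

def eps (a : Fin 3 → L) (κ : ℤ) (t : Fin 3 → L → ℤ) : ℤ := κ - (t 0 (a 0) + t 1 (a 1) + t 2 (a 2))

/-- variant root -/
def vroot (a : Fin 3 → L) (j : Fin 3) (l : L) : Fin 3 → L → ℤ :=
  fun j' x => if j' = j then (if x = l then 1 else 0) else (if x = a j' then 1 else 0)

theorem SolvR.mono {n : ℕ} {m : Fin 3 → L → ℕ} {R R' : ℤ → (Fin 3 → L → ℤ) → Prop}
    (h : SolvR n m R) (hR : ∀ κ t, R κ t → R' κ t) : SolvR n m R' :=
  fun v c h1 h2 h3 => h v c h1 h2 (fun κ t hr => h3 κ t (hR κ t hr))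

theorem leg_ne {v : Fin 3 → L → ℂ} {c : ℂ} {m : Fin 3 → L → ℕ}
    (hinj : ∀ j l l', m j l ≠ 0 → m j l' ≠ 0 → v j l = v j l' → l = l') {κ t}
    (h : IsLeg m κ t) : LForm v c κ t ≠ 0 := by
  obtain ⟨rfl, j, l, l', hne, hl, hl', ht⟩ := h
  have : LForm v c 0 t = v j l - v j l' := by
    simp only [LForm, ht]
    rw [Finset.sum_eq_single j]
    · simp [sub_mul, Finset.sum_sub_distrib]
    · intro b _ hb; simp [hb]
    · simp
  rw [this, sub_ne_zero]
  intro h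
  exact hne (hinj j l l' hl hl' h)

theorem form_shift (v : Fin 3 → L → ℂ) (c : ℂ) (a : Fin 3 → L) (ε κ : ℤ) (t : Fin 3 → L → ℤ) :
    LForm v c (κ + ε) (tsh a ε t) = LForm v c κ t + ε * (∑ j, v j (a j) - c) := by
  simp only [LForm, tsh, Int.cast_add, add_mul, Finset.sum_add_distrib]
  have : ∑ j : Fin 3, ∑ l, ((if l = a j then ε else 0 : ℤ) : ℂ) * v j l = ε * ∑ j, v j (a j) := by
    rw [Finset.mul_sum]
    apply Finset.sum_congr rfl
    intro j _
    rw [Finset.sum_eq_single (a j)]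
    · simp
    · intro b _ hb; simp [hb]
    · simp
  rw [this]
  ring

theorem form_upd (v : Fin 3 → L → ℂ) (c ℓ : ℂ) (a : Fin 3 → L) (κ : ℤ) (t : Fin 3 → L → ℤ) :
    LForm (fun j => Function.update (v j) (a j) (v j (a j) - ℓ)) (c - ℓ) κ t
      = LForm v c κ t + (eps a κ t : ℤ) * ℓ := by
  simp only [LForm]
  have : ∀ j : Fin 3, ∑ l, (t j l : ℂ) * (Function.update (v j) (a j) (v j (a j) - ℓ)) l
      = ∑ l, (t j l : ℂ) * v j l - t j (a j) * ℓ := by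
    intro j
    rw [eq_sub_iff_add_eq, ← Finset.sum_erase_add _ _ (Finset.mem_univ (a j)),
      ← Finset.sum_erase_add _ _ (Finset.mem_univ (a j)), add_assoc]
    congr 1
    · apply Finset.sum_congr rfl
      intro x hx
      rw [Function.update_of_ne (Finset.ne_of_mem_erase hx)]
    · simp; ring
  simp only [this, Finset.sum_sub_distrib, eps, Fin.sum_univ_three]
  push_cast
  ring

theorem solv_reflect (n n' δ : ℕ) (m m' : Fin 3 → L → ℕ) (a : Fin 3 → L)
    (R R' : ℤ → (Fin 3 → L → ℤ) → Prop) (hn : n = n' + δ)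
    (hsum : m 0 (a 0) + m 1 (a 1) + m 2 (a 2) = n + δ) (hma : ∀ j, m j (a j) = m' j (a j) + δ)
    (hml : ∀ j l, l ≠ a j → m j l = m' j l) (hm : ∀ j, ∑ l, m j l = n)
    (hmapos : ∀ j, m j (a j) ≠ 0)
    (hvar : ∀ j l, m j l ≠ 0 → R 1 (vroot a j l) ∨ IsLeg m 1 (vroot a j l))
    (hR : ∀ κ t, R' κ t → R (κ + eps a κ t) (tsh a (eps a κ t) t) ∨
      IsLeg m (κ + eps a κ t) (tsh a (eps a κ t) t))
    (h : SolvR n' m' R') : SolvR n m R := by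
  intro v c hinj htr hnv
  have hnv' : ∀ κ t, (R κ t ∨ IsLeg m κ t) → LForm v c κ t ≠ 0 := by
    intro κ t h
    rcases h with h | h
    · exact hnv κ t h
    · exact leg_ne hinj h
  have hm' : ∀ j, ∑ l, m' j l = n' := by
    intro j
    have h1 := hm j
    rw [← Finset.sum_erase_add _ _ (Finset.mem_univ (a j))] at h1 ⊢
    have h2 : ∑ x ∈ Finset.univ.erase (a j), m j x = ∑ x ∈ Finset.univ.erase (a j), m' j x :=
      Finset.sum_congr rfl (fun x hx => hml j x (Finset.ne_of_mem_erase hx))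
    have := hma j
    omega
  set ℓ := ∑ j, v j (a j) - c with hℓ
  have hvr : ∀ j l, LForm v c 1 (vroot a j l) = ℓ - v j (a j) + v j l := by
    intro j l
    have : ∀ j', ∑ x, (vroot a j l j' x : ℂ) * v j' x = if j' = j then v j l else v j' (a j') := by
      intro j'
      by_cases hj : j' = j
      · subst hj; simp [vroot]
      · simp [vroot, hj]
    simp only [LForm, this, hℓ]
    rw [← Finset.sum_erase_add _ _ (Finset.mem_univ j),
      ← Finset.sum_erase_add Finset.univ (fun j => v j (a j)) (Finset.mem_univ j)]
    have : ∑ x ∈ Finset.univ.erase j, (if x = j then v j l else v x (a x)) =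
        ∑ x ∈ Finset.univ.erase j, v x (a x) :=
      Finset.sum_congr rfl (fun x hx => by simp [Finset.ne_of_mem_erase hx])
    rw [this]
    simp
    ring
  have hv2 : ∀ j l, m j l ≠ 0 → v j l ≠ v j (a j) - ℓ := by
    intro j l hl h
    apply hnv' _ _ (hvar j l hl)
    rw [hvr, h]; ring
  have hℓ0 : ℓ ≠ 0 := by
    have := hv2 0 (a 0) (hmapos 0)
    intro h
    apply this
    rw [h]; ring
  apply sol_reflect n n' δ c v m m' a ℓ hℓ hℓ0 hn (by rw [Fin.sum_univ_three]; exact hsum) hma hml hm'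
    hinj hmapos (fun j l _ hl => hv2 j l hl)
  apply h
  · intro j l l' hl hl' h
    have key : ∀ l, m' j l ≠ 0 → l ≠ a j → v j l ≠ v j (a j) - ℓ := by
      intro l hl hne
      exact hv2 j l (by rw [hml j l hne]; exact hl)
    by_cases e : l = a j <;> by_cases e' : l' = a j
    · rw [e, e']
    · exfalso
      subst e
      simp only [Function.update_self, Function.update_of_ne e'] at h
      exact key l' hl' e' h.symm
    · exfalso
      subst e'
      simp only [Function.update_self, Function.update_of_ne e] at h
      exact key l hl e h
    · simp only [Function.update_of_ne e, Function.update_of_ne e'] at h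
      exact hinj j l l' (by rw [hml j l e]; exact hl) (by rw [hml j l' e']; exact hl') h
  · rw [form_upd, hℓ, ← form_shift]
    have e1 : eps a (n' : ℤ) (fun j l => (m' j l : ℤ)) = δ := by
      have a0 := hma 0
      have a1 := hma 1
      have a2 := hma 2
      simp only [eps]
      omega
    rw [e1]
    have e2 : tsh a (δ : ℤ) (fun j l => (m' j l : ℤ)) = fun j l => (m j l : ℤ) := by
      funext j l
      simp only [tsh]
      by_cases e : l = a j
      · subst e; rw [hma j]; simp
      · simp [e, hml j l e]
    rw [e2, ← htr, hn]
    push_cast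
    rfl
  · intro κ t hr
    rw [form_upd, hℓ, ← form_shift]
    exact hnv' _ _ (hR κ t hr)

theorem solv_perm (σ : Equiv.Perm (Fin 3)) (n : ℕ) (m : Fin 3 → L → ℕ)
    (R R' : ℤ → (Fin 3 → L → ℤ) → Prop) (hR : ∀ κ t, R' κ (fun j => t (σ j)) → R κ t)
    (h : SolvR n (fun j => m (σ j)) R') : SolvR n m R := by
  intro v c hinj htr hnv
  have hf : ∀ κ (t : Fin 3 → L → ℤ), LForm (fun j => v (σ j)) c κ (fun j => t (σ j)) = LForm v c κ t := by
    intro κ t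
    simp only [LForm]
    rw [Equiv.sum_comp σ (fun j => ∑ l, (t j l : ℂ) * v j l)]
  obtain ⟨V, i1, i2, i3, A, h1, h2, h3⟩ := h (fun j => v (σ j)) c (fun j => hinj (σ j))
    (by rw [← htr, ← hf]) (by
      intro κ t ht
      have e : t = fun j => (fun j => t (σ.symm j)) (σ j) := by funext j; simp
      rw [e, hf κ (fun j => t (σ.symm j))]
      apply hnv
      apply hR
      simpa using ht)
  refine ⟨V, i1, i2, i3, fun j => A (σ.symm j), h1, ?_, ?_⟩
  · rw [Equiv.sum_comp σ.symm (fun j => A j)]; exact h2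
  · intro j l
    have := h3 (σ.symm j) l
    beta_reduce at this
    rw [Equiv.apply_symm_apply] at this
    exact this

theorem solv_one (m : Fin 3 → L → ℕ) (R) (hm : ∀ j, ∑ l, m j l = 1) : SolvR 1 m R := by
  classical
  intro v c hinj htr _
  have : ∀ j, ∃ l, m j l = 1 ∧ ∀ x, x ≠ l → m j x = 0 := by
    intro j
    have h0 : ∃ l, m j l ≠ 0 := by
      by_contra hc
      push Not at hc
      have := hm j
      simp [hc] at this
    obtain ⟨l, hl⟩ := h0
    have h1 := hm j
    rw [← Finset.sum_erase_add _ _ (Finset.mem_univ l)] at h1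
    have h2 : ∑ x ∈ Finset.univ.erase l, m j x = 0 := by omega
    refine ⟨l, by omega, ?_⟩
    intro x hx
    exact (Finset.sum_eq_zero_iff.1 h2) x (by simp [hx])
  choose a ha1 ha2 using this
  refine ⟨ℂ, inferInstance, inferInstance, inferInstance, fun j => v j (a j) • 1, by simp, ?_, ?_⟩
  · rw [← Finset.sum_smul]
    congr 1
    have : ∀ j, ∑ l, ((m j l : ℤ) : ℂ) * v j l = v j (a j) := by
      intro j
      rw [Finset.sum_eq_single (a j)]
      · simp [ha1]
      · intro b _ hb; simp [ha2 j b hb]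
      · simp
    simp only [LForm, this] at htr
    have := sub_eq_zero.1 htr
    rw [this]; simp
  · intro j l
    by_cases e : l = a j
    · subst e
      rw [ha1]
      have : Module.End.eigenspace (v j (a j) • (1 : Module.End ℂ ℂ)) (v j (a j)) = ⊤ := by
        rw [eq_top_iff]
        intro x _
        rw [Module.End.mem_eigenspace_iff]
        simp
      rw [this]; simp
    · rw [ha2 j l e]; exact Nat.zero_le _

end refl

end partA2

section partB1
open Matrix BigOperators
open Module
set_option linter.unusedSectionVars false
set_option linter.unusedDecidableInType false

section boxes
variable {L : Type} [Fintype L] [DecidableEq L]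

def Box (n : ℕ) (m : Fin 3 → L → ℕ) (κ : ℤ) (t : Fin 3 → L → ℤ) : Prop :=
  1 ≤ κ ∧ κ < n ∧ (∀ j l, 0 ≤ t j l ∧ t j l ≤ m j l) ∧ ∀ j, ∑ l, t j l = κ

def BoxC (n : ℕ) (m : Fin 3 → L → ℕ) (C : ℤ → (Fin 3 → L → ℤ) → Prop) (κ : ℤ)
    (t : Fin 3 → L → ℤ) : Prop := Box n m κ t ∧ C κ t

def mred (a : Fin 3 → L) (δ : ℕ) (m : Fin 3 → L → ℕ) : Fin 3 → L → ℕ :=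
  fun j l => m j l - if l = a j then δ else 0

theorem mred_self (a : Fin 3 → L) (δ : ℕ) (m : Fin 3 → L → ℕ) (j) :
    mred a δ m j (a j) = m j (a j) - δ := by simp [mred]

theorem mred_ne (a : Fin 3 → L) (δ : ℕ) (m : Fin 3 → L → ℕ) (j l) (h : l ≠ a j) :
    mred a δ m j l = m j l := by simp [mred, h]

theorem sum_mred (a : Fin 3 → L) (δ : ℕ) (m : Fin 3 → L → ℕ) (j) (h : δ ≤ m j (a j)) :
    ∑ l, mred a δ m j l + δ = ∑ l, m j l := by
  rw [← Finset.sum_erase_add _ _ (Finset.mem_univ (a j)),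
    ← Finset.sum_erase_add Finset.univ (m j) (Finset.mem_univ (a j)), mred_self]
  have : ∑ x ∈ Finset.univ.erase (a j), mred a δ m j x = ∑ x ∈ Finset.univ.erase (a j), m j x :=
    Finset.sum_congr rfl (fun x hx => mred_ne a δ m j x (Finset.ne_of_mem_erase hx))
  omega

theorem sum_tsh (a : Fin 3 → L) (ε : ℤ) (t : Fin 3 → L → ℤ) (j) :
    ∑ l, tsh a ε t j l = ∑ l, t j l + ε := by
  simp [tsh, Finset.sum_add_distrib]

theorem box_tsh {n n' δ : ℕ} {m : Fin 3 → L → ℕ} {a : Fin 3 → L} {κ ε : ℤ} {t}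
    (hb : Box n' (mred a δ m) κ t) (h1 : ∀ j, 0 ≤ t j (a j) + ε ∧ t j (a j) + ε ≤ m j (a j))
    (h2 : 1 ≤ κ + ε) (h3 : κ + ε < n) : Box n m (κ + ε) (tsh a ε t) := by
  obtain ⟨_, _, hb1, hb2⟩ := hb
  refine ⟨h2, h3, ?_, ?_⟩
  · intro j l
    by_cases e : l = a j
    · subst e
      simpa [tsh] using h1 j
    · have := hb1 j l
      rw [mred_ne a δ m j l e] at this
      simpa [tsh, e] using this
  · intro j
    rw [sum_tsh, hb2]

theorem box_vroot {n : ℕ} {m : Fin 3 → L → ℕ} {a : Fin 3 → L} (hn : 2 ≤ n)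
    (ha : ∀ j, m j (a j) ≠ 0) (j : Fin 3) (l : L) (hl : m j l ≠ 0) : Box n m 1 (vroot a j l) := by
  refine ⟨le_refl _, by omega, ?_, ?_⟩
  · intro j' x
    by_cases e : j' = j
    · subst e
      by_cases e2 : x = l
      · subst e2; simp [vroot]; omega
      · simp [vroot, e2]
    · by_cases e2 : x = a j'
      · subst e2
        have := ha j'
        simp [vroot, e]; omega
      · simp [vroot, e, e2]
  · intro j'
    by_cases e : j' = j
    · subst e; simp [vroot]
    · simp [vroot, e]

theorem solv_reflC (n n' δ : ℕ) (m : Fin 3 → L → ℕ) (a : Fin 3 → L)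
    (C C' : ℤ → (Fin 3 → L → ℤ) → Prop) (hn : n = n' + δ) (hδ : 1 ≤ δ) (hn1 : 1 ≤ n')
    (hm : ∀ j, ∑ l, m j l = n)
    (hsum : m 0 (a 0) + m 1 (a 1) + m 2 (a 2) = n + δ) (hle : ∀ j, δ ≤ m j (a j))
    (hvar : ∀ j l, m j l ≠ 0 → C 1 (vroot a j l))
    (hR : ∀ κ t, Box n' (mred a δ m) κ t → C' κ t →
      ((∀ j, 0 ≤ t j (a j) + eps a κ t ∧ t j (a j) + eps a κ t ≤ m j (a j)) ∧
        1 ≤ κ + eps a κ t ∧ κ + eps a κ t < n ∧ C (κ + eps a κ t) (tsh a (eps a κ t) t)) ∨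
      IsLeg m (κ + eps a κ t) (tsh a (eps a κ t) t))
    (h : SolvR n' (mred a δ m) (BoxC n' (mred a δ m) C')) : SolvR n m (BoxC n m C) := by
  have hpos : ∀ j, m j (a j) ≠ 0 := fun j => by have := hle j; omega
  refine solv_reflect n n' δ m (mred a δ m) a _ _ hn hsum ?_ ?_ hm hpos ?_ ?_ h
  · intro j; rw [mred_self]; have := hle j; omega
  · intro j l hl; rw [mred_ne _ _ _ _ _ hl]
  · intro j l hl
    exact Or.inl ⟨box_vroot (by omega) hpos j l hl, hvar j l hl⟩
  · intro κ t ht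
    rcases hR κ t ht.1 ht.2 with ⟨h1, h2, h3, h4⟩ | h
    · exact Or.inl ⟨box_tsh ht.1 h1 h2 h3, h4⟩
    · exact Or.inr h

theorem box_S {n : ℕ} {m : Fin 3 → L → ℕ} {κ : ℤ} {t} (hb : Box n m κ t)
    (hm : ∀ j, ∑ l, m j l = n) (j) (S : Finset L) :
    ∑ l ∈ S, t j l ≤ κ ∧ κ ≤ ∑ l ∈ S, t j l + (n - ∑ l ∈ S, (m j l : ℤ)) := by
  obtain ⟨_, _, hb1, hb2⟩ := hb
  have e1 := Finset.sum_add_sum_compl S (t j)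
  have e2 := Finset.sum_add_sum_compl S (fun l => (m j l : ℤ))
  have e3 : ∑ l, (m j l : ℤ) = n := by rw [← hm j]; push_cast; rfl
  have e4 : 0 ≤ ∑ l ∈ Sᶜ, t j l := Finset.sum_nonneg (fun l _ => (hb1 j l).1)
  have e5 : ∑ l ∈ Sᶜ, t j l ≤ ∑ l ∈ Sᶜ, (m j l : ℤ) := Finset.sum_le_sum (fun l _ => (hb1 j l).2)
  have e6 := hb2 j
  constructor <;> linarith

theorem box_1 {n : ℕ} {m : Fin 3 → L → ℕ} {κ : ℤ} {t} (hb : Box n m κ t)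
    (hm : ∀ j, ∑ l, m j l = n) (j) (f : L) :
    t j f ≤ κ ∧ κ ≤ t j f + (n - (m j f : ℤ)) := by
  have := box_S hb hm j {f}
  simpa using this

theorem box_2 {n : ℕ} {m : Fin 3 → L → ℕ} {κ : ℤ} {t} (hb : Box n m κ t)
    (hm : ∀ j, ∑ l, m j l = n) (j) (f g : L) (h : f ≠ g) :
    t j f + t j g ≤ κ ∧ κ ≤ t j f + t j g + (n - (m j f : ℤ) - (m j g : ℤ)) := by
  have := box_S hb hm j {f, g}
  rw [Finset.sum_pair h, Finset.sum_pair h] at this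
  constructor
  · exact this.1
  · linarith [this.2]

theorem box_3 {n : ℕ} {m : Fin 3 → L → ℕ} {κ : ℤ} {t} (hb : Box n m κ t)
    (hm : ∀ j, ∑ l, m j l = n) (j) (f g k : L) (h : f ≠ g) (h1 : f ≠ k) (h2 : g ≠ k) :
    t j f + t j g + t j k ≤ κ ∧ κ ≤ t j f + t j g + t j k +
      (n - (m j f : ℤ) - (m j g : ℤ) - (m j k : ℤ)) := by
  have := box_S hb hm j {f, g, k}
  rw [Finset.sum_insert (by simp [h, h1]), Finset.sum_pair h2,
    Finset.sum_insert (by simp [h, h1]), Finset.sum_pair h2] at this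
  constructor
  · linarith [this.1]
  · linarith [this.2]

theorem box_one {n : ℕ} {m : Fin 3 → L → ℕ} {t} (hb : Box n m 1 t) (j) :
    ∃ l, m j l ≠ 0 ∧ ∀ x, t j x = if x = l then 1 else 0 := by
  obtain ⟨_, _, hb1, hb2⟩ := hb
  have h0 : ∃ l, t j l ≠ 0 := by
    by_contra hc
    push Not at hc
    have := hb2 j
    simp [hc] at this
  obtain ⟨l, hl⟩ := h0
  have h1 := hb2 j
  rw [← Finset.sum_erase_add _ _ (Finset.mem_univ l)] at h1
  have h2 : 0 ≤ ∑ x ∈ Finset.univ.erase l, t j x := Finset.sum_nonneg (fun l _ => (hb1 j l).1)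
  have h3 := hb1 j l
  have h4 : ∑ x ∈ Finset.univ.erase l, t j x = 0 := by omega
  refine ⟨l, by omega, ?_⟩
  intro x
  by_cases e : x = l
  · subst e; simp; omega
  · simp only [e, if_false]
    exact (Finset.sum_eq_zero_iff_of_nonneg (fun l _ => (hb1 j l).1)).1 h4 x (by simp [e])

theorem box_one_eq {n : ℕ} {m : Fin 3 → L → ℕ} {t} (hb : Box n m 1 t) (j) (f : L) (hf : t j f = 1) :
    ∀ x, t j x = if x = f then 1 else 0 := by
  obtain ⟨l, _, h⟩ := box_one hb j
  have := h f
  rw [hf] at this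
  by_cases e : f = l
  · subst e; exact h
  · simp [e] at this

/-- a label in slot `0` of multiplicity one -/
theorem exists_c {n : ℕ} {m : L → ℕ} (hm : ∑ l, m l = n) (hn : 1 ≤ n) (h1 : ∀ l, m l ≤ 1) :
    ∃ c, m c = 1 := by
  by_contra hc
  push Not at hc
  have : ∀ l, m l = 0 := fun l => by have := h1 l; have := hc l; omega
  simp [this] at hm
  omega

end boxes

end partB1

section partB2
open Matrix BigOperators
open Module
set_option linter.unusedSectionVars false
set_option linter.unusedSimpArgs false
set_option linter.unusedDecidableInType false

section bases
variable {L : Type} [Fintype L] [DecidableEq L]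

theorem sum_mred2 {a : Fin 3 → L} {δ n n' : ℕ} {m : Fin 3 → L → ℕ} (hm : ∀ j, ∑ l, m j l = n)
    (hn : n = n' + δ) (hle : ∀ j, δ ≤ m j (a j)) : ∀ j, ∑ l, mred a δ m j l = n' := by
  intro j
  have := sum_mred a δ m j (hle j)
  have := hm j
  omega

theorem base2 (m : Fin 3 → L → ℕ) (hm : ∀ j, ∑ l, m j l = 2) (a : Fin 3 → L)
    (ha : ∀ j, m j (a j) = 1) : SolvR 2 m (BoxC 2 m (fun _ _ => True)) := by
  apply solv_reflC 2 1 1 m a (fun _ _ => True) (fun _ _ => False) rfl (le_refl _) (le_refl _) hm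
  · rw [ha, ha, ha]
  · intro j; rw [ha]
  · intros; trivial
  · intro κ t _ h; exact h.elim
  · apply solv_one
    exact sum_mred2 hm rfl (fun j => by rw [ha])

theorem base3 (m : Fin 3 → L → ℕ) (hm : ∀ j, ∑ l, m j l = 3) (h0 : ∀ l, m 0 l ≤ 1)
    (D s1 s2 p q : L) (n1 : D ≠ s1) (n2 : D ≠ s2) (n3 : s1 ≠ s2) (n4 : p ≠ q)
    (hD : m 1 D = 1) (hs1 : m 1 s1 = 1) (hs2 : m 1 s2 = 1) (hp : m 2 p = 2) (hq : m 2 q = 1) :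
    SolvR 3 m (BoxC 3 m (fun κ t => (0 ≤ κ - t 1 D - t 2 q ∧ κ - t 1 D - t 2 q ≤ 1) ∧
      (0 ≤ κ - t 1 s2 - t 2 q ∧ κ - t 1 s2 - t 2 q ≤ 1))) := by
  obtain ⟨c, hc⟩ := exists_c (hm 0) (by norm_num) h0
  have hle : ∀ j, 1 ≤ m j ((![c, s1, p] : Fin 3 → L) j) := by
    intro j; fin_cases j <;> simp <;> omega
  have hm' := sum_mred2 (n' := 2) hm rfl hle
  apply solv_reflC 3 2 1 m ![c, s1, p] _ (fun _ _ => True) rfl (le_refl _) (by norm_num) hm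
  · simp; omega
  · exact hle
  · intro j l hl
    fin_cases j <;> simp [vroot, n1, n2, n3, n4, n1.symm, n2.symm, n3.symm, n4.symm] <;> split_ifs <;> simp_all
  · intro κ t hb _
    left
    have b0 := box_1 hb hm' 0 c
    have b1 := box_3 hb hm' 1 D s1 s2 n1 n2 n3
    have b2 := box_2 hb hm' 2 p q n4
    have c0 := hb.2.2.1 0 c
    have c1 := hb.2.2.1 1 D
    have c2 := hb.2.2.1 1 s1
    have c3 := hb.2.2.1 1 s2
    have c4 := hb.2.2.1 2 p
    have c5 := hb.2.2.1 2 q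
    have k1 := hb.1
    have k2 := hb.2.1
    simp [mred, hD, hs1, hs2, hp, hq, hc, n1, n2, n3, n4, n1.symm, n2.symm, n3.symm, n4.symm] at b0 b1 b2 c0 c1 c2 c3 c4 c5
    simp [eps, tsh, hD, hs1, hs2, hp, hq, hc, n1, n2, n3, n4, n1.symm, n2.symm, n3.symm, n4.symm, Fin.forall_fin_succ]
    omega
  · obtain ⟨c', hc'⟩ := exists_c (hm' 0) (by norm_num) (fun l => le_trans (Nat.sub_le _ _) (h0 l))
    apply base2 _ hm' ![c', D, p]
    intro j
    fin_cases j
    · exact hc'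
    · simp [mred, n1, hD]
    · simp [mred, hp]

def C4 (s1 s2 p q : L) (κ : ℤ) (t : Fin 3 → L → ℤ) : Prop :=
  ((0 ≤ κ - t 1 s1 - t 2 p ∧ κ - t 1 s1 - t 2 p ≤ 1) ∧
   (0 ≤ κ - t 1 s2 - t 2 p ∧ κ - t 1 s2 - t 2 p ≤ 1) ∧
   (0 ≤ κ - t 1 s2 - t 2 q ∧ κ - t 1 s2 - t 2 q ≤ 1)) ∨ (κ = 1 ∧ t 1 s2 = 1 ∧ t 2 q = 1)

theorem base4 (m : Fin 3 → L → ℕ) (hm : ∀ j, ∑ l, m j l = 4) (h0 : ∀ l, m 0 l ≤ 1)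
    (D s1 s2 p q : L) (n1 : D ≠ s1) (n2 : D ≠ s2) (n3 : s1 ≠ s2) (n4 : p ≠ q)
    (hD : m 1 D = 2) (hs1 : m 1 s1 = 1) (hs2 : m 1 s2 = 1) (hp : m 2 p = 2) (hq : m 2 q = 2) :
    SolvR 4 m (BoxC 4 m (C4 s1 s2 p q)) := by
  obtain ⟨c, hc⟩ := exists_c (hm 0) (by norm_num) h0
  have hle : ∀ j, 1 ≤ m j ((![c, D, q] : Fin 3 → L) j) := by
    intro j; fin_cases j <;> simp <;> omega
  have hm' := sum_mred2 (n' := 3) hm rfl hle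
  apply solv_reflC 4 3 1 m ![c, D, q] _ (fun κ t => (0 ≤ κ - t 1 D - t 2 q ∧ κ - t 1 D - t 2 q ≤ 1) ∧
      (0 ≤ κ - t 1 s2 - t 2 q ∧ κ - t 1 s2 - t 2 q ≤ 1)) rfl (le_refl _) (by norm_num) hm
  · simp; omega
  · exact hle
  · intro j l hl
    fin_cases j <;> simp [C4, vroot, n1, n2, n3, n4, n1.symm, n2.symm, n3.symm, n4.symm] <;> split_ifs <;> simp_all
  · intro κ t hb hC
    left
    have b0 := box_1 hb hm' 0 c
    have b1 := box_3 hb hm' 1 D s1 s2 n1 n2 n3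
    have b2 := box_2 hb hm' 2 p q n4
    have c0 := hb.2.2.1 0 c
    have c1 := hb.2.2.1 1 D
    have c2 := hb.2.2.1 1 s1
    have c3 := hb.2.2.1 1 s2
    have c4 := hb.2.2.1 2 p
    have c5 := hb.2.2.1 2 q
    have k1 := hb.1
    have k2 := hb.2.1
    simp [mred, hD, hs1, hs2, hp, hq, hc, n1, n2, n3, n4, n1.symm, n2.symm, n3.symm, n4.symm] at b0 b1 b2 c0 c1 c2 c3 c4 c5
    simp [C4, eps, tsh, hD, hs1, hs2, hp, hq, hc, n1, n2, n3, n4, n1.symm, n2.symm, n3.symm, n4.symm, Fin.forall_fin_succ]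
    omega
  · apply base3 _ hm' (fun l => le_trans (Nat.sub_le _ _) (h0 l)) D s1 s2 p q n1 n2 n3 n4 <;>
      simp [mred, hD, hs1, hs2, hp, hq, n1, n2, n3, n4, n1.symm, n2.symm, n3.symm, n4.symm]

/-- condition of a half state -/
def Chalf (f g p q : L) (κ : ℤ) (t : Fin 3 → L → ℤ) : Prop :=
  ((0 ≤ κ - t 1 f - t 2 p ∧ κ - t 1 f - t 2 p ≤ 1) ∧
   (0 ≤ κ - t 1 g - t 2 q ∧ κ - t 1 g - t 2 q ≤ 1)) ∨ (κ = 1 ∧ t 1 f = 1 ∧ t 2 p = 1) ∨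
   (κ = 1 ∧ t 1 g = 1 ∧ t 2 q = 1)

theorem base5 (m : Fin 3 → L → ℕ) (hm : ∀ j, ∑ l, m j l = 5) (h0 : ∀ l, m 0 l ≤ 1)
    (f g h p q : L) (n1 : f ≠ g) (n2 : f ≠ h) (n3 : g ≠ h) (n4 : p ≠ q)
    (hf : m 1 f = 1) (hg : m 1 g = 2) (hh : m 1 h = 2) (hp : m 2 p = 3) (hq : m 2 q = 2) :
    SolvR 5 m (BoxC 5 m (Chalf f g p q)) := by
  obtain ⟨c, hc⟩ := exists_c (hm 0) (by norm_num) h0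
  have hle : ∀ j, 1 ≤ m j ((![c, h, p] : Fin 3 → L) j) := by
    intro j; fin_cases j <;> simp <;> omega
  have hm' := sum_mred2 (n' := 4) hm rfl hle
  apply solv_reflC 5 4 1 m ![c, h, p] _ (fun κ t => (0 ≤ κ - t 1 h - t 2 p ∧ κ - t 1 h - t 2 p ≤ 1) ∧
      (0 ≤ κ - t 1 f - t 2 p ∧ κ - t 1 f - t 2 p ≤ 1)) rfl (le_refl _) (by norm_num) hm
  · simp; omega
  · exact hle
  · intro j l hl
    fin_cases j <;> simp [Chalf, vroot, n1, n2, n3, n4, n1.symm, n2.symm, n3.symm, n4.symm] <;> split_ifs <;> simp_all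
  · intro κ t hb hC
    left
    have b0 := box_1 hb hm' 0 c
    have b1 := box_3 hb hm' 1 f g h n1 n2 n3
    have b2 := box_2 hb hm' 2 p q n4
    have c0 := hb.2.2.1 0 c
    have c1 := hb.2.2.1 1 f
    have c2 := hb.2.2.1 1 g
    have c3 := hb.2.2.1 1 h
    have c4 := hb.2.2.1 2 p
    have c5 := hb.2.2.1 2 q
    have k1 := hb.1
    have k2 := hb.2.1
    simp [mred, hf, hg, hh, hp, hq, hc, n1, n2, n3, n4, n1.symm, n2.symm, n3.symm, n4.symm] at b0 b1 b2 c0 c1 c2 c3 c4 c5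
    simp [Chalf, eps, tsh, hf, hg, hh, hp, hq, hc, n1, n2, n3, n4, n1.symm, n2.symm, n3.symm, n4.symm, Fin.forall_fin_succ]
    omega
  · have h4 := base4 (mred ![c, h, p] 1 m) hm' (fun l => le_trans (Nat.sub_le _ _) (h0 l)) g h f p q
      n3 n1.symm n2.symm n4
      (by simp [mred, hg, n3]) (by simp [mred, hh]) (by simp [mred, hf, n2]) (by simp [mred, hp])
      (by simp [mred, hq, n4.symm])
    apply h4.mono
    rintro κ t ⟨hb, hC⟩
    refine ⟨hb, ?_⟩
    have b1 := box_3 hb hm' 1 f g h n1 n2 n3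
    have b2 := box_2 hb hm' 2 p q n4
    have c1 := hb.2.2.1 1 f
    have c2 := hb.2.2.1 1 g
    have c3 := hb.2.2.1 1 h
    have c4 := hb.2.2.1 2 p
    have c5 := hb.2.2.1 2 q
    simp only [C4] at hC
    omega

end bases

end partB2

section partB3
open Matrix BigOperators
open Module
set_option linter.unusedSectionVars false
set_option linter.unusedSimpArgs false
set_option linter.unusedDecidableInType false

section chains
variable {L : Type} [Fintype L] [DecidableEq L]

def CT : ℤ → (Fin 3 → L → ℤ) → Prop := fun _ _ => True

/-- from a full state to a half state -/
theorem full_to_half (n : ℕ) (m : Fin 3 → L → ℕ) (hm : ∀ j, ∑ l, m j l = n + 1) (hn : 1 ≤ n)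
    (c f g p q : L) (n1 : f ≠ g) (n2 : p ≠ q) (hc : m 0 c = 1) (hfp : m 1 f + m 2 p = n + 1)
    (hgq : m 1 g + m 2 q + 1 = n) (hf : 1 ≤ m 1 f) (hp : 1 ≤ m 2 p)
    (h : SolvR n (mred ![c, f, p] 1 m) (BoxC n (mred ![c, f, p] 1 m) (Chalf f g p q))) :
    SolvR (n + 1) m (BoxC (n + 1) m CT) := by
  have hle : ∀ j, 1 ≤ m j ((![c, f, p] : Fin 3 → L) j) := by
    intro j; fin_cases j <;> simp <;> omega
  have hm' := sum_mred2 (n' := n) hm rfl hle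
  apply solv_reflC (n + 1) n 1 m ![c, f, p] _ _ rfl (le_refl _) hn hm _ hle _ _ h
  · simp; omega
  · intros; trivial
  · intro κ t hb hC
    have b0 := box_1 hb hm' 0 c
    have b1 := box_2 hb hm' 1 f g n1
    have b2 := box_2 hb hm' 2 p q n2
    have c0 := hb.2.2.1 0 c
    have c1 := hb.2.2.1 1 f
    have c2 := hb.2.2.1 1 g
    have c4 := hb.2.2.1 2 p
    have c5 := hb.2.2.1 2 q
    have k1 := hb.1
    have k2 := hb.2.1
    by_cases hsp : κ = 1 ∧ t 1 f = 1 ∧ t 2 p = 1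
    · right
      obtain ⟨rfl, h1, h2⟩ := hsp
      have e1 := box_one_eq hb 1 f h1
      have e2 := box_one_eq hb 2 p h2
      obtain ⟨l, hl, e0⟩ := box_one hb 0
      have hlc : l ≠ c := by
        rintro rfl
        simp [mred, hc] at hl
      have hl' : m 0 l ≠ 0 := by
        simpa [mred, hlc] using hl
      have e3 : eps ![c, f, p] 1 t = -1 := by
        simp [eps, h1, h2, e0, hlc.symm]
      rw [e3]
      refine ⟨by norm_num, 0, l, c, hlc, hl', by omega, ?_⟩
      intro j x
      fin_cases j
      · by_cases h3 : x = l
        · simp [tsh, e0, h3, hlc]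
        · by_cases h4 : x = c <;> simp [tsh, e0, h3, h4, hlc.symm]
      · by_cases h3 : x = f <;> simp [tsh, e1, h3]
      · by_cases h3 : x = p <;> simp [tsh, e2, h3]
    · left
      simp [mred, hc, n1, n2, n1.symm, n2.symm] at b0 b1 b2 c0 c1 c2 c4 c5
      simp only [Chalf] at hC
      simp [eps, tsh, hc, n1, n2, n1.symm, n2.symm, Fin.forall_fin_succ]
      refine ⟨by omega, by omega, by omega, trivial⟩

theorem gamma_step (n : ℕ) (m : Fin 3 → L → ℕ) (hm : ∀ j, ∑ l, m j l = n + 2) (hn : 1 ≤ n)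
    (a b f : L) (ha : m 0 a = 2) (hb : m 1 b = 2) (hf : m 2 f = n) (hn2 : 2 ≤ n)
    (h : SolvR n (mred ![a, b, f] 2 m) (BoxC n (mred ![a, b, f] 2 m) CT)) :
    SolvR (n + 2) m (BoxC (n + 2) m CT) := by
  have hle : ∀ j, 2 ≤ m j ((![a, b, f] : Fin 3 → L) j) := by
    intro j; fin_cases j <;> simp <;> omega
  have hm' := sum_mred2 (n' := n) hm rfl hle
  apply solv_reflC (n + 2) n 2 m ![a, b, f] _ _ rfl (by norm_num) hn hm _ hle _ _ h
  · simp; omega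
  · intros; trivial
  · intro κ t hb' hC
    left
    have b0 := box_1 hb' hm' 0 a
    have b1 := box_1 hb' hm' 1 b
    have b2 := box_1 hb' hm' 2 f
    have c0 := hb'.2.2.1 0 a
    have c1 := hb'.2.2.1 1 b
    have c2 := hb'.2.2.1 2 f
    have k1 := hb'.1
    have k2 := hb'.2.1
    simp [mred, ha, hb, hf] at b0 b1 b2 c0 c1 c2
    simp [eps, tsh, ha, hb, hf, Fin.forall_fin_succ]
    refine ⟨by omega, by omega, by omega, trivial⟩

theorem half_step (n : ℕ) (m : Fin 3 → L → ℕ) (hm : ∀ j, ∑ l, m j l = n + 2) (hn : 1 ≤ n)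
    (a f g p q : L) (n1 : f ≠ g) (n2 : p ≠ q) (ha : m 0 a = 2) (hfp : m 1 f + m 2 p = n + 1)
    (hgq : m 1 g + m 2 q = n + 1) (hf : 1 ≤ m 1 f) (hp : 1 ≤ m 2 p) (hg : 1 ≤ m 1 g) (hq : 1 ≤ m 2 q)
    (h : SolvR n (mred ![a, g, q] 1 (mred ![a, f, p] 1 m))
      (BoxC n (mred ![a, g, q] 1 (mred ![a, f, p] 1 m)) (Chalf f g p q))) :
    SolvR (n + 2) m (BoxC (n + 2) m (Chalf f g p q)) := by
  have hle : ∀ j, 1 ≤ m j ((![a, f, p] : Fin 3 → L) j) := by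
    intro j; fin_cases j <;> simp <;> omega
  have hm' := sum_mred2 (n' := n + 1) hm rfl hle
  have hle2 : ∀ j, 1 ≤ (mred ![a, f, p] 1 m) j ((![a, g, q] : Fin 3 → L) j) := by
    intro j; fin_cases j <;> simp [mred, ha, n1.symm, n2.symm] <;> omega
  have hm'' := sum_mred2 (n' := n) hm' rfl hle2
  have hpos : ∀ j, m j ((![a, f, p] : Fin 3 → L) j) ≠ 0 := fun j => by have := hle j; omega
  have hpos2 : ∀ j, (mred ![a, f, p] 1 m) j ((![a, g, q] : Fin 3 → L) j) ≠ 0 :=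
    fun j => by have := hle2 j; omega
  refine solv_reflect (n + 2) (n + 1) 1 m (mred ![a, f, p] 1 m) ![a, f, p] _
    (fun κ t => BoxC (n + 2) m (Chalf f g p q) (κ + eps ![a, f, p] κ t)
      (tsh ![a, f, p] (eps ![a, f, p] κ t) t) ∨
      IsLeg m (κ + eps ![a, f, p] κ t) (tsh ![a, f, p] (eps ![a, f, p] κ t) t)) rfl ?_ ?_ ?_ hm hpos
      ?_ (fun κ t h => h) ?_
  · simp; omega
  · intro j; rw [mred_self]; have := hle j; omega
  · intro j l hl; rw [mred_ne _ _ _ _ _ hl]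
  · intro j l hl
    left
    refine ⟨box_vroot (by omega) hpos j l hl, ?_⟩
    fin_cases j <;> simp [Chalf, vroot, n1, n2, n1.symm, n2.symm] <;> split_ifs <;> simp_all
  · refine solv_reflect (n + 1) n 1 (mred ![a, f, p] 1 m) _ ![a, g, q] _ _ rfl ?_ ?_ ?_ hm' hpos2
      ?_ ?_ h
    · simp [mred, ha, n1.symm, n2.symm]; omega
    · intro j; rw [mred_self _ _ _ j]; have := hle2 j; omega
    · intro j l hl; rw [mred_ne _ _ _ _ _ hl]
    · intro j l hl
      left
      have hbv := box_vroot (n := n + 1) (by omega) hpos2 j l hl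
      fin_cases j
      · left
        by_cases e : l = a
        · subst e
          have e3 : eps ![l, f, p] 1 (vroot ![l, g, q] 0 l) = 0 := by
            simp [eps, vroot, n1, n2]
          have hb2 := box_tsh (n := n + 2) (ε := 0) hbv (by
            intro j; fin_cases j <;> simp [vroot, n1, n2, ha]) (by norm_num) (by omega)
          simp only [Fin.zero_eta, Fin.mk_one]
          rw [e3]
          refine ⟨hb2, ?_⟩
          simp [Chalf, tsh, vroot, n1, n2, n1.symm, n2.symm]
        · have e3 : eps ![a, f, p] 1 (vroot ![a, g, q] 0 l) = 1 := by
            simp [eps, vroot, n1, n2, Ne.symm e]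
          have hb2 := box_tsh (n := n + 2) (ε := 1) hbv (by
            intro j; fin_cases j <;> simp [vroot, n1, n2, ha, Ne.symm e] <;> omega) (by norm_num) (by omega)
          simp only [Fin.zero_eta, Fin.mk_one]
          rw [e3]
          refine ⟨hb2, ?_⟩
          simp [Chalf, tsh, vroot, n1, n2, n1.symm, n2.symm]
      · by_cases e : l = f
        · subst e
          right
          have e3 : eps ![a, l, p] 1 (vroot ![a, g, q] 1 l) = -1 := by
            simp [eps, vroot, n1, n2]
          simp only [Fin.zero_eta, Fin.mk_one]
          rw [e3]
          refine ⟨by norm_num, 2, q, p, n2.symm, by omega, by omega, ?_⟩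
          intro j x
          fin_cases j
          · by_cases h3 : x = a <;> simp [tsh, vroot, h3]
          · by_cases h3 : x = l <;> simp [tsh, vroot, h3]
          · by_cases h3 : x = p
            · simp [tsh, vroot, h3, n2]
            · by_cases h4 : x = q <;> simp [tsh, vroot, h3, h4, n2.symm]
        · left
          have e3 : eps ![a, f, p] 1 (vroot ![a, g, q] 1 l) = 0 := by
            simp [eps, vroot, n1, n2, Ne.symm e]
          have hb2 := box_tsh (n := n + 2) (ε := 0) hbv (by
            intro j; fin_cases j <;> simp [vroot, n1, n2, ha, Ne.symm e]) (by norm_num) (by omega)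
          simp only [Fin.zero_eta, Fin.mk_one]
          rw [e3]
          refine ⟨hb2, ?_⟩
          simp [Chalf, tsh, vroot, n1, n2, n1.symm, n2.symm, Ne.symm e]
          split_ifs <;> simp_all
      · by_cases e : l = p
        · subst e
          right
          have e3 : eps ![a, f, l] 1 (vroot ![a, g, q] 2 l) = -1 := by
            simp [eps, vroot, n1, n2]
          simp only [Fin.reduceFinMk]
          rw [e3]
          refine ⟨by norm_num, 1, g, f, n1.symm, by omega, by omega, ?_⟩
          intro j x
          fin_cases j
          · by_cases h3 : x = a <;> simp [tsh, vroot, h3]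
          · by_cases h3 : x = f
            · simp [tsh, vroot, h3, n1]
            · by_cases h4 : x = g <;> simp [tsh, vroot, h3, h4, n1.symm]
          · by_cases h3 : x = l <;> simp [tsh, vroot, h3]
        · left
          have e3 : eps ![a, f, p] 1 (vroot ![a, g, q] 2 l) = 0 := by
            simp [eps, vroot, n1, n2, Ne.symm e]
          have hb2 := box_tsh (n := n + 2) (ε := 0) hbv (by
            intro j; fin_cases j <;> simp [vroot, n1, n2, ha, Ne.symm e]) (by norm_num) (by omega)
          simp only [Fin.reduceFinMk]
          rw [e3]
          refine ⟨hb2, ?_⟩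
          simp [Chalf, tsh, vroot, n1, n2, n1.symm, n2.symm, Ne.symm e]
          split_ifs <;> simp_all
    · rintro κ t ⟨hb, hC⟩
      left
      left
      have b0 := box_1 hb hm'' 0 a
      have b1 := box_2 hb hm'' 1 f g n1
      have b2 := box_2 hb hm'' 2 p q n2
      have c0 := hb.2.2.1 0 a
      have c1 := hb.2.2.1 1 f
      have c2 := hb.2.2.1 1 g
      have c4 := hb.2.2.1 2 p
      have c5 := hb.2.2.1 2 q
      have k1 := hb.1
      have k2 := hb.2.1
      simp [mred, ha, n1, n2, n1.symm, n2.symm] at b0 b1 b2 c0 c1 c2 c4 c5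
      simp only [Chalf] at hC
      have t0 : t 0 a = 0 := by omega
      set X := κ - t 1 f - t 2 p with hX
      set Y := κ - t 1 g - t 2 q with hY
      have e1 : eps ![a, g, q] κ t = Y := by simp [eps, t0, hY]; ring
      rw [e1]
      have e2 : eps ![a, f, p] (κ + Y) (tsh ![a, g, q] Y t) = X := by
        simp [eps, tsh, t0, n1, n2, hX]; ring
      rw [e2]
      refine ⟨⟨by omega, by push_cast; omega, ?_, ?_⟩, ?_⟩
      · intro j l
        have hj := hb.2.2.1 j l
        fin_cases j
        · by_cases e : l = a
          · subst e; simp [tsh, t0, ha]; omega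
          · simp [tsh, e]; simpa [mred, e] using hj
        · by_cases e : l = f
          · subst e; simp [tsh, n1]; omega
          · by_cases e' : l = g
            · subst e'; simp [tsh, e]; omega
            · simp [tsh, e, e']; simpa [mred, e, e'] using hj
        · by_cases e : l = p
          · subst e; simp [tsh, n2]; omega
          · by_cases e' : l = q
            · subst e'; simp [tsh, e]; omega
            · simp [tsh, e, e']; simpa [mred, e, e'] using hj
      · intro j
        rw [sum_tsh, sum_tsh, hb.2.2.2]
      · simp [Chalf, tsh, n1, n2, n1.symm, n2.symm]
        omega

theorem Chalf_symm {f g p q : L} {κ : ℤ} {t : Fin 3 → L → ℤ} (h : Chalf f g p q κ t) :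
    Chalf g f q p κ t := by
  simp only [Chalf] at h ⊢
  omega

theorem half_chain (s x0 y0 z0 w0 : ℕ) (f g p q : L) (r1 r2 : L → ℕ) (n1 : f ≠ g) (n2 : p ≠ q)
    (hs : 1 ≤ s) (hxz : x0 + z0 + 1 = s) (hyw : y0 + w0 + 1 = s)
    (hbase : ∀ m : Fin 3 → L → ℕ, (∀ j, ∑ l, m j l = s) → (∀ l, m 0 l ≤ 1) → m 1 f = x0 →
      m 1 g = y0 → m 2 p = z0 → m 2 q = w0 → (∀ l, l ≠ f → l ≠ g → m 1 l = r1 l) →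
      (∀ l, l ≠ p → l ≠ q → m 2 l = r2 l) → SolvR s m (BoxC s m (Chalf f g p q))) :
    ∀ (k : ℕ) (m : Fin 3 → L → ℕ), (∀ j, ∑ l, m j l = s + 2 * k) → (∀ l, m 0 l ≤ 2) →
      (Finset.univ.filter (fun l => m 0 l = 2)).card = k → m 1 f = x0 + k →
      m 1 g = y0 + k → m 2 p = z0 + k → m 2 q = w0 + k → (∀ l, l ≠ f → l ≠ g → m 1 l = r1 l) →
      (∀ l, l ≠ p → l ≠ q → m 2 l = r2 l) → SolvR (s + 2 * k) m (BoxC (s + 2 * k) m (Chalf f g p q)) := by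
  intro k
  induction k with
  | zero =>
    intro m hm h2 hk hf hg hp hq hr1 hr2
    apply hbase m hm _ hf hg hp hq hr1 hr2
    intro l
    rw [Finset.card_eq_zero, Finset.filter_eq_empty_iff] at hk
    have := hk (Finset.mem_univ l)
    have := h2 l
    omega
  | succ k ih =>
    intro m hm h2 hk hf hg hp hq hr1 hr2
    have hne : (Finset.univ.filter (fun l => m 0 l = 2)).Nonempty := by
      rw [← Finset.card_pos]; omega
    obtain ⟨a, ha⟩ := hne
    have ha2 : m 0 a = 2 := (Finset.mem_filter.1 ha).2
    have hle : ∀ j, 1 ≤ m j ((![a, f, p] : Fin 3 → L) j) := by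
      intro j; fin_cases j <;> simp <;> omega
    have hm' := sum_mred2 (n' := s + 2 * k + 1) hm rfl hle
    have hle2 : ∀ j, 1 ≤ (mred ![a, f, p] 1 m) j ((![a, g, q] : Fin 3 → L) j) := by
      intro j; fin_cases j <;> simp [mred, ha2, n1.symm, n2.symm] <;> omega
    have hm'' := sum_mred2 (n' := s + 2 * k) hm' rfl hle2
    apply half_step (s + 2 * k) m hm (by omega) a f g p q n1 n2 ha2 (by omega) (by omega)
      (by omega) (by omega) (by omega) (by omega)
    apply ih _ hm''
    · intro l
      have := h2 l
      simp only [mred]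
      omega
    · have : (Finset.univ.filter (fun l => mred ![a, g, q] 1 (mred ![a, f, p] 1 m) 0 l = 2)) =
          (Finset.univ.filter (fun l => m 0 l = 2)).erase a := by
        ext l
        simp only [Finset.mem_filter, Finset.mem_univ, true_and, Finset.mem_erase]
        by_cases e : l = a
        · subst e; simp [mred, ha2]
        · simp [mred, e]
      rw [this, Finset.card_erase_of_mem ha, hk]
      rfl
    · simp [mred, hf, n1]
    · simp [mred, hg, n1.symm]
    · simp [mred, hp, n2]
    · simp [mred, hq, n2.symm]
    · intro l e e'; simp [mred, e, e']; exact hr1 l e e'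
    · intro l e e'; simp [mred, e, e']; exact hr2 l e e'

end chains

end partB3

section partB4
open Matrix BigOperators
open Module
set_option linter.unusedSectionVars false
set_option linter.unusedSimpArgs false
set_option linter.unusedDecidableInType false

section fams
variable {L : Type} [Fintype L] [DecidableEq L]

/-- `m` consists of `k` twos and `s` ones -/
def TwoOne (m : L → ℕ) (k s : ℕ) : Prop :=
  (∀ l, m l ≤ 2) ∧ (Finset.univ.filter (fun l => m l = 2)).card = k ∧
    (Finset.univ.filter (fun l => m l = 1)).card = s

theorem TwoOne.le_one {m : L → ℕ} {s : ℕ} (h : TwoOne m 0 s) (l : L) : m l ≤ 1 := by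
  have h1 := h.2.1
  rw [Finset.card_eq_zero, Finset.filter_eq_empty_iff] at h1
  have := h1 (Finset.mem_univ l)
  have := h.1 l
  omega

theorem TwoOne.exists_one {m : L → ℕ} {k s : ℕ} (h : TwoOne m k s) (hs : 1 ≤ s) : ∃ c, m c = 1 := by
  have h1 := h.2.2
  have : 0 < (Finset.univ.filter (fun l => m l = 1)).card := by omega
  rw [Finset.card_pos] at this
  obtain ⟨c, hc⟩ := this
  exact ⟨c, (Finset.mem_filter.1 hc).2⟩

theorem TwoOne.exists_two {m : L → ℕ} {k s : ℕ} (h : TwoOne m k s) (hs : 1 ≤ k) : ∃ c, m c = 2 := by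
  have h1 := h.2.1
  have : 0 < (Finset.univ.filter (fun l => m l = 2)).card := by omega
  rw [Finset.card_pos] at this
  obtain ⟨c, hc⟩ := this
  exact ⟨c, (Finset.mem_filter.1 hc).2⟩

theorem TwoOne.mred2 {m : Fin 3 → L → ℕ} {k s : ℕ} {a : Fin 3 → L} {j : Fin 3} (h : TwoOne (m j) (k + 1) s)
    (ha : m j (a j) = 2) : TwoOne (mred a 2 m j) k s := by
  refine ⟨fun l => le_trans (Nat.sub_le _ _) (h.1 l), ?_, ?_⟩
  · have : (Finset.univ.filter (fun l => mred a 2 m j l = 2)) =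
        (Finset.univ.filter (fun l => m j l = 2)).erase (a j) := by
      ext l
      simp only [Finset.mem_filter, Finset.mem_univ, true_and, Finset.mem_erase]
      by_cases e : l = a j
      · subst e; simp [mred, ha]
      · simp [mred, e]
    rw [this, Finset.card_erase_of_mem (by simp [ha]), h.2.1]
    rfl
  · rw [← h.2.2]
    congr 1
    ext l
    simp only [Finset.mem_filter, Finset.mem_univ, true_and]
    by_cases e : l = a j
    · subst e; simp [mred, ha]
    · simp [mred, e]

theorem exists_three {m : L → ℕ} {v : ℕ} (h : (Finset.univ.filter (fun l => m l = v)).card = 3) :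
    ∃ x y z, x ≠ y ∧ x ≠ z ∧ y ≠ z ∧ m x = v ∧ m y = v ∧ m z = v := by
  obtain ⟨x, y, z, h1, h2, h3, h4⟩ := Finset.card_eq_three.1 h
  have : ∀ w, w ∈ ({x, y, z} : Finset L) → m w = v := by
    intro w hw
    rw [← h4] at hw
    exact (Finset.mem_filter.1 hw).2
  exact ⟨x, y, z, h1, h2, h3, this x (by simp), this y (by simp), this z (by simp)⟩

theorem exists_pair {m : L → ℕ} {v : ℕ} (h : (Finset.univ.filter (fun l => m l = v)).card = 2) :
    ∃ x y, x ≠ y ∧ m x = v ∧ m y = v := by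
  obtain ⟨x, y, h1, h4⟩ := Finset.card_eq_two.1 h
  have : ∀ w, w ∈ ({x, y} : Finset L) → m w = v := by
    intro w hw
    rw [← h4] at hw
    exact (Finset.mem_filter.1 hw).2
  exact ⟨x, y, h1, this x (by simp), this y (by simp)⟩

theorem full_chain (s k x0 y0 z0 w0 : ℕ) (m : Fin 3 → L → ℕ) (f g p q : L) (n1 : f ≠ g) (n2 : p ≠ q)
    (hm : ∀ j, ∑ l, m j l = s + 2 * k + 1) (h2 : TwoOne (m 0) k (s + 1))
    (hs : 1 ≤ s) (hxz : x0 + z0 + 1 = s) (hyw : y0 + w0 + 1 = s)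
    (hf : m 1 f = x0 + k + 1) (hg : m 1 g = y0 + k) (hp : m 2 p = z0 + k + 1) (hq : m 2 q = w0 + k)
    (hbase : ∀ m' : Fin 3 → L → ℕ, (∀ j, ∑ l, m' j l = s) → (∀ l, m' 0 l ≤ 1) → m' 1 f = x0 →
      m' 1 g = y0 → m' 2 p = z0 → m' 2 q = w0 → (∀ l, l ≠ f → l ≠ g → m' 1 l = m 1 l) →
      (∀ l, l ≠ p → l ≠ q → m' 2 l = m 2 l) → SolvR s m' (BoxC s m' (Chalf f g p q))) :
    SolvR (s + 2 * k + 1) m (BoxC (s + 2 * k + 1) m CT) := by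
  obtain ⟨c, hc⟩ := h2.exists_one (by omega)
  have hle : ∀ j, 1 ≤ m j ((![c, f, p] : Fin 3 → L) j) := by
    intro j; fin_cases j <;> simp <;> omega
  have hm' := sum_mred2 (n' := s + 2 * k) hm rfl hle
  apply full_to_half (s + 2 * k) m hm (by omega) c f g p q n1 n2 hc (by omega) (by omega)
    (by omega) (by omega)
  apply half_chain s x0 y0 z0 w0 f g p q (m 1) (m 2) n1 n2 hs hxz hyw hbase k _ hm'
  · exact fun l => le_trans (Nat.sub_le _ _) (h2.1 l)
  · rw [← h2.2.1]
    congr 1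
    ext l
    simp only [Finset.mem_filter, Finset.mem_univ, true_and]
    by_cases e : l = c
    · subst e; simp [mred, hc]
    · simp [mred, e]
  · simp [mred, hf]
  · simp [mred, hg, n1.symm]
  · simp [mred, hp]
  · simp [mred, hq, n2.symm]
  · intro l e e'; simp [mred, e]
  · intro l e e'; simp [mred, e]

theorem half_start (s k x0 y0 z0 w0 : ℕ) (m : Fin 3 → L → ℕ) (f g p q : L) (n1 : f ≠ g) (n2 : p ≠ q)
    (hm : ∀ j, ∑ l, m j l = s + 2 * k) (h2 : TwoOne (m 0) k s)
    (hs : 1 ≤ s) (hxz : x0 + z0 + 1 = s) (hyw : y0 + w0 + 1 = s)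
    (hf : m 1 f = x0 + k) (hg : m 1 g = y0 + k) (hp : m 2 p = z0 + k) (hq : m 2 q = w0 + k)
    (hbase : ∀ m' : Fin 3 → L → ℕ, (∀ j, ∑ l, m' j l = s) → (∀ l, m' 0 l ≤ 1) → m' 1 f = x0 →
      m' 1 g = y0 → m' 2 p = z0 → m' 2 q = w0 → (∀ l, l ≠ f → l ≠ g → m' 1 l = m 1 l) →
      (∀ l, l ≠ p → l ≠ q → m' 2 l = m 2 l) → SolvR s m' (BoxC s m' (Chalf f g p q))) :
    SolvR (s + 2 * k) m (BoxC (s + 2 * k) m CT) := by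
  have := half_chain s x0 y0 z0 w0 f g p q (m 1) (m 2) n1 n2 hs hxz hyw hbase k m hm h2.1 h2.2.1
    hf hg hp hq (fun _ _ _ => rfl) (fun _ _ _ => rfl)
  exact this.mono (fun κ t h => ⟨h.1, trivial⟩)

theorem gamma_chain (n0 f0 k0 k1 s0 s1 : ℕ) (f : L) (r2 : L → ℕ) (hn0 : n0 = f0 + 2)
    (hbase : ∀ m : Fin 3 → L → ℕ, (∀ j, ∑ l, m j l = n0) → TwoOne (m 0) k0 s0 → TwoOne (m 1) k1 s1 →
      m 2 f = f0 → (∀ l, l ≠ f → m 2 l = r2 l) → SolvR n0 m (BoxC n0 m CT)) :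
    ∀ (k : ℕ) (m : Fin 3 → L → ℕ), (∀ j, ∑ l, m j l = n0 + 2 * k) → TwoOne (m 0) (k0 + k) s0 →
      TwoOne (m 1) (k1 + k) s1 → m 2 f = f0 + 2 * k → (∀ l, l ≠ f → m 2 l = r2 l) →
      SolvR (n0 + 2 * k) m (BoxC (n0 + 2 * k) m CT) := by
  intro k
  induction k with
  | zero =>
    intro m hm h0 h1 h2 h3
    exact hbase m hm h0 h1 h2 h3
  | succ k ih =>
    intro m hm h0 h1 h2 h3
    obtain ⟨a, ha⟩ := h0.exists_two (by omega)
    obtain ⟨b, hb⟩ := h1.exists_two (by omega)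
    have hle : ∀ j, 2 ≤ m j ((![a, b, f] : Fin 3 → L) j) := by
      intro j; fin_cases j <;> simp <;> omega
    have hm' := sum_mred2 (n' := n0 + 2 * k) hm rfl hle
    apply gamma_step (n0 + 2 * k) m hm (by omega) a b f ha hb (by omega) (by omega)
    apply ih _ hm'
    · exact TwoOne.mred2 (a := ![a, b, f]) (j := 0) h0 ha
    · exact TwoOne.mred2 (a := ![a, b, f]) (j := 1) h1 hb
    · simp [mred, h2]; omega
    · intro l e; simp [mred, e]; exact h3 l e

theorem halfbase2 (m : Fin 3 → L → ℕ) (hm : ∀ j, ∑ l, m j l = 2) (a : Fin 3 → L)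
    (ha : ∀ j, m j (a j) = 1) (f g p q : L) (hfp : m 1 f + m 2 p = 1) (hgq : m 1 g + m 2 q = 1) :
    SolvR 2 m (BoxC 2 m (Chalf f g p q)) := by
  apply (base2 m hm a ha).mono
  rintro κ t ⟨hb, _⟩
  refine ⟨hb, ?_⟩
  have c1 := hb.2.2.1 1 f
  have c2 := hb.2.2.1 1 g
  have c4 := hb.2.2.1 2 p
  have c5 := hb.2.2.1 2 q
  have k1 := hb.1
  have k2 := hb.2.1
  simp only [Chalf]
  omega

theorem halfbase4 (m : Fin 3 → L → ℕ) (hm : ∀ j, ∑ l, m j l = 4) (h0 : ∀ l, m 0 l ≤ 1)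
    (f g h p q : L) (n1 : f ≠ g) (n2 : f ≠ h) (n3 : g ≠ h) (n4 : p ≠ q)
    (hf : m 1 f = 1) (hg : m 1 g = 1) (hh : m 1 h = 2) (hp : m 2 p = 2) (hq : m 2 q = 2) :
    SolvR 4 m (BoxC 4 m (Chalf f g p q)) := by
  apply (base4 m hm h0 h f g p q n2.symm n3.symm n1 n4 hh hf hg hp hq).mono
  rintro κ t ⟨hb, hC⟩
  refine ⟨hb, ?_⟩
  simp only [C4, Chalf] at hC ⊢
  omega

theorem halfbase3 (m : Fin 3 → L → ℕ) (hm : ∀ j, ∑ l, m j l = 3) (h0 : ∀ l, m 0 l ≤ 1)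
    (f g h1 h2 p q : L) (n2 : g ≠ h1) (n3 : g ≠ h2) (n3' : h1 ≠ h2) (n4 : p ≠ q)
    (hf : m 1 f = 0) (hg : m 1 g = 1) (hh1 : m 1 h1 = 1) (hh2 : m 1 h2 = 1)
    (hp : m 2 p = 2) (hq : m 2 q = 1) :
    SolvR 3 m (BoxC 3 m (Chalf f g p q)) := by
  apply (base3 m hm h0 h1 h2 g p q n3' n2.symm n3.symm n4 hh1 hh2 hg hp hq).mono
  rintro κ t ⟨hb, hC⟩
  refine ⟨hb, ?_⟩
  have b2 := box_2 hb hm 2 p q n4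
  have c1 := hb.2.2.1 1 f
  have c4 := hb.2.2.1 2 p
  have c5 := hb.2.2.1 2 q
  simp only [Chalf]
  omega

theorem base6 (m : Fin 3 → L → ℕ) (hm : ∀ j, ∑ l, m j l = 6) (h0 : TwoOne (m 0) 0 6)
    (f g h p q : L) (n1 : f ≠ g) (n2 : f ≠ h) (n3 : g ≠ h) (n4 : p ≠ q)
    (hf : m 1 f = 2) (hg : m 1 g = 2) (hh : m 1 h = 2) (hp : m 2 p = 4) (hq : m 2 q = 2) :
    SolvR 6 m (BoxC 6 m CT) := by
  apply full_chain 5 0 1 2 3 2 m f g p q n1 n4 hm h0 (by norm_num) (by norm_num) (by norm_num)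
    hf hg hp hq
  intro m' hm' h0' hf' hg' hp' hq' hr1 _
  exact base5 m' hm' h0' f g h p q n1 n2 n3 n4 hf' hg' (by rw [hr1 h n2.symm n3.symm, hh]) hp' hq'

end fams

end partB4

section partB5
open Matrix BigOperators
open Module
set_option linter.unusedSectionVars false
set_option linter.unusedSimpArgs false
set_option linter.unusedDecidableInType false

section fams
variable {L : Type} [Fintype L] [DecidableEq L]

/-- the multiset of nonzero values of `m` on `T` -/
def EC (T : Finset L) (m : L → ℕ) : Multiset ℕ := (T.val.map m).filter (fun x => x ≠ 0)

theorem ec_cons {T : Finset L} {m : L → ℕ} {x : ℕ} {s : Multiset ℕ} (hx : x ≠ 0)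
    (h : EC T m = x ::ₘ s) : ∃ f ∈ T, m f = x ∧ EC (T.erase f) m = s := by
  have hmem : x ∈ EC T m := by rw [h]; exact Multiset.mem_cons_self _ _
  simp only [EC, Multiset.mem_filter, Multiset.mem_map] at hmem
  obtain ⟨⟨f, hf, hfx⟩, _⟩ := hmem
  refine ⟨f, hf, hfx, ?_⟩
  have h1 : T = insert f (T.erase f) := (Finset.insert_erase hf).symm
  have h2 : T.val = f ::ₘ (T.erase f).val := by
    conv_lhs => rw [h1]
    exact Finset.insert_val_of_notMem (Finset.notMem_erase _ _)
  rw [EC, h2, Multiset.map_cons, Multiset.filter_cons_of_pos _ (by rw [hfx]; exact hx), hfx] at h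
  exact (Multiset.cons_inj_right x).1 h

theorem ec_zero {T : Finset L} {m : L → ℕ} (h : EC T m = 0) : ∀ l ∈ T, m l = 0 := by
  intro l hl
  by_contra hc
  have : m l ∈ EC T m := by
    simp only [EC, Multiset.mem_filter, Multiset.mem_map]
    exact ⟨⟨l, hl, rfl⟩, hc⟩
  rw [h] at this
  simp at this

theorem ec_two {m : L → ℕ} {x y : ℕ} (hx : x ≠ 0) (hy : y ≠ 0)
    (h : EC Finset.univ m = {x, y}) : ∃ f g, f ≠ g ∧ m f = x ∧ m g = y ∧
      ∀ l, l ≠ f → l ≠ g → m l = 0 := by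
  obtain ⟨f, hf, hfx, h1⟩ := ec_cons hx h
  obtain ⟨g, hg, hgx, h2⟩ := ec_cons (s := 0) hy h1
  refine ⟨f, g, (Finset.mem_erase.1 hg).1.symm, hfx, hgx, ?_⟩
  intro l e1 e2
  exact ec_zero h2 l (by simp [e1, e2])

theorem ec_three {m : L → ℕ} {x y z : ℕ} (hx : x ≠ 0) (hy : y ≠ 0) (hz : z ≠ 0)
    (h : EC Finset.univ m = {x, y, z}) : ∃ f g k, f ≠ g ∧ f ≠ k ∧ g ≠ k ∧ m f = x ∧ m g = y ∧ m k = z ∧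
      ∀ l, l ≠ f → l ≠ g → l ≠ k → m l = 0 := by
  obtain ⟨f, hf, hfx, h1⟩ := ec_cons hx h
  obtain ⟨g, hg, hgx, h2⟩ := ec_cons hy h1
  obtain ⟨k, hk, hkx, h3⟩ := ec_cons (s := 0) hz h2
  simp at hg hk
  refine ⟨f, g, k, fun e => hg e.symm, fun e => hk.2 e.symm, fun e => hk.1 e.symm, hfx, hgx, hkx, ?_⟩
  intro l e1 e2 e3
  exact ec_zero h3 l (by simp [e1, e2, e3])

theorem ec_four {m : L → ℕ} {x y z w : ℕ} (hx : x ≠ 0) (hy : y ≠ 0) (hz : z ≠ 0) (hw : w ≠ 0)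
    (h : EC Finset.univ m = {x, y, z, w}) : ∃ f g k r, f ≠ g ∧ f ≠ k ∧ f ≠ r ∧ g ≠ k ∧ g ≠ r ∧ k ≠ r ∧
      m f = x ∧ m g = y ∧ m k = z ∧ m r = w := by
  obtain ⟨f, hf, hfx, h1⟩ := ec_cons hx h
  obtain ⟨g, hg, hgx, h2⟩ := ec_cons hy h1
  obtain ⟨k, hk, hkx, h3⟩ := ec_cons hz h2
  obtain ⟨r, hr, hrx, h3⟩ := ec_cons (s := 0) hw h3
  simp at hg hk hr
  exact ⟨f, g, k, r, fun e => hg e.symm, fun e => hk.2 e.symm, fun e => hr.2.2 e.symm, 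
    fun e => hk.1 e.symm, fun e => hr.2.1 e.symm, fun e => hr.1 e.symm, hfx, hgx, hkx, hrx⟩

theorem ec_twoone {m : L → ℕ} {k s : ℕ}
    (h : EC Finset.univ m = Multiset.replicate k 2 + Multiset.replicate s 1) : TwoOne m k s := by
  have hc : ∀ v, v ≠ 0 → (Finset.univ.filter (fun l => m l = v)).card = Multiset.count v (EC Finset.univ m) := by
    intro v hv
    rw [EC, Multiset.count_filter_of_pos (p := fun x => x ≠ 0) hv, Multiset.count_map, Finset.card_def]
    congr 1
    rw [Finset.filter_val]
    apply Multiset.filter_congr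
    intro l _
    exact eq_comm
  refine ⟨?_, ?_, ?_⟩
  · intro l
    by_cases e : m l = 0
    · omega
    have : m l ∈ EC Finset.univ m := by
      simp only [EC, Multiset.mem_filter, Multiset.mem_map]
      exact ⟨⟨l, Finset.mem_univ _, rfl⟩, e⟩
    rw [h, Multiset.mem_add] at this
    rcases this with h | h
    · rw [Multiset.eq_of_mem_replicate h]
    · rw [Multiset.eq_of_mem_replicate h]; norm_num
  · rw [hc 2 (by norm_num), h]; simp [Multiset.count_replicate]
  · rw [hc 1 (by norm_num), h]; simp [Multiset.count_replicate]

theorem exists_c0 {m : L → ℕ} {n : ℕ} (h : ∑ l, m l = n) (hn : 1 ≤ n) (h0 : ∀ l, m l ≤ 1) : ∃ c, m c = 1 := by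
  by_contra hc
  push Not at hc
  have : ∑ l, m l = 0 := Finset.sum_eq_zero (fun l _ => by have := hc l; have := h0 l; omega)
  omega

theorem fam_gamma1 (k : ℕ) (m : Fin 3 → L → ℕ) (hm : ∀ j, ∑ l, m j l = 6 + 2 * k)
    (h0 : TwoOne (m 0) (3 + k) 0) (h1 : TwoOne (m 1) (0 + k) 6)
    (h2 : EC Finset.univ (m 2) = {4 + 2 * k, 2}) :
    SolvR (6 + 2 * k) m (BoxC (6 + 2 * k) m CT) := by
  obtain ⟨p, q, n4, hp, hq, -⟩ := ec_two (by omega) (by omega) h2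
  refine gamma_chain 6 4 3 0 0 6 p (m 2) (by norm_num) ?_ k m hm h0 h1 hp (fun _ _ => rfl)
  intro m' hm' g0 g1 gp gr
  obtain ⟨x, y, z, e1, e2, e3, hx, hy, hz⟩ := exists_three g0.2.1
  refine solv_perm (Equiv.swap 0 1) 6 m' _ (BoxC 6 (fun j => m' (Equiv.swap 0 1 j)) CT) ?_ ?_
  · rintro κ t ⟨⟨a1, a2, a3, a4⟩, -⟩
    refine ⟨⟨a1, a2, ?_, ?_⟩, trivial⟩
    · intro j; simpa using a3 (Equiv.swap 0 1 j)
    · intro j; simpa using a4 (Equiv.swap 0 1 j)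
  · apply base6 (fun j => m' (Equiv.swap 0 1 j)) (fun j => hm' _) g1 x y z p q e1 e2 e3 n4
    · exact hx
    · exact hy
    · exact hz
    · exact gp
    · exact (gr q n4.symm).trans hq

theorem perm_box (σ : Equiv.Perm (Fin 3)) (n : ℕ) (m : Fin 3 → L → ℕ) 
    (h : SolvR n (fun j => m (σ j)) (BoxC n (fun j => m (σ j)) CT)) : SolvR n m (BoxC n m CT) := by
  refine solv_perm σ n m _ _ ?_ h
  rintro κ t ⟨⟨a1, a2, a3, a4⟩, -⟩
  refine ⟨⟨a1, a2, ?_, ?_⟩, trivial⟩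
  · intro j; simpa using a3 (σ.symm j)
  · intro j; simpa using a4 (σ.symm j)

theorem toCT {n : ℕ} {m : Fin 3 → L → ℕ} {C : ℤ → (Fin 3 → L → ℤ) → Prop}
    (h : SolvR n m (BoxC n m C)) : SolvR n m (BoxC n m CT) :=
  h.mono (fun _ _ h => ⟨h.1, trivial⟩)

theorem toHalfSymm {n : ℕ} {m : Fin 3 → L → ℕ} {f g p q : L}
    (h : SolvR n m (BoxC n m (Chalf g f q p))) : SolvR n m (BoxC n m (Chalf f g p q)) :=
  h.mono (fun _ _ h => ⟨h.1, Chalf_symm h.2⟩)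

theorem fam_gamma2 (k : ℕ) (m : Fin 3 → L → ℕ) (hm : ∀ j, ∑ l, m j l = 4 + 2 * k)
    (h0 : TwoOne (m 0) (1 + k) 2) (h1 : TwoOne (m 1) (0 + k) 4)
    (h2 : EC Finset.univ (m 2) = {2 + 2 * k, 2}) :
    SolvR (4 + 2 * k) m (BoxC (4 + 2 * k) m CT) := by
  obtain ⟨p, q, n4, hp, hq, -⟩ := ec_two (by omega) (by omega) h2
  refine gamma_chain 4 2 1 0 2 4 p (m 2) (by norm_num) ?_ k m hm h0 h1 hp (fun _ _ => rfl)
  intro m' hm' g0 g1 gp gr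
  obtain ⟨D, hD⟩ := g0.exists_two (by norm_num)
  obtain ⟨x, y, e1, hx, hy⟩ := exists_pair g0.2.2
  apply perm_box (Equiv.swap 0 1)
  apply toCT
  apply base4 (fun j => m' (Equiv.swap 0 1 j)) (fun j => hm' _) (fun l => g1.le_one l) D x y p q (by rintro rfl; omega) 
    (by rintro rfl; omega) e1 n4
  · exact hD
  · exact hx
  · exact hy
  · exact gp
  · exact (gr q n4.symm).trans hq

theorem fam_gamma3 (k : ℕ) (m : Fin 3 → L → ℕ) (hm : ∀ j, ∑ l, m j l = 2 + 2 * k)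
    (h0 : TwoOne (m 0) (0 + k) 2) (h1 : TwoOne (m 1) (0 + k) 2) (hk : 1 ≤ k)
    (h2 : EC Finset.univ (m 2) = {0 + 2 * k, 1, 1}) :
    SolvR (2 + 2 * k) m (BoxC (2 + 2 * k) m CT) := by
  obtain ⟨p, q, r, n4, n5, n6, hp, hq, hr, -⟩ := ec_three (by omega) (by omega) (by omega) h2
  refine gamma_chain 2 0 0 0 2 2 p (m 2) (by norm_num) ?_ k m hm h0 h1 hp (fun _ _ => rfl)
  intro m' hm' g0 g1 gp gr
  obtain ⟨x, hx⟩ := g0.exists_one (by norm_num)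
  obtain ⟨y, hy⟩ := g1.exists_one (by norm_num)
  apply base2 _ hm' ![x, y, q]
  intro j; fin_cases j
  · exact hx
  · exact hy
  · exact (gr q n4.symm).trans hq

def cyc : Equiv.Perm (Fin 3) := ⟨![1, 2, 0], ![2, 0, 1], by decide, by decide⟩

theorem fam_gamma4 (k : ℕ) (m : Fin 3 → L → ℕ) (hm : ∀ j, ∑ l, m j l = 4 + 2 * k)
    (h0 : TwoOne (m 0) (2 + k) 0) (h1 : TwoOne (m 1) (0 + k) 4)
    (h2 : EC Finset.univ (m 2) = {2 + 2 * k, 1, 1}) :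
    SolvR (4 + 2 * k) m (BoxC (4 + 2 * k) m CT) := by
  obtain ⟨p, q, r, n4, n5, n6, hp, hq, hr, -⟩ := ec_three (by omega) (by omega) (by omega) h2
  refine gamma_chain 4 2 2 0 0 4 p (m 2) (by norm_num) ?_ k m hm h0 h1 hp (fun _ _ => rfl)
  intro m' hm' g0 g1 gp gr
  obtain ⟨x, y, e1, hx, hy⟩ := exists_pair g0.2.1
  apply perm_box cyc
  apply toCT
  apply base4 (fun j => m' (cyc j)) (fun j => hm' _) (fun l => g1.le_one l) p q r x y n4 n5 n6 e1
  · exact gp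
  · exact (gr q n4.symm).trans hq
  · exact (gr r n5.symm).trans hr
  · exact hx
  · exact hy

theorem fam_X1 (k : ℕ) (m : Fin 3 → L → ℕ) (hm : ∀ j, ∑ l, m j l = 5 + 2 * k)
    (h0 : TwoOne (m 0) (0 + k) 5) (h1 : TwoOne (m 1) (2 + k) 1)
    (h2 : EC Finset.univ (m 2) = {3 + 2 * k, 2}) :
    SolvR (5 + 2 * k) m (BoxC (5 + 2 * k) m CT) := by
  obtain ⟨p, q, n4, hp, hq, -⟩ := ec_two (by omega) (by omega) h2
  refine gamma_chain 5 3 0 2 5 1 p (m 2) (by norm_num) ?_ k m hm h0 h1 hp (fun _ _ => rfl)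
  intro m' hm' g0 g1 gp gr
  obtain ⟨D, hD⟩ := g1.exists_one (by norm_num)
  obtain ⟨x, y, e1, hx, hy⟩ := exists_pair g1.2.1
  apply toCT
  exact base5 _ hm' (fun l => g0.le_one l) D x y p q (by rintro rfl; omega) 
    (by rintro rfl; omega) e1 n4 hD hx hy gp ((gr q n4.symm).trans hq)

theorem fam_X2 (k : ℕ) (m : Fin 3 → L → ℕ) (hm : ∀ j, ∑ l, m j l = 3 + 2 * k)
    (h0 : TwoOne (m 0) (0 + k) 3) (h1 : TwoOne (m 1) (0 + k) 3)
    (h2 : EC Finset.univ (m 2) = {1 + 2 * k, 2}) :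
    SolvR (3 + 2 * k) m (BoxC (3 + 2 * k) m CT) := by
  obtain ⟨p, q, n4, hp, hq, -⟩ := ec_two (by omega) (by omega) h2
  refine gamma_chain 3 1 0 0 3 3 p (m 2) (by norm_num) ?_ k m hm h0 h1 hp (fun _ _ => rfl)
  intro m' hm' g0 g1 gp gr
  obtain ⟨x, y, z, e1, e2, e3, hx, hy, hz⟩ := exists_three g1.2.2
  apply toCT
  exact base3 _ hm' (fun l => g0.le_one l) x y z q p e1 e2 e3 n4.symm hx hy hz
    ((gr q n4.symm).trans hq) gp

theorem fam_OG (k : ℕ) (m : Fin 3 → L → ℕ) (hm : ∀ j, ∑ l, m j l = 3 + 2 * k)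
    (h0 : TwoOne (m 0) (1 + k) 1) (h1 : TwoOne (m 1) (0 + k) 3)
    (h2 : EC Finset.univ (m 2) = {1 + 2 * k, 1, 1}) :
    SolvR (3 + 2 * k) m (BoxC (3 + 2 * k) m CT) := by
  obtain ⟨p, q, r, n4, n5, n6, hp, hq, hr, -⟩ := ec_three (by omega) (by omega) (by omega) h2
  refine gamma_chain 3 1 1 0 1 3 p (m 2) (by norm_num) ?_ k m hm h0 h1 hp (fun _ _ => rfl)
  intro m' hm' g0 g1 gp gr
  obtain ⟨x, hx⟩ := g0.exists_two (by norm_num)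
  obtain ⟨y, hy⟩ := g0.exists_one (by norm_num)
  apply perm_box cyc
  apply toCT
  apply base3 (fun j => m' (cyc j)) (fun j => hm' _) (fun l => g1.le_one l) p q r x y n4 n5 n6 (by rintro rfl; omega)
  · exact gp
  · exact (gr q n4.symm).trans hq
  · exact (gr r n5.symm).trans hr
  · exact hx
  · exact hy

theorem fam_Y1 (k : ℕ) (m : Fin 3 → L → ℕ) (hm : ∀ j, ∑ l, m j l = 4 + 2 * k)
    (h0 : TwoOne (m 0) k 4) (h1 : EC Finset.univ (m 1) = {1 + k, 1 + k, 2})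
    (h2 : EC Finset.univ (m 2) = {2 + k, 2 + k}) :
    SolvR (4 + 2 * k) m (BoxC (4 + 2 * k) m CT) := by
  obtain ⟨f, g, h, n1, n2, n3, hf, hg, hh, -⟩ := ec_three (by omega) (by omega) (by omega) h1
  obtain ⟨p, q, n4, hp, hq, -⟩ := ec_two (by omega) (by omega) h2
  apply half_start 4 k 1 1 2 2 m f g p q n1 n4 hm h0 (by norm_num) (by norm_num) (by norm_num) hf hg hp hq
  intro m' hm' g0 gf gg gp gq r1 r2
  exact halfbase4 m' hm' g0 f g h p q n1 n2 n3 n4 gf gg ((r1 h n2.symm n3.symm).trans hh) gp gq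

theorem fam_Y2 (k : ℕ) (m : Fin 3 → L → ℕ) (hm : ∀ j, ∑ l, m j l = 2 + 2 * k) (hk : 1 ≤ k)
    (h0 : TwoOne (m 0) k 2) (h1 : EC Finset.univ (m 1) = {0 + k, 0 + k, 1, 1})
    (h2 : EC Finset.univ (m 2) = {1 + k, 1 + k}) :
    SolvR (2 + 2 * k) m (BoxC (2 + 2 * k) m CT) := by
  obtain ⟨f, g, h, h', n1, n2, n2', n3, n3', n4', hf, hg, hh, hh'⟩ := ec_four (by omega) (by omega) (by omega) (by omega) h1
  obtain ⟨p, q, n4, hp, hq, -⟩ := ec_two (by omega) (by omega) h2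
  apply half_start 2 k 0 0 1 1 m f g p q n1 n4 hm h0 (by norm_num) (by norm_num) (by norm_num) hf hg hp hq
  intro m' hm' g0 gf gg gp gq r1 r2
  obtain ⟨c, hc⟩ := exists_c0 (hm' 0) (by norm_num) g0
  apply halfbase2 m' hm' ![c, h, p] _ f g p q (by omega) (by omega)
  intro j; fin_cases j
  · exact hc
  · exact (r1 h n2.symm n3.symm).trans hh
  · exact gp

theorem fam_Z1 (k : ℕ) (m : Fin 3 → L → ℕ) (hm : ∀ j, ∑ l, m j l = 1 + 2 * k) (hk : 1 ≤ k)
    (h0 : TwoOne (m 0) k 1) (h1 : EC Finset.univ (m 1) = {0 + k, 0 + k, 1})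
    (h2 : EC Finset.univ (m 2) = {0 + k, 0 + k, 1}) :
    SolvR (1 + 2 * k) m (BoxC (1 + 2 * k) m CT) := by
  obtain ⟨f, g, h, n1, n2, n3, hf, hg, hh, -⟩ := ec_three (by omega) (by omega) (by omega) h1
  obtain ⟨p, q, r, n4, n5, n6, hp, hq, hr, -⟩ := ec_three (by omega) (by omega) (by omega) h2
  apply half_start 1 k 0 0 0 0 m f g p q n1 n4 hm h0 (by norm_num) (by norm_num) (by norm_num) hf hg hp hq
  intro m' hm' g0 gf gg gp gq r1 r2
  exact solv_one m' _ hm'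

theorem fam_Y5 (k : ℕ) (m : Fin 3 → L → ℕ) (hm : ∀ j, ∑ l, m j l = 1 + 2 * k + 1) (hk : 1 ≤ k)
    (h0 : TwoOne (m 0) k 2) (h1 : EC Finset.univ (m 1) = {0 + k + 1, 0 + k, 1})
    (h2 : EC Finset.univ (m 2) = {0 + k + 1, 0 + k, 1}) :
    SolvR (1 + 2 * k + 1) m (BoxC (1 + 2 * k + 1) m CT) := by
  obtain ⟨f, g, h, n1, n2, n3, hf, hg, hh, -⟩ := ec_three (by omega) (by omega) (by omega) h1
  obtain ⟨p, q, r, n4, n5, n6, hp, hq, hr, -⟩ := ec_three (by omega) (by omega) (by omega) h2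
  apply full_chain 1 k 0 0 0 0 m f g p q n1 n4 hm h0 (by norm_num) (by norm_num) (by norm_num) hf hg hp hq
  intro m' hm' g0 gf gg gp gq r1 r2
  exact solv_one m' _ hm'

theorem fam_Y6 (k : ℕ) (m : Fin 3 → L → ℕ) (hm : ∀ j, ∑ l, m j l = 3 + 2 * k + 1)
    (h0 : TwoOne (m 0) k 4) (h1 : EC Finset.univ (m 1) = {0 + k + 1, 1 + k, 1, 1})
    (h2 : EC Finset.univ (m 2) = {2 + k + 1, 1 + k}) :
    SolvR (3 + 2 * k + 1) m (BoxC (3 + 2 * k + 1) m CT) := by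
  obtain ⟨f, g, h, h', n1, n2, n2', n3, n3', n4', hf, hg, hh, hh'⟩ := ec_four (by omega) (by omega) (by omega) (by omega) h1
  obtain ⟨p, q, n4, hp, hq, -⟩ := ec_two (by omega) (by omega) h2
  apply full_chain 3 k 0 1 2 1 m f g p q n1 n4 hm h0 (by norm_num) (by norm_num) (by norm_num) hf hg hp hq
  intro m' hm' g0 gf gg gp gq r1 r2
  exact halfbase3 m' hm' g0 f g h h' p q n3 n3' n4' n4 gf gg ((r1 h n2.symm n3.symm).trans hh)
    ((r1 h' n2'.symm n3'.symm).trans hh') gp gq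

theorem fam_Y7 (k : ℕ) (m : Fin 3 → L → ℕ) (hm : ∀ j, ∑ l, m j l = 5 + 2 * k + 1)
    (h0 : TwoOne (m 0) k 6) (h1 : EC Finset.univ (m 1) = {1 + k + 1, 2 + k, 2})
    (h2 : EC Finset.univ (m 2) = {3 + k + 1, 2 + k}) :
    SolvR (5 + 2 * k + 1) m (BoxC (5 + 2 * k + 1) m CT) := by
  obtain ⟨f, g, h, n1, n2, n3, hf, hg, hh, -⟩ := ec_three (by omega) (by omega) (by omega) h1
  obtain ⟨p, q, n4, hp, hq, -⟩ := ec_two (by omega) (by omega) h2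
  apply full_chain 5 k 1 2 3 2 m f g p q n1 n4 hm h0 (by norm_num) (by norm_num) (by norm_num) hf hg hp hq
  intro m' hm' g0 gf gg gp gq r1 r2
  exact base5 m' hm' g0 f g h p q n1 n2 n3 n4 gf gg ((r1 h n2.symm n3.symm).trans hh) gp gq

theorem fam_Y3 (k : ℕ) (m : Fin 3 → L → ℕ) (hm : ∀ j, ∑ l, m j l = 3 + 2 * k + 1) (hk : 1 ≤ k)
    (h0 : TwoOne (m 0) k 4) (h1 : EC Finset.univ (m 1) = {1 + k + 1, 0 + k, 1, 1})
    (h2 : EC Finset.univ (m 2) = {1 + k + 1, 2 + k}) :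
    SolvR (3 + 2 * k + 1) m (BoxC (3 + 2 * k + 1) m CT) := by
  obtain ⟨f, g, h, h', n1, n2, n2', n3, n3', n4', hf, hg, hh, hh'⟩ := ec_four (by omega) (by omega) (by omega) (by omega) h1
  obtain ⟨p, q, n4, hp, hq, -⟩ := ec_two (by omega) (by omega) h2
  apply full_chain 3 k 1 0 1 2 m f g p q n1 n4 hm h0 (by norm_num) (by norm_num) (by norm_num) hf hg hp hq
  intro m' hm' g0 gf gg gp gq r1 r2
  apply toHalfSymm
  exact halfbase3 m' hm' g0 g f h h' q p n2 n2' n4' n4.symm gg gf ((r1 h n2.symm n3.symm).trans hh)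
    ((r1 h' n2'.symm n3'.symm).trans hh') gq gp

theorem fam_Y4 (k : ℕ) (m : Fin 3 → L → ℕ) (hm : ∀ j, ∑ l, m j l = 5 + 2 * k + 1)
    (h0 : TwoOne (m 0) k 6) (h1 : EC Finset.univ (m 1) = {2 + k + 1, 1 + k, 2})
    (h2 : EC Finset.univ (m 2) = {2 + k + 1, 3 + k}) :
    SolvR (5 + 2 * k + 1) m (BoxC (5 + 2 * k + 1) m CT) := by
  obtain ⟨f, g, h, n1, n2, n3, hf, hg, hh, -⟩ := ec_three (by omega) (by omega) (by omega) h1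
  obtain ⟨p, q, n4, hp, hq, -⟩ := ec_two (by omega) (by omega) h2
  apply full_chain 5 k 2 1 2 3 m f g p q n1 n4 hm h0 (by norm_num) (by norm_num) (by norm_num) hf hg hp hq
  intro m' hm' g0 gf gg gp gq r1 r2
  apply toHalfSymm
  exact base5 m' hm' g0 g f h q p n1.symm n3 n2 n4.symm gg gf ((r1 h n2.symm n3.symm).trans hh) gq gp

theorem fam_Z2 (k : ℕ) (m : Fin 3 → L → ℕ) (hm : ∀ j, ∑ l, m j l = 4 + 2 * k + 1)
    (h0 : TwoOne (m 0) k 5) (h1 : EC Finset.univ (m 1) = {1 + k + 1, 1 + k, 2})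
    (h2 : EC Finset.univ (m 2) = {2 + k + 1, 2 + k}) :
    SolvR (4 + 2 * k + 1) m (BoxC (4 + 2 * k + 1) m CT) := by
  obtain ⟨f, g, h, n1, n2, n3, hf, hg, hh, -⟩ := ec_three (by omega) (by omega) (by omega) h1
  obtain ⟨p, q, n4, hp, hq, -⟩ := ec_two (by omega) (by omega) h2
  apply full_chain 4 k 1 1 2 2 m f g p q n1 n4 hm h0 (by norm_num) (by norm_num) (by norm_num) hf hg hp hq
  intro m' hm' g0 gf gg gp gq r1 r2
  exact halfbase4 m' hm' g0 f g h p q n1 n2 n3 n4 gf gg ((r1 h n2.symm n3.symm).trans hh) gp gq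

theorem fam_Z3 (k : ℕ) (m : Fin 3 → L → ℕ) (hm : ∀ j, ∑ l, m j l = 2 + 2 * k + 1) (hk : 1 ≤ k)
    (h0 : TwoOne (m 0) k 3) (h1 : EC Finset.univ (m 1) = {0 + k + 1, 0 + k, 1, 1})
    (h2 : EC Finset.univ (m 2) = {1 + k + 1, 1 + k}) :
    SolvR (2 + 2 * k + 1) m (BoxC (2 + 2 * k + 1) m CT) := by
  obtain ⟨f, g, h, h', n1, n2, n2', n3, n3', n4', hf, hg, hh, hh'⟩ := ec_four (by omega) (by omega) (by omega) (by omega) h1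
  obtain ⟨p, q, n4, hp, hq, -⟩ := ec_two (by omega) (by omega) h2
  apply full_chain 2 k 0 0 1 1 m f g p q n1 n4 hm h0 (by norm_num) (by norm_num) (by norm_num) hf hg hp hq
  intro m' hm' g0 gf gg gp gq r1 r2
  obtain ⟨c, hc⟩ := exists_c0 (hm' 0) (by norm_num) g0
  apply halfbase2 m' hm' ![c, h, p] _ f g p q (by omega) (by omega)
  intro j; fin_cases j
  · exact hc
  · exact (r1 h n2.symm n3.symm).trans hh
  · exact gp

theorem fam_Z4 (k : ℕ) (m : Fin 3 → L → ℕ) (hm : ∀ j, ∑ l, m j l = 2 + 2 * k + 1) (hk : 1 ≤ k)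
    (h0 : TwoOne (m 0) k 3) (h1 : EC Finset.univ (m 1) = {0 + k + 1, 1 + k, 1})
    (h2 : EC Finset.univ (m 2) = {1 + k + 1, 0 + k, 1}) :
    SolvR (2 + 2 * k + 1) m (BoxC (2 + 2 * k + 1) m CT) := by
  obtain ⟨f, g, h, n1, n2, n3, hf, hg, hh, -⟩ := ec_three (by omega) (by omega) (by omega) h1
  obtain ⟨p, q, r, n4, n5, n6, hp, hq, hr, -⟩ := ec_three (by omega) (by omega) (by omega) h2
  apply full_chain 2 k 0 1 1 0 m f g p q n1 n4 hm h0 (by norm_num) (by norm_num) (by norm_num) hf hg hp hq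
  intro m' hm' g0 gf gg gp gq r1 r2
  obtain ⟨c, hc⟩ := exists_c0 (hm' 0) (by norm_num) g0
  apply halfbase2 m' hm' ![c, h, p] _ f g p q (by omega) (by omega)
  intro j; fin_cases j
  · exact hc
  · exact (r1 h n2.symm n3.symm).trans hh
  · exact gp
end fams

end partB5

section partB6
open Matrix BigOperators
open Module
set_option linter.unusedSectionVars false
set_option linter.unusedSimpArgs false
set_option linter.unusedDecidableInType false

section fams
variable {L : Type} [Fintype L] [DecidableEq L]

theorem rep11 : ({1, 1} : Multiset ℕ) = Multiset.replicate 2 1 := rfl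
theorem rep1 : ({1} : Multiset ℕ) = Multiset.replicate 1 1 := rfl

theorem ec_twoone' {m : L → ℕ} {k k' s : ℕ}
    (h : EC Finset.univ m = Multiset.replicate k 2 + Multiset.replicate s 1) (hk : k = k') : TwoOne m k' s := by
  subst hk; exact ec_twoone h

theorem ec_twoone0 {m : L → ℕ} {k k' : ℕ}
    (h : EC Finset.univ m = Multiset.replicate k 2) (hk : k = k') : TwoOne m k' 0 := by
  subst hk; exact ec_twoone (by rw [h]; simp)

theorem two_cong {a b a' b' : ℕ} {M : Multiset ℕ} (h : M = {a, b}) (h1 : a = a') (h2 : b = b') :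
    M = {a', b'} := by subst h1 h2; exact h
theorem three_cong {a b c a' b' c' : ℕ} {M : Multiset ℕ} (h : M = {a, b, c}) (h1 : a = a') (h2 : b = b')
    (h3 : c = c') : M = {a', b', c'} := by subst h1 h2 h3; exact h
theorem four_cong {a b c d a' b' c' d' : ℕ} {M : Multiset ℕ} (h : M = {a, b, c, d}) (h1 : a = a') (h2 : b = b')
    (h3 : c = c') (h4 : d = d') : M = {a', b', c', d'} := by subst h1 h2 h3 h4; exact h

theorem n_cong {n n' : ℕ} (h : n = n') (m : Fin 3 → L → ℕ) (h1 : SolvR n' m (BoxC n' m CT)) :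
    SolvR n m (BoxC n m CT) := by subst h; exact h1

theorem trifam_solv (n : ℕ) (hn : 22 ≤ n) (m : Fin 3 → L → ℕ) (hm : ∀ j, ∑ l, m j l = n)
    (h : TriFam n (fun j => EC Finset.univ (m j))) : SolvR n m (BoxC n m CT) := by
  simp only [TriFam, rep11, rep1] at h
  rcases h with ⟨r, hr, h⟩ | ⟨r, hr, h⟩ | ⟨r, hr, h⟩ | ⟨r, hr, h⟩
  · rcases h with ⟨h0, h1, h2⟩ | ⟨h0, h1, h2⟩ | ⟨h0, h1, h2⟩ | ⟨h0, h1, h2⟩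
    · have e : n = 6 + 2 * (r - 3) := by omega
      apply n_cong e
      apply fam_gamma1 (r - 3) m (fun j => (hm j).trans e) (ec_twoone0 h0 (by omega))
        (ec_twoone' h1 (by omega)) (two_cong h2 (by omega) rfl)
    · have e : n = 4 + 2 * (r - 2) := by omega
      apply n_cong e
      apply fam_gamma2 (r - 2) m (fun j => (hm j).trans e) (ec_twoone' h0 (by omega))
        (ec_twoone' h1 (by omega)) (two_cong h2 (by omega) rfl)
    · have e : n = 2 + 2 * (r - 1) := by omega
      apply n_cong e
      apply fam_gamma3 (r - 1) m (fun j => (hm j).trans e) (ec_twoone' h0 (by omega))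
        (ec_twoone' h1 (by omega)) (by omega) (three_cong h2 (by omega) rfl rfl)
    · have e : n = 4 + 2 * (r - 2) := by omega
      apply n_cong e
      apply fam_gamma4 (r - 2) m (fun j => (hm j).trans e) (ec_twoone0 h0 (by omega))
        (ec_twoone' h1 (by omega)) (three_cong h2 (by omega) rfl rfl)
  · rcases h with ⟨h0, h1, h2⟩ | ⟨h0, h1, h2⟩ | ⟨h0, h1, h2⟩ | ⟨h0, h1, h2⟩ | ⟨h0, h1, h2⟩
    · have e : n = 4 + 2 * (r - 1) := by omega
      apply n_cong e
      apply fam_Y1 (r - 1) m (fun j => (hm j).trans e) (ec_twoone' h0 (by omega))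
        (three_cong h1 (by omega) (by omega) rfl) (two_cong h2 (by omega) (by omega))
    · have e : n = 2 + 2 * r := by omega
      apply n_cong e
      apply fam_Y2 r m (fun j => (hm j).trans e) (by omega) (ec_twoone' h0 (by omega))
        (four_cong h1 (by omega) (by omega) rfl rfl) (two_cong h2 (by omega) (by omega))
    · have e : n = 1 + 2 * r + 1 := by omega
      apply n_cong e
      apply fam_Y5 r m (fun j => (hm j).trans e) (by omega) (ec_twoone' h0 (by omega))
        (three_cong h1 (by omega) (by omega) rfl) (three_cong h2 (by omega) (by omega) rfl)
    · have e : n = 3 + 2 * (r - 1) + 1 := by omega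
      apply n_cong e
      apply fam_Y6 (r - 1) m (fun j => (hm j).trans e) (ec_twoone' h0 (by omega))
        (four_cong h1 (by omega) (by omega) rfl rfl) (two_cong h2 (by omega) (by omega))
    · have e : n = 5 + 2 * (r - 2) + 1 := by omega
      apply n_cong e
      apply fam_Y7 (r - 2) m (fun j => (hm j).trans e) (ec_twoone' h0 (by omega))
        (three_cong h1 (by omega) (by omega) rfl) (two_cong h2 (by omega) (by omega))
  · rcases h with ⟨h0, h1, h2⟩ | ⟨h0, h1, h2⟩
    · have e : n = 3 + 2 * r + 1 := by omega
      apply n_cong e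
      apply fam_Y3 r m (fun j => (hm j).trans e) (by omega) (ec_twoone' h0 (by omega))
        (four_cong h1 (by omega) (by omega) rfl rfl) (two_cong h2 (by omega) (by omega))
    · have e : n = 5 + 2 * (r - 1) + 1 := by omega
      apply n_cong e
      apply fam_Y4 (r - 1) m (fun j => (hm j).trans e) (ec_twoone' h0 (by omega))
        (three_cong h1 (by omega) (by omega) rfl) (two_cong h2 (by omega) (by omega))
  · rcases h with ⟨h0, h1, h2⟩ | ⟨h0, h1, h2⟩ | ⟨h0, h1, h2⟩ | ⟨h0, h1, h2⟩ | ⟨h0, h1, h2⟩ |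
      ⟨h0, h1, h2⟩ | ⟨h0, h1, h2⟩
    · have e : n = 5 + 2 * (r - 2) := by omega
      apply n_cong e
      apply fam_X1 (r - 2) m (fun j => (hm j).trans e) (ec_twoone' h0 (by omega))
        (ec_twoone' h1 (by omega)) (two_cong h2 (by omega) rfl)
    · have e : n = 3 + 2 * (r - 1) := by omega
      apply n_cong e
      apply fam_X2 (r - 1) m (fun j => (hm j).trans e) (ec_twoone' h0 (by omega))
        (ec_twoone' h1 (by omega)) (two_cong h2 (by omega) rfl)
    · have e : n = 3 + 2 * (r - 1) := by omega
      apply n_cong e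
      apply fam_OG (r - 1) m (fun j => (hm j).trans e) (ec_twoone' h0 (by omega))
        (ec_twoone' h1 (by omega)) (three_cong h2 (by omega) rfl rfl)
    · have e : n = 1 + 2 * r := by omega
      apply n_cong e
      apply fam_Z1 r m (fun j => (hm j).trans e) (by omega) (ec_twoone' h0 (by omega))
        (three_cong h1 (by omega) (by omega) rfl) (three_cong h2 (by omega) (by omega) rfl)
    · have e : n = 4 + 2 * (r - 2) + 1 := by omega
      apply n_cong e
      apply fam_Z2 (r - 2) m (fun j => (hm j).trans e) (ec_twoone' h0 (by omega))
        (three_cong h1 (by omega) (by omega) rfl) (two_cong h2 (by omega) (by omega))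
    · have e : n = 2 + 2 * (r - 1) + 1 := by omega
      apply n_cong e
      apply fam_Z3 (r - 1) m (fun j => (hm j).trans e) (by omega) (ec_twoone' h0 (by omega))
        (four_cong h1 (by omega) (by omega) rfl rfl) (two_cong h2 (by omega) (by omega))
    · have e : n = 2 + 2 * (r - 1) + 1 := by omega
      apply n_cong e
      apply fam_Z4 (r - 1) m (fun j => (hm j).trans e) (by omega) (ec_twoone' h0 (by omega))
        (three_cong h1 (by omega) (by omega) rfl) (three_cong h2 (by omega) (by omega) rfl)
end fams

end partB6

section partA3
open Matrix BigOperators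
open Module
set_option linter.unusedSectionVars false
set_option linter.unusedSimpArgs false
set_option linter.unusedDecidableInType false

/-- number of indices with value `z` -/
noncomputable def cnt {n : ℕ} (d : Fin n → ℂ) (z : ℂ) : ℕ := by
  classical exact (Finset.univ.filter fun k => d k = z).card

theorem pick_set {n : ℕ} (d : Fin n → ℂ) (S : Finset ℂ) (t : ℂ → ℕ) (ht : ∀ z ∈ S, t z ≤ cnt d z) :
    ∃ Φ : Finset (Fin n), Φ.card = ∑ z ∈ S, t z ∧ (∑ k ∈ Φ, d k = ∑ z ∈ S, (t z : ℂ) * z) := by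
  classical
  have : ∀ z, ∃ F : Finset (Fin n), z ∈ S → (F ⊆ Finset.univ.filter (fun k => d k = z) ∧ F.card = t z) := by
    intro z
    by_cases hz : z ∈ S
    · obtain ⟨F, h1, h2⟩ := Finset.exists_subset_card_eq (s := Finset.univ.filter (fun k => d k = z))
        (n := t z) (by have := ht z hz; unfold cnt at this; convert this)
      exact ⟨F, fun _ => ⟨h1, h2⟩⟩
    · exact ⟨∅, fun h => absurd h hz⟩
  choose F hF using this
  have hdisj : ∀ x ∈ S, ∀ y ∈ S, x ≠ y → Disjoint (F x) (F y) := by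
    intro x hx y hy hxy
    rw [Finset.disjoint_left]
    intro k h1 h2
    have h1' := (Finset.mem_filter.1 ((hF x hx).1 h1)).2
    have h2' := (Finset.mem_filter.1 ((hF y hy).1 h2)).2
    exact hxy (h1'.symm.trans h2')
  refine ⟨S.biUnion F, ?_, ?_⟩
  · rw [Finset.card_biUnion hdisj]
    exact Finset.sum_congr rfl (fun z hz => (hF z hz).2)
  · rw [Finset.sum_biUnion hdisj]
    apply Finset.sum_congr rfl
    intro z hz
    rw [← (hF z hz).2, ← nsmul_eq_mul, ← Finset.sum_const]
    apply Finset.sum_congr rfl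
    intro k hk
    exact (Finset.mem_filter.1 ((hF z hz).1 hk)).2

theorem sum_cnt {n : ℕ} (d : Fin n → ℂ) (S : Finset ℂ) (hS : ∀ k, d k ∈ S) : ∑ z ∈ S, cnt d z = n := by
  classical
  have := Finset.card_eq_sum_card_fiberwise (s := (Finset.univ : Finset (Fin n))) (t := S) (f := d)
    (fun k _ => hS k)
  simp at this
  conv_rhs => rw [this]
  apply Finset.sum_congr rfl
  intro z _
  unfold cnt
  congr

theorem sum_cnt_mul {n : ℕ} (d : Fin n → ℂ) (S : Finset ℂ) (hS : ∀ k, d k ∈ S) :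
    ∑ z ∈ S, (cnt d z : ℂ) * z = ∑ k, d k := by
  classical
  rw [← Finset.sum_fiberwise_of_maps_to (t := S) (g := d) (fun k _ => hS k)]
  apply Finset.sum_congr rfl
  intro z _
  rw [Finset.sum_congr rfl (g := fun _ => z) (fun k hk => (Finset.mem_filter.1 hk).2),
    Finset.sum_const, nsmul_eq_mul]
  unfold cnt
  congr

theorem eigbasis {V : Type} [AddCommGroup V] [Module ℂ V] [FiniteDimensional ℂ V] {n : ℕ}
    (A : Module.End ℂ V) (hV : finrank ℂ V = n) (d : Fin n → ℂ)
    (h : ∀ k, cnt d (d k) ≤ finrank ℂ (Module.End.eigenspace A (d k))) :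
    ∃ b : Basis (Fin n) ℂ V, ∀ k, A (b k) = d k • b k := by
  classical
  have : ∀ z, ∃ f : {k // d k = z} → Module.End.eigenspace A z, LinearIndependent ℂ f := by
    intro z
    by_cases hz : ∃ k, d k = z
    · obtain ⟨k, rfl⟩ := hz
      have hc : Fintype.card {i // d i = d k} ≤ Fintype.card (Fin (finrank ℂ (Module.End.eigenspace A (d k)))) := by
        rw [Fintype.card_fin, Fintype.card_subtype]
        have := h k; unfold cnt at this; convert this
      obtain ⟨e⟩ := Function.Embedding.nonempty_of_card_le hc
      exact ⟨fun i => Module.finBasis ℂ _ (e i), 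
        (Module.finBasis ℂ (Module.End.eigenspace A (d k))).linearIndependent.comp e e.injective⟩
    · have : IsEmpty {k // d k = z} := ⟨fun k => hz ⟨k.1, k.2⟩⟩
      exact ⟨fun k => 0, linearIndependent_empty_type⟩
  choose f hf using this
  set b : Fin n → V := fun k => (f (d k) ⟨k, rfl⟩ : V) with hb
  have hbz : ∀ z k (hk : d k = z), b k = (f z ⟨k, hk⟩ : V) := by
    intro z k hk; subst hk; rfl
  have hli : LinearIndependent ℂ b := by
    rw [Fintype.linearIndependent_iff]
    intro g hg i
    have hind := (iSupIndep_iff_finsetSum_eq_zero_imp_eq_zero _).1 (Module.End.eigenspaces_iSupIndep A)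
    rw [← Finset.sum_fiberwise_of_maps_to (t := Finset.univ.image d) (g := d) 
      (fun k _ => Finset.mem_image_of_mem d (Finset.mem_univ k))] at hg
    have hz := hind (Finset.univ.image d) (fun z => ∑ k with d k = z, g k • b k) (by
      intro z _
      apply Submodule.sum_mem
      intro k hk
      rw [hbz z k (Finset.mem_filter.1 hk).2]
      exact Submodule.smul_mem _ _ (Subtype.coe_prop _)) hg (d i) (by simp)
    have hz2 : ∑ k : {k // d k = d i}, g k • f (d i) k = 0 := by
      apply Subtype.ext
      rw [Submodule.coe_sum, Submodule.coe_zero, ← hz]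
      rw [Finset.sum_subtype (Finset.univ.filter (fun k => d k = d i)) (p := fun k => d k = d i) (by simp) 
        (fun k => g k • b k)]
      apply Finset.sum_congr rfl
      intro k _
      rw [Submodule.coe_smul, hbz (d i) k.1 k.2]
    exact (Fintype.linearIndependent_iff.1 (hf (d i))) (fun k => g k) hz2 ⟨i, rfl⟩
  refine ⟨basisOfLinearIndependentOfCardEqFinrank' b hli (by simp [hV]), ?_⟩
  intro k
  rw [coe_basisOfLinearIndependentOfCardEqFinrank']
  exact Module.End.mem_eigenspace_iff.1 (Subtype.coe_prop _)

theorem conj_basis {n : ℕ} {d : Fin n → ℂ} {A : Matrix (Fin n) (Fin n) ℂ} (h : MatConj (diagonal d) A) :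
    ∃ b : Basis (Fin n) ℂ (Fin n → ℂ), ∀ k, A.mulVecLin (b k) = d k • b k := by
  obtain ⟨S, hS⟩ := h
  have hli : LinearIndependent ℂ S.val.col := Matrix.linearIndependent_cols_of_isUnit S.isUnit
  refine ⟨basisOfLinearIndependentOfCardEqFinrank' _ hli (by simp), ?_⟩
  intro k
  rw [coe_basisOfLinearIndependentOfCardEqFinrank']
  have hAS : A * S.val = S.val * diagonal d := by
    rw [hS, Matrix.mul_assoc]; simp
  ext i
  have := congrFun (congrFun hAS i) k
  simp only [Matrix.mul_apply, Matrix.mul_diagonal] at this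
  simp only [Matrix.mulVecLin_apply, Matrix.mulVec, dotProduct, Matrix.col_apply, Pi.smul_apply, smul_eq_mul]
  rw [this]
  simp [Matrix.diagonal_apply, mul_comm]

theorem basis_conj {V : Type} [AddCommGroup V] [Module ℂ V] {n : ℕ} (A : Module.End ℂ V)
    (β b : Basis (Fin n) ℂ V) (d : Fin n → ℂ) (hb : ∀ k, A (b k) = d k • b k) :
    MatConj (diagonal d) (LinearMap.toMatrix β β A) := by
  refine ⟨⟨β.toMatrix b, b.toMatrix β, Basis.toMatrix_mul_toMatrix_flip _ _,
    Basis.toMatrix_mul_toMatrix_flip _ _⟩, ?_⟩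
  have : diagonal d = LinearMap.toMatrix b b A := by
    ext i j
    rw [LinearMap.toMatrix_apply, hb]
    simp [Matrix.diagonal_apply, Finsupp.single_apply]
    by_cases h : i = j
    · subst h; simp
    · simp [h, Ne.symm h]
  rw [this]
  exact (basis_toMatrix_mul_linearMap_toMatrix_mul_basis_toMatrix β b β b A).symm

theorem basis_eig {V : Type} [AddCommGroup V] [Module ℂ V] [FiniteDimensional ℂ V] {n : ℕ} (A : Module.End ℂ V)
    (b : Basis (Fin n) ℂ V) (d : Fin n → ℂ) (hb : ∀ k, A (b k) = d k • b k) (z : ℂ) :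
    finrank ℂ (Module.End.eigenspace A z) = cnt d z := by
  classical
  have hge : ∀ z, cnt d z ≤ finrank ℂ (Module.End.eigenspace A z) := by
    intro z
    have hli : LinearIndependent ℂ (fun k : {k // d k = z} => 
        (⟨b k.1, Module.End.mem_eigenspace_iff.2 (by rw [hb, k.2])⟩ : Module.End.eigenspace A z)) := by
      apply LinearIndependent.of_comp (Module.End.eigenspace A z).subtype
      exact b.linearIndependent.comp _ Subtype.val_injective
    have := hli.fintype_card_le_finrank
    rw [Fintype.card_subtype] at this
    unfold cnt
    convert this
  have hV : finrank ℂ V = n := by rw [finrank_eq_card_basis b]; simp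
  have h1 := finrank_eig_le A (fun z : ℂ => z) (insert z (Finset.univ.image d)) (fun _ _ _ _ h => h)
  have h2 := sum_cnt d (insert z (Finset.univ.image d)) (by intro k; simp)
  have h3 := (Finset.sum_eq_sum_iff_of_le (fun l (_ : l ∈ insert z (Finset.univ.image d)) => hge l)).1
    (le_antisymm (Finset.sum_le_sum (fun l _ => hge l)) (by rw [h2]; exact h1.trans hV.le)) z (by simp)
  exact h3.symm

theorem restrict_trace {V : Type} [AddCommGroup V] [Module ℂ V] [FiniteDimensional ℂ V] {n : ℕ} (A : Module.End ℂ V)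
    (b : Basis (Fin n) ℂ V) (d : Fin n → ℂ) (hb : ∀ k, A (b k) = d k • b k) (W : Submodule ℂ V)
    (hW : ∀ x ∈ W, A x ∈ W) : ∃ Φ : Finset (Fin n), Φ.card = finrank ℂ W ∧
      LinearMap.trace ℂ W (A.restrict hW) = ∑ k ∈ Φ, d k := by
  classical
  set f : Module.End ℂ W := A.restrict hW with hf
  set S := Finset.univ.image d with hS
  have htop : ⨆ μ, A.eigenspace μ = ⊤ := by
    rw [eq_top_iff, ← b.span_eq, Submodule.span_le]
    rintro _ ⟨k, rfl⟩
    exact Submodule.mem_iSup_of_mem (d k) (Module.End.mem_eigenspace_iff.2 (hb k))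
  have htopf : ⨆ μ, f.eigenspace μ = ⊤ := Module.End.genEigenspace_restrict_eq_top hW htop
  have hle : ∀ z, finrank ℂ (f.eigenspace z) ≤ cnt d z := by
    intro z
    rw [← basis_eig A b d hb z]
    have : ∀ x : f.eigenspace z, W.subtype x.1 ∈ A.eigenspace z := by
      rintro ⟨x, hx⟩
      have := Module.End.mem_eigenspace_iff.1 hx
      exact Module.End.mem_eigenspace_iff.2 (congrArg Subtype.val this)
    exact LinearMap.finrank_le_finrank_of_injective
      (f := LinearMap.codRestrict (A.eigenspace z) (W.subtype.comp (f.eigenspace z).subtype) this)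
      (by
        intro x y hxy
        have := congrArg Subtype.val hxy
        exact Subtype.ext (Subtype.ext this))
  have hbot : ∀ z, z ∉ S → f.eigenspace z = ⊥ := by
    intro z hz
    have h0 : cnt d z = 0 := by
      unfold cnt
      rw [Finset.card_eq_zero, Finset.filter_eq_empty_iff]
      intro k _ hk
      exact hz (by rw [hS, ← hk]; simp)
    have := hle z
    rw [h0] at this
    exact Submodule.finrank_eq_zero.1 (Nat.le_zero.1 this)
  have hsum : ∑ z ∈ S, finrank ℂ (f.eigenspace z) = finrank ℂ W := by
    have hinternal : DirectSum.IsInternal (fun z : S => f.eigenspace z) := by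
      apply DirectSum.isInternal_submodule_of_iSupIndep_of_iSup_eq_top
      · exact (Module.End.eigenspaces_iSupIndep f).comp Subtype.val_injective
      · rw [eq_top_iff, ← htopf]
        apply iSup_le
        intro z
        by_cases hz : z ∈ S
        · exact le_iSup (fun z : S => f.eigenspace z) ⟨z, hz⟩
        · rw [hbot z hz]; exact bot_le
    have e := LinearEquiv.ofBijective (DirectSum.coeLinearMap (fun z : S => f.eigenspace z)) hinternal
    have h1 := e.finrank_eq
    rw [← h1, Module.finrank_directSum (R := ℂ) (fun l : S => f.eigenspace l)]
    exact (Finset.sum_coe_sort S (fun z => finrank ℂ (f.eigenspace z))).symm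
  obtain ⟨Φ, h1, h2⟩ := pick_set d S (fun z => finrank ℂ (f.eigenspace z)) (fun z _ => hle z)
  refine ⟨Φ, h1.trans hsum, ?_⟩
  rw [h2]
  -- trace
  have hinternal : DirectSum.IsInternal (fun z : S => f.eigenspace z) := by
    apply DirectSum.isInternal_submodule_of_iSupIndep_of_iSup_eq_top
    · exact (Module.End.eigenspaces_iSupIndep f).comp Subtype.val_injective
    · rw [eq_top_iff, ← htopf]
      apply iSup_le
      intro z
      by_cases hz : z ∈ S
      · exact le_iSup (fun z : S => f.eigenspace z) ⟨z, hz⟩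
      · rw [hbot z hz]; exact bot_le
  have hmaps : ∀ z : S, Set.MapsTo f (f.eigenspace z) (f.eigenspace z) := by
    intro z x hx
    have := Module.End.mem_eigenspace_iff.1 hx
    rw [this]
    exact Submodule.smul_mem _ _ hx
  rw [LinearMap.trace_eq_sum_trace_restrict hinternal hmaps, 
    ← Finset.sum_coe_sort S (fun z => (finrank ℂ (f.eigenspace z) : ℂ) * z)]
  apply Finset.sum_congr rfl
  intro z _
  have : f.restrict (hmaps z) = (z : ℂ) • LinearMap.id := by
    ext x
    have := Module.End.mem_eigenspace_iff.1 x.2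
    have := congrArg Subtype.val this
    exact this
  rw [this, map_smul, LinearMap.trace_id, smul_eq_mul, mul_comm]

theorem irr_of_generic {n : ℕ} (A : Fin 3 → Matrix (Fin n) (Fin n) ℂ) (d : Fin 3 → Fin n → ℂ)
    (hA : ∀ j, MatConj (diagonal (d j)) (A j)) (h0 : ∑ j, A j = 0) (hg : GenericAddEV d) :
    IrreducibleTuple A := by
  intro W hW
  by_contra hc
  push Not at hc
  have hW' : ∀ j, ∀ x ∈ W, (A j).mulVecLin x ∈ W := fun j x hx => hW j (Submodule.mem_map_of_mem hx)
  have hfr : finrank ℂ (Fin n → ℂ) = n := by simp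
  have h1 : 1 ≤ finrank ℂ W := by
    by_contra h
    exact hc.1 (Submodule.finrank_eq_zero.1 (by omega))
  have h2 : finrank ℂ W < n := by
    have := Submodule.finrank_lt hc.2
    rwa [hfr] at this
  have h3 : ∀ j, ∃ Φ : Finset (Fin n), Φ.card = finrank ℂ W ∧
      LinearMap.trace ℂ W ((A j).mulVecLin.restrict (hW' j)) = ∑ k ∈ Φ, d j k := by
    intro j
    obtain ⟨b, hb⟩ := conj_basis (hA j)
    exact restrict_trace _ b (d j) hb W (hW' j)
  choose Φ hΦ hΦ2 using h3
  apply hg _ h1 (by omega) Φ hΦ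
  simp only [← hΦ2]
  rw [← map_sum]
  have : ∑ j, (A j).mulVecLin.restrict (hW' j) = 0 := by
    ext x
    have : (∑ j, A j) *ᵥ x.1 = 0 := by rw [h0]; simp
    rw [Fin.sum_univ_three] at this ⊢
    rw [Matrix.add_mulVec, Matrix.add_mulVec] at this
    simpa using congrFun this _
  rw [this, map_zero]

end partA3

section partA4
open Matrix BigOperators
open Module
set_option linter.unusedSectionVars false
set_option linter.unusedSimpArgs false
set_option linter.unusedDecidableInType false

theorem evCounts_eq {n : ℕ} (d : Fin n → ℂ) (S : Finset ℂ) (hS : ∀ k, d k ∈ S) :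
    evCounts d = EC (Finset.univ : Finset S) (fun z : S => cnt d z) := by
  classical
  have h1 : (Finset.univ : Finset S).val.map (fun z : S => cnt d z) = S.val.map (cnt d) := by
    have : (Finset.univ : Finset S).val.map (fun z : S => z.1) = S.val := by
      exact Multiset.attach_map_val S.val
    conv_rhs => rw [← this]
    rw [Multiset.map_map]; rfl
  rw [EC, h1, Multiset.filter_map, ← Finset.filter_val]
  have h2 : S.filter ((fun x => x ≠ 0) ∘ cnt d) = Finset.univ.image d := by
    ext z
    simp only [Finset.mem_filter, Function.comp, Finset.mem_image, Finset.mem_univ, true_and, cnt, ne_eq,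
      Finset.card_eq_zero, Finset.filter_eq_empty_iff]
    push Not
    constructor
    · rintro ⟨_, k, _, hk⟩; exact ⟨k, hk⟩
    · rintro ⟨k, hk⟩; exact ⟨hk ▸ hS k, k, trivial, hk⟩
  rw [h2]
  unfold evCounts cnt
  congr

theorem second_half (n : ℕ) (hn : 22 ≤ n) (d : Fin 3 → Fin n → ℂ)
    (hT : TriFam n (fun j => evCounts (d j))) (h0 : (∑ j, ∑ k, d j k) = 0) (hg : GenericAddEV d) :
    ∃ A : Fin 3 → Matrix (Fin n) (Fin n) ℂ, (∑ j, A j) = 0 ∧ IrreducibleTuple A ∧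
          ∀ j, MatConj (Matrix.diagonal (d j)) (A j) := by
  classical
  set S : Finset ℂ := Finset.univ.biUnion (fun j => Finset.univ.image (d j)) with hSdef
  have hS : ∀ j k, d j k ∈ S := by
    intro j k
    simp only [hSdef, Finset.mem_biUnion, Finset.mem_image, Finset.mem_univ, true_and]
    exact ⟨j, k, rfl⟩
  set m : Fin 3 → S → ℕ := fun j z => cnt (d j) z with hm
  have hsum : ∀ j, ∑ l, m j l = n := by
    intro j
    rw [← sum_cnt (d j) S (hS j)]
    exact Finset.sum_coe_sort S (cnt (d j))
  have hT' : TriFam n (fun j => EC Finset.univ (m j)) := by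
    have : (fun j => evCounts (d j)) = fun j => EC Finset.univ (m j) := by
      funext j; exact evCounts_eq (d j) S (hS j)
    rwa [this] at hT
  have hsol : Sol n 0 (fun _ (z : S) => (z : ℂ)) m := by
    apply trifam_solv n hn m hsum hT'
    · intro j l l' _ _ h; exact Subtype.ext h
    · simp only [LForm, mul_zero, sub_zero]
      rw [← h0]
      apply Finset.sum_congr rfl
      intro j _
      rw [← sum_cnt_mul (d j) S (hS j)]
      rw [← Finset.sum_coe_sort S]
      simp [hm]
    · rintro κ t ⟨⟨k1, k2, ht, hts⟩, -⟩ hL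
      simp only [LForm, mul_zero, sub_zero] at hL
      have hpick : ∀ j, ∃ Φ : Finset (Fin n), Φ.card = κ.toNat ∧ 
          ∑ k ∈ Φ, d j k = ∑ l : S, (t j l : ℂ) * (l : ℂ) := by
        intro j
        obtain ⟨Φ, h1, h2⟩ := pick_set (d j) S (fun z => if h : z ∈ S then (t j ⟨z, h⟩).toNat else 0) (by
          intro z hz
          simp only [hz, dif_pos]
          have := (ht j ⟨z, hz⟩).2
          simp only [hm] at this
          omega)
        refine ⟨Φ, ?_, ?_⟩
        · rw [h1, ← Finset.sum_coe_sort S]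
          have : ((∑ l : S, (t j l).toNat : ℕ) : ℤ) = κ := by
            rw [← hts j]; push_cast
            apply Finset.sum_congr rfl
            intro l _
            have := (ht j l).1
            omega
          rw [← this, Int.toNat_natCast]
          apply Finset.sum_congr rfl
          intro l _
          rw [dif_pos l.2]
        · rw [h2, ← Finset.sum_coe_sort S]
          apply Finset.sum_congr rfl
          intro l _
          have h3 : ((t j l).toNat : ℤ) = t j l := by
            have := (ht j l).1
            omega
          have h4 : (((t j l).toNat : ℤ) : ℂ) = t j l := by rw [h3]
          rw [dif_pos l.2, ← h4, Int.cast_natCast]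
      choose Φ hΦ1 hΦ2 using hpick
      apply hg κ.toNat (by omega) (by omega) Φ hΦ1
      simp only [hΦ2]
      exact hL
  obtain ⟨V, i1, i2, i3, B, hV, hB, hle⟩ := hsol
  have hbas : ∀ j, ∃ b : Basis (Fin n) ℂ V, ∀ k, B j (b k) = d j k • b k := by
    intro j
    apply eigbasis (B j) hV (d j)
    intro k
    exact hle j ⟨d j k, hS j k⟩
  choose b hb using hbas
  have hsum0 : ∑ j, LinearMap.toMatrix (b 0) (b 0) (B j) = 0 := by
    rw [← map_sum, hB]; simp
  have hconj : ∀ j, MatConj (Matrix.diagonal (d j)) (LinearMap.toMatrix (b 0) (b 0) (B j)) :=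
    fun j => basis_conj (B j) (b 0) (b j) (d j) (hb j)
  exact ⟨_, hsum0, irr_of_generic _ d hconj hsum0 hg, hconj⟩

end partA4

section partC1
open Matrix BigOperators

/-- sum of squares -/
def msq (S : Multiset ℕ) : ℕ := (S.map (fun x => x ^ 2)).sum

theorem msq_cons (a : ℕ) (S : Multiset ℕ) : msq (a ::ₘ S) = a ^ 2 + msq S := by simp [msq]

theorem msq_le_max (M : ℕ) (S : Multiset ℕ) : (∀ x ∈ S, x ≤ M) → msq S ≤ M * S.sum := by
  induction S using Multiset.induction_on with
  | empty => simp [msq]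
  | cons a S ih =>
    intro h
    rw [msq_cons, Multiset.sum_cons]
    have h1 := ih (fun x hx => h x (Multiset.mem_cons_of_mem hx))
    have h2 := h a (Multiset.mem_cons_self _ _)
    nlinarith

theorem msq_le_sum (S : Multiset ℕ) : msq S ≤ S.sum ^ 2 := by
  induction S using Multiset.induction_on with
  | empty => simp [msq]
  | cons a S ih =>
    rw [msq_cons, Multiset.sum_cons]
    nlinarith [Nat.zero_le (a * S.sum)]

theorem exists_max (S : Multiset ℕ) : S ≠ 0 → ∃ a T, S = a ::ₘ T ∧ ∀ x ∈ T, x ≤ a := by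
  induction S using Multiset.induction_on with
  | empty => simp
  | cons a S ih =>
    intro _
    by_cases h : S = 0
    · subst h; exact ⟨a, 0, rfl, by simp⟩
    · obtain ⟨b, T, rfl, hT⟩ := ih h
      by_cases hab : b ≤ a
      · refine ⟨a, b ::ₘ T, rfl, ?_⟩
        intro x hx
        rcases Multiset.mem_cons.1 hx with rfl | hx
        · exact hab
        · exact (hT x hx).trans hab
      · refine ⟨b, a ::ₘ T, Multiset.cons_swap _ _ _, ?_⟩
        intro x hx
        rcases Multiset.mem_cons.1 hx with rfl | hx
        · omega
        · exact hT x hx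

theorem sum0 (S : Multiset ℕ) (hp : ∀ x ∈ S, 1 ≤ x) (h : S.sum = 0) : S = 0 := by
  by_contra hc
  obtain ⟨a, T, rfl, hT⟩ := exists_max S hc
  have := hp a (Multiset.mem_cons_self _ _)
  rw [Multiset.sum_cons] at h
  omega

theorem sum1 (S : Multiset ℕ) (hp : ∀ x ∈ S, 1 ≤ x) (h : S.sum = 1) : S = {1} := by
  have hc : S ≠ 0 := by rintro rfl; simp at h
  obtain ⟨a, T, rfl, hT⟩ := exists_max S hc
  have := hp a (Multiset.mem_cons_self _ _)
  rw [Multiset.sum_cons] at h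
  have h1 : a = 1 := by omega
  rw [sum0 T (fun x hx => hp x (Multiset.mem_cons_of_mem hx)) (by omega), h1]
  rfl

theorem sum2 (S : Multiset ℕ) (hp : ∀ x ∈ S, 1 ≤ x) (h : S.sum = 2) :
    (S = {2} ∧ msq S = 4) ∨ (S = {1, 1} ∧ msq S = 2) := by
  have hc : S ≠ 0 := by rintro rfl; simp at h
  obtain ⟨a, T, rfl, hT⟩ := exists_max S hc
  have := hp a (Multiset.mem_cons_self _ _)
  rw [Multiset.sum_cons] at h
  have h1 : a = 1 ∨ a = 2 := by omega
  rcases h1 with rfl | rfl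
  · right
    rw [sum1 T (fun x hx => hp x (Multiset.mem_cons_of_mem hx)) (by omega)]
    exact ⟨rfl, rfl⟩
  · left
    rw [sum0 T (fun x hx => hp x (Multiset.mem_cons_of_mem hx)) (by omega)]
    exact ⟨rfl, rfl⟩

theorem twos (S : Multiset ℕ) : (∀ x ∈ S, 1 ≤ x) → (∀ x ∈ S, x ≤ 2) → ∃ k s,
    S = Multiset.replicate k 2 + Multiset.replicate s 1 := by
  induction S using Multiset.induction_on with
  | empty => intros; exact ⟨0, 0, by simp⟩
  | cons a S ih =>
    intro h1 h2
    obtain ⟨k, s, rfl⟩ := ih (fun x hx => h1 x (Multiset.mem_cons_of_mem hx))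
      (fun x hx => h2 x (Multiset.mem_cons_of_mem hx))
    have e1 := h1 a (Multiset.mem_cons_self _ _)
    have e2 := h2 a (Multiset.mem_cons_self _ _)
    have e : a = 1 ∨ a = 2 := by omega
    rcases e with rfl | rfl
    · exact ⟨k, s + 1, by rw [Multiset.replicate_succ]; simp⟩
    · exact ⟨k + 1, s, by rw [Multiset.replicate_succ]; simp⟩

theorem twos_sum (k s : ℕ) : (Multiset.replicate k 2 + Multiset.replicate s 1).sum = 2 * k + s := by
  simp; omega

theorem twos_sq (k s : ℕ) : msq (Multiset.replicate k 2 + Multiset.replicate s 1) = 4 * k + s := by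
  simp [msq]; omega

set_option maxHeartbeats 2000000 in
/-- the arithmetic of case `a + b = n` -/
theorem arith1 (k s a b t p q i j n M N : ℕ) (hn : 22 ≤ n) (hk : 1 ≤ k) (hb : 3 ≤ b)
    (h0 : n = 2 * k + s) (hab : a + b = n) (ht : a = b + t) (hi : b = p + i) (hj : b = q + j)
    (hM : M ≤ i ^ 2) (hN : N ≤ (t + j) ^ 2) (hpM : M ≤ p * i) (hqN : N ≤ q * (t + j))
    (heq : 4 * k + s + (a ^ 2 + p ^ 2 + M) + (b ^ 2 + q ^ 2 + N) = n ^ 2 + 2) :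
    (t = 2 ∧ i = 0 ∧ j = 0 ∧ N + 2 = s) ∨ (t = 1 ∧ i = 1 ∧ j = 0 ∧ 1 + M + N = s) ∨
    (t = 1 ∧ i = 0 ∧ j = 1 ∧ 1 + N + M = s) ∨ (t = 0 ∧ i = 2 ∧ j = 0 ∧ M + N + 2 = s) ∨
    (t = 0 ∧ i = 0 ∧ j = 2 ∧ M + N + 2 = s) ∨ (t = 0 ∧ i = 1 ∧ j = 1 ∧ M + N = s) := by
  have hE : (i : ℤ) ^ 2 + j ^ 2 + M + N = 2 * b * (t + i + j) - 4 * b - 2 * t + 2 + s := by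
    zify at heq hi hj ht hab h0
    have e1 : (p : ℤ) = b - i := by linarith
    have e2 : (q : ℤ) = b - j := by linarith
    have e3 : (n : ℤ) = 2 * b + t := by linarith
    have e4 : (2 * k : ℤ) = 2 * b + t - s := by linarith
    have e5 : (4 * k : ℤ) = 2 * (2 * b + t - s) := by linarith
    rw [e5, ht, e1, e2, e3] at heq
    linear_combination heq
  have b1 : (b : ℤ) * t + b * i + b * j + j * t ≤ 4 * b + 2 * t - 2 - s := by
    zify at hi hj hpM hqN
    have e1 : (p : ℤ) = b - i := by linarith
    have e2 : (q : ℤ) = b - j := by linarith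
    rw [e1] at hpM
    rw [e2] at hqN
    have f1 : ((b : ℤ) - i) * i = b * i - i ^ 2 := by ring
    have f2 : ((b : ℤ) - j) * (t + j) = b * t + b * j - j * t - j ^ 2 := by ring
    have f3 : 2 * (b : ℤ) * (t + i + j) = 2 * (b * t) + 2 * (b * i) + 2 * (b * j) := by ring
    rw [f1] at hpM
    rw [f2] at hqN
    rw [f3] at hE
    linarith
  have g1 : (0 : ℤ) ≤ b * i := by positivity
  have g2 : (0 : ℤ) ≤ b * j := by positivity
  have g3 : (0 : ℤ) ≤ j * t := by positivity
  have ht4 : t ≤ 4 := by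
    by_contra hc
    have b2 : (b : ℤ) * t ≤ 4 * b + 2 * t - 2 := by linarith
    have hb9 : b ≤ 8 := by
      by_contra hb8
      push Not at hc hb8
      have c1 : (9 : ℤ) ≤ b := by exact_mod_cast hb8
      have c2 : (5 : ℤ) ≤ t := by exact_mod_cast hc
      have b6 : (0 : ℤ) ≤ (b - 9) * (t - 5) := by
        apply mul_nonneg <;> linarith
      have b7 : ((b : ℤ) - 9) * (t - 5) = b * t - 5 * b - 9 * t + 45 := by ring
      linarith
    clear hE heq hM hN hpM hqN b1 g1 g2 g3
    interval_cases b <;> omega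
  have hN4 : t + i + j ≤ 4 := by
    by_contra hc
    push Not at hc
    have : (b : ℤ) * 5 ≤ b * (t + i + j) := by
      apply mul_le_mul_of_nonneg_left _ (by positivity)
      exact_mod_cast hc
    have f3 : (b : ℤ) * (t + i + j) = (b * t) + (b * i) + (b * j) := by ring
    have : (t : ℤ) ≤ 4 := by exact_mod_cast ht4
    have : (22 : ℤ) ≤ 2 * b + t := by omega
    linarith
  clear b1 g1 g2 g3 heq hpM hqN
  have hi4 : i ≤ 4 := by omega
  have hj4 : j ≤ 4 := by omega
  interval_cases t <;> interval_cases i <;> interval_cases j <;> simp at hM hN hE <;> omega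

set_option maxHeartbeats 2000000 in
/-- the arithmetic of case `a + b + 1 = n` -/
theorem arith2 (k s a b t p q i j n M N : ℕ) (hn : 22 ≤ n) (hk : 1 ≤ k) (hb : 3 ≤ b)
    (h0 : n = 2 * k + s) (hab : a + b + 1 = n) (ht : a = b + t) (hi : b + 1 = p + i) (hj : b = q + j)
    (hpa : p ≤ a)
    (hM : M ≤ i ^ 2) (hN : N ≤ (t + 1 + j) ^ 2) (hpM : M ≤ p * i) (hqN : N ≤ q * (t + 1 + j))
    (heq : 4 * k + s + (a ^ 2 + p ^ 2 + M) + (b ^ 2 + q ^ 2 + N) = n ^ 2 + 2) :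
    (t = 1 ∧ i = 0 ∧ j = 0 ∧ M + N = s) ∨ (t = 0 ∧ i = 1 ∧ j = 0 ∧ M + N = s + 1) := by
  have hE : (i : ℤ) ^ 2 - 2 * i + j ^ 2 + M + N = 2 * b * (t + i + j) - 2 * b + s := by
    zify at heq hi hj ht hab h0
    have e1 : (p : ℤ) = b + 1 - i := by linarith
    have e2 : (q : ℤ) = b - j := by linarith
    have e3 : (n : ℤ) = 2 * b + t + 1 := by linarith
    have e5 : (4 * k : ℤ) = 2 * (2 * b + t + 1 - s) := by linarith
    rw [e5, ht, e1, e2, e3] at heq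
    linear_combination heq
  have hN3 : t + i + j ≤ 3 := by
    by_contra hc
    push Not at hc
    have b1 : (b : ℤ) * (t + i + j) + i + j * (t + 1) + s ≤ 3 * b := by
      zify at hi hj hpM hqN
      have e1 : (p : ℤ) = b + 1 - i := by linarith
      have e2 : (q : ℤ) = b - j := by linarith
      rw [e1] at hpM
      rw [e2] at hqN
      nlinarith
    have : (0 : ℤ) ≤ j * (t + 1) := by positivity
    have : (b : ℤ) * 4 ≤ b * (t + i + j) := by
      apply mul_le_mul_of_nonneg_left _ (by positivity)
      exact_mod_cast hc
    omega
  have hi4 : i ≤ 3 := by omega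
  have hj4 : j ≤ 3 := by omega
  have ht4 : t ≤ 3 := by omega
  interval_cases t <;> interval_cases i <;> interval_cases j <;> simp at hM hN hE <;> omega

end partC1

section partC2
open Matrix BigOperators

theorem tw (k k' s : ℕ) (S : Multiset ℕ) (h : k = k') (hS : S = Multiset.replicate s 1) :
    Multiset.replicate k 2 + Multiset.replicate s 1 = Multiset.replicate k' 2 + S := by
  rw [h, hS]

theorem tw0 (k k' : ℕ) (h : k = k') :
    Multiset.replicate k 2 + Multiset.replicate 0 1 = Multiset.replicate k' 2 := by
  rw [h]; simp

theorem coreA (n k s k' s' : ℕ) (μ : Multiset ℕ) (hn : 22 ≤ n) (h0 : n = 2 * k + s)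
    (h0' : n = 2 * k' + s') (hμ : ∀ x ∈ μ, 1 ≤ x) (hsum : μ.sum = 2) (hs : s + s' = 2 + msq μ) :
    TriFam n ![Multiset.replicate k 2 + Multiset.replicate s 1,
      Multiset.replicate k' 2 + Multiset.replicate s' 1, (n - 2) ::ₘ μ] ∨
    TriFam n ![Multiset.replicate k' 2 + Multiset.replicate s' 1,
      Multiset.replicate k 2 + Multiset.replicate s 1, (n - 2) ::ₘ μ] := by
  rcases sum2 μ hμ hsum with ⟨rfl, hq⟩ | ⟨rfl, hq⟩
  · rw [hq] at hs
    have h7 : s ≤ 6 := by omega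
    interval_cases s
    · obtain rfl : s' = 6 := by omega
      exact Or.inl (Or.inl ⟨k, by omega, Or.inl ⟨tw0 _ _ (by omega), tw _ _ _ _ (by omega) rfl, rfl⟩⟩)
    · obtain rfl : s' = 5 := by omega
      exact Or.inr (Or.inr (Or.inr (Or.inr ⟨k, by omega, Or.inl ⟨tw _ _ _ _ (by omega) rfl, tw _ _ _ _ (by omega) rfl, rfl⟩⟩)))
    · obtain rfl : s' = 4 := by omega
      exact Or.inl (Or.inl ⟨k + 1, by omega, Or.inr (Or.inl ⟨tw _ _ _ _ (by omega) rfl, tw _ _ _ _ (by omega) rfl, rfl⟩)⟩)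
    · obtain rfl : s' = 3 := by omega
      exact Or.inl (Or.inr (Or.inr (Or.inr ⟨k + 1, by omega, Or.inr (Or.inl ⟨tw _ _ _ _ (by omega) rfl, tw _ _ _ _ (by omega) rfl, rfl⟩)⟩)))
    · obtain rfl : s' = 2 := by omega
      exact Or.inr (Or.inl ⟨k' + 1, by omega, Or.inr (Or.inl ⟨tw _ _ _ _ (by omega) rfl, tw _ _ _ _ (by omega) rfl, rfl⟩)⟩)
    · obtain rfl : s' = 1 := by omega
      exact Or.inl (Or.inr (Or.inr (Or.inr ⟨k', by omega, Or.inl ⟨tw _ _ _ _ (by omega) rfl, tw _ _ _ _ (by omega) rfl, rfl⟩⟩)))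
    · obtain rfl : s' = 0 := by omega
      exact Or.inr (Or.inl ⟨k', by omega, Or.inl ⟨tw0 _ _ (by omega), tw _ _ _ _ (by omega) rfl, rfl⟩⟩)
  · rw [hq] at hs
    have h7 : s ≤ 4 := by omega
    interval_cases s
    · obtain rfl : s' = 4 := by omega
      exact Or.inl (Or.inl ⟨k, by omega, Or.inr (Or.inr (Or.inr ⟨tw0 _ _ (by omega), tw _ _ _ _ (by omega) rfl, rfl⟩))⟩)
    · obtain rfl : s' = 3 := by omega
      exact Or.inl (Or.inr (Or.inr (Or.inr ⟨k, by omega, Or.inr (Or.inr (Or.inl ⟨tw _ _ _ _ (by omega) rfl, tw _ _ _ _ (by omega) rfl, rfl⟩))⟩)))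
    · obtain rfl : s' = 2 := by omega
      exact Or.inl (Or.inl ⟨k + 1, by omega, Or.inr (Or.inr (Or.inl ⟨tw _ _ _ _ (by omega) rfl, tw _ _ _ _ (by omega) rfl, rfl⟩))⟩)
    · obtain rfl : s' = 1 := by omega
      exact Or.inr (Or.inr (Or.inr (Or.inr ⟨k', by omega, Or.inr (Or.inr (Or.inl ⟨tw _ _ _ _ (by omega) rfl, tw _ _ _ _ (by omega) rfl, rfl⟩))⟩)))
    · obtain rfl : s' = 0 := by omega
      exact Or.inr (Or.inl ⟨k', by omega, Or.inr (Or.inr (Or.inr ⟨tw0 _ _ (by omega), tw _ _ _ _ (by omega) rfl, rfl⟩))⟩)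

/-- case `a + b = n` -/
theorem coreB (n k s a b p q t i j : ℕ) (μ ν : Multiset ℕ) (hn : 22 ≤ n) (h0 : n = 2 * k + s)
    (hab : a + b = n) (ht : a = b + t) (hi : b = p + i) (hj : b = q + j)
    (hμ : ∀ x ∈ μ, 1 ≤ x) (hν : ∀ x ∈ ν, 1 ≤ x) (sμ : μ.sum = i) (sν : ν.sum = t + j)
    (H : (t = 2 ∧ i = 0 ∧ j = 0 ∧ msq ν + 2 = s) ∨ (t = 1 ∧ i = 1 ∧ j = 0 ∧ 1 + msq μ + msq ν = s) ∨
    (t = 1 ∧ i = 0 ∧ j = 1 ∧ 1 + msq ν + msq μ = s) ∨ (t = 0 ∧ i = 2 ∧ j = 0 ∧ msq μ + msq ν + 2 = s) ∨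
    (t = 0 ∧ i = 0 ∧ j = 2 ∧ msq μ + msq ν + 2 = s) ∨ (t = 0 ∧ i = 1 ∧ j = 1 ∧ msq μ + msq ν = s)) :
    TriFam n ![Multiset.replicate k 2 + Multiset.replicate s 1, a ::ₘ p ::ₘ μ, b ::ₘ q ::ₘ ν] ∨
    TriFam n ![Multiset.replicate k 2 + Multiset.replicate s 1, b ::ₘ q ::ₘ ν, a ::ₘ p ::ₘ μ] := by
  rcases H with ⟨rfl, rfl, rfl, h⟩ | ⟨rfl, rfl, rfl, h⟩ | ⟨rfl, rfl, rfl, h⟩ | ⟨rfl, rfl, rfl, h⟩ |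
    ⟨rfl, rfl, rfl, h⟩ | ⟨rfl, rfl, rfl, h⟩
  · right
    obtain rfl := sum0 μ hμ sμ
    obtain rfl : p = b := by omega
    obtain rfl : q = p := by omega
    subst ht
    rcases sum2 ν hν sν with ⟨rfl, hq⟩ | ⟨rfl, hq⟩
    · obtain rfl : s = 6 := by omega
      exact Or.inr (Or.inl ⟨q, by omega, Or.inr (Or.inr (Or.inr (Or.inr ⟨tw _ _ _ _ (by omega) rfl, rfl, rfl⟩)))⟩)
    · obtain rfl : s = 4 := by omega
      exact Or.inr (Or.inl ⟨q, by omega, Or.inr (Or.inr (Or.inr (Or.inl ⟨tw _ _ _ _ (by omega) rfl, rfl, rfl⟩)))⟩)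
  · right
    obtain rfl := sum1 μ hμ sμ
    obtain rfl := sum1 ν hν sν
    obtain rfl : p = b - 1 := by omega
    obtain rfl : q = b := by omega
    subst ht
    obtain rfl : s = 3 := by rw [← h]; rfl
    exact Or.inr (Or.inr (Or.inr ⟨q, by omega, Or.inr (Or.inr (Or.inr (Or.inr (Or.inr (Or.inr ⟨tw _ _ _ _ (by omega) rfl, rfl, rfl⟩)))))⟩))
  · right
    obtain rfl := sum0 μ hμ sμ
    obtain rfl : p = b := by omega
    obtain rfl : q = p - 1 := by omega
    subst ht
    have hz : msq 0 = 0 := rfl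
    rcases sum2 ν hν sν with ⟨rfl, hq⟩ | ⟨rfl, hq⟩
    · obtain rfl : s = 5 := by omega
      exact Or.inr (Or.inr (Or.inr ⟨p, by omega, Or.inr (Or.inr (Or.inr (Or.inr (Or.inl ⟨tw _ _ _ _ (by omega) rfl, rfl, rfl⟩))))⟩))
    · obtain rfl : s = 3 := by omega
      exact Or.inr (Or.inr (Or.inr ⟨p, by omega, Or.inr (Or.inr (Or.inr (Or.inr (Or.inr (Or.inl ⟨tw _ _ _ _ (by omega) rfl, rfl, rfl⟩)))))⟩))
  · left
    obtain rfl := sum0 ν hν sν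
    obtain rfl : q = b := by omega
    subst hi
    obtain rfl : a = p + 2 := by omega
    have hz : msq 0 = 0 := rfl
    rcases sum2 μ hμ sμ with ⟨rfl, hq⟩ | ⟨rfl, hq⟩
    · obtain rfl : s = 6 := by omega
      exact Or.inr (Or.inr (Or.inl ⟨p, by omega, Or.inr ⟨tw _ _ _ _ (by omega) rfl, rfl, rfl⟩⟩))
    · obtain rfl : s = 4 := by omega
      exact Or.inr (Or.inr (Or.inl ⟨p, by omega, Or.inl ⟨tw _ _ _ _ (by omega) rfl, rfl, rfl⟩⟩))
  · right
    obtain rfl := sum0 μ hμ sμ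
    obtain rfl : p = b := by omega
    subst hj
    obtain rfl : a = q + 2 := by omega
    have hz : msq 0 = 0 := rfl
    rcases sum2 ν hν sν with ⟨rfl, hq⟩ | ⟨rfl, hq⟩
    · obtain rfl : s = 6 := by omega
      exact Or.inr (Or.inr (Or.inl ⟨q, by omega, Or.inr ⟨tw _ _ _ _ (by omega) rfl, rfl, rfl⟩⟩))
    · obtain rfl : s = 4 := by omega
      exact Or.inr (Or.inr (Or.inl ⟨q, by omega, Or.inl ⟨tw _ _ _ _ (by omega) rfl, rfl, rfl⟩⟩))
  · left
    obtain rfl := sum1 μ hμ sμ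
    obtain rfl := sum1 ν hν sν
    obtain rfl : q = p := by omega
    subst hi
    obtain rfl : a = q + 1 := by omega
    obtain rfl : s = 2 := by rw [← h]; rfl
    exact Or.inr (Or.inl ⟨q, by omega, Or.inr (Or.inr (Or.inl ⟨tw _ _ _ _ (by omega) rfl, rfl, rfl⟩))⟩)

/-- case `a + b + 1 = n` -/
theorem coreC (n k s a b p q t i j : ℕ) (μ ν : Multiset ℕ) (hn : 22 ≤ n) (h0 : n = 2 * k + s)
    (hab : a + b + 1 = n) (ht : a = b + t) (hi : b + 1 = p + i) (hj : b = q + j)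
    (hμ : ∀ x ∈ μ, 1 ≤ x) (hν : ∀ x ∈ ν, 1 ≤ x) (sμ : μ.sum = i) (sν : ν.sum = t + 1 + j)
    (H : (t = 1 ∧ i = 0 ∧ j = 0 ∧ msq μ + msq ν = s) ∨
      (t = 0 ∧ i = 1 ∧ j = 0 ∧ msq μ + msq ν = s + 1)) :
    TriFam n ![Multiset.replicate k 2 + Multiset.replicate s 1, b ::ₘ q ::ₘ ν, a ::ₘ p ::ₘ μ] := by
  rcases H with ⟨rfl, rfl, rfl, h⟩ | ⟨rfl, rfl, rfl, h⟩
  · obtain rfl := sum0 μ hμ sμ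
    obtain rfl : q = b := by omega
    subst ht
    obtain rfl : p = q + 1 := by omega
    have hz : msq 0 = 0 := rfl
    rcases sum2 ν hν sν with ⟨rfl, hq⟩ | ⟨rfl, hq⟩
    · obtain rfl : s = 4 := by omega
      exact Or.inr (Or.inl ⟨q, by omega, Or.inl ⟨tw _ _ _ _ (by omega) rfl, rfl, rfl⟩⟩)
    · obtain rfl : s = 2 := by omega
      exact Or.inr (Or.inl ⟨q, by omega, Or.inr (Or.inl ⟨tw _ _ _ _ (by omega) rfl, rfl, rfl⟩)⟩)
  · obtain rfl := sum1 μ hμ sμ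
    obtain rfl := sum1 ν hν sν
    obtain rfl : q = b := by omega
    obtain rfl : p = q := by omega
    obtain rfl : a = p := by omega
    have h1 : msq {1} = 1 := rfl
    obtain rfl : s = 1 := by omega
    exact Or.inr (Or.inr (Or.inr ⟨a, by omega, Or.inr (Or.inr (Or.inr (Or.inl ⟨tw _ _ _ _ (by omega) rfl, rfl, rfl⟩)))⟩))

theorem core (n : ℕ) (hn : 22 ≤ n) (e0 e1 e2 : Multiset ℕ)
    (p0 : ∀ x ∈ e0, 1 ≤ x) (p1 : ∀ x ∈ e1, 1 ≤ x) (p2 : ∀ x ∈ e2, 1 ≤ x)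
    (s0 : e0.sum = n) (s1 : e1.sum = n) (s2 : e2.sum = n)
    (h12 : ∀ x ∈ e1, ∀ y ∈ e2, x + y ≤ n) (h0 : ∀ x ∈ e0, x ≤ 2) (h02 : 2 ∈ e0)
    (a b : ℕ) (ha2 : 2 ≤ a) (hb2 : 2 ≤ b) (hba : b ≤ a) (μ ν : Multiset ℕ)
    (he1 : e1 = a ::ₘ μ) (he2 : e2 = b ::ₘ ν) (ha : ∀ x ∈ μ, x ≤ a) (hb : ∀ x ∈ ν, x ≤ b)
    (heq : msq e0 + msq e1 + msq e2 = n ^ 2 + 2) :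
    TriFam n ![e0, e1, e2] ∨ TriFam n ![e0, e2, e1] ∨ TriFam n ![e2, e0, e1] := by
  obtain ⟨k, s, rfl⟩ := twos e0 p0 h0
  have hk : 1 ≤ k := by
    rcases Nat.eq_zero_or_pos k with rfl | hk
    · simp only [Multiset.replicate_zero, zero_add] at h02
      exact absurd (Multiset.eq_of_mem_replicate h02) (by norm_num)
    · exact hk
  rw [twos_sum] at s0
  rw [twos_sq] at heq
  have hab : a + b ≤ n := h12 a (by rw [he1]; simp) b (by rw [he2]; simp)
  have m1 : msq e1 ≤ a * n := by
    rw [← s1]; apply msq_le_max; rw [he1]; intro x hx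
    rcases Multiset.mem_cons.1 hx with rfl | hx
    · exact le_rfl
    · exact ha x hx
  have m2 : msq e2 ≤ b * n := by
    rw [← s2]; apply msq_le_max; rw [he2]; intro x hx
    rcases Multiset.mem_cons.1 hx with rfl | hx
    · exact le_rfl
    · exact hb x hx
  have hab' : n ≤ a + b + 1 := by
    by_contra hc
    push Not at hc
    have : (a + b + 2) * n ≤ n * n := Nat.mul_le_mul_right n hc
    nlinarith
  have q1 : ∀ x ∈ μ, 1 ≤ x := fun x hx => p1 x (by rw [he1]; exact Multiset.mem_cons_of_mem hx)
  have q2 : ∀ x ∈ ν, 1 ≤ x := fun x hx => p2 x (by rw [he2]; exact Multiset.mem_cons_of_mem hx)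
  have t1 : a + μ.sum = n := by rw [← s1, he1, Multiset.sum_cons]
  have t2 : b + ν.sum = n := by rw [← s2, he2, Multiset.sum_cons]
  have g1 : msq e1 = a ^ 2 + msq μ := by rw [he1, msq_cons]
  have g2 : msq e2 = b ^ 2 + msq ν := by rw [he2, msq_cons]
  rcases Nat.lt_or_ge 2 b with hb3 | hb3
  · have nμ : μ ≠ 0 := by rintro rfl; simp at t1; omega
    have nν : ν ≠ 0 := by rintro rfl; simp at t2; omega
    obtain ⟨p, μ, rfl, hp⟩ := exists_max μ nμ
    obtain ⟨q, ν, rfl, hq⟩ := exists_max ν nν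
    rw [Multiset.sum_cons] at t1 t2
    rw [msq_cons] at g1 g2
    have hqb : q ≤ b := hb q (Multiset.mem_cons_self _ _)
    have hpa : p ≤ a := ha p (Multiset.mem_cons_self _ _)
    have r1 : ∀ x ∈ μ, 1 ≤ x := fun x hx => q1 x (Multiset.mem_cons_of_mem hx)
    have r2 : ∀ x ∈ ν, 1 ≤ x := fun x hx => q2 x (Multiset.mem_cons_of_mem hx)
    obtain ⟨t, ht⟩ := Nat.exists_eq_add_of_le hba
    obtain ⟨j, hj⟩ := Nat.exists_eq_add_of_le hqb
    have u1 := msq_le_max p μ hp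
    have u2 := msq_le_max q ν hq
    have v1 := msq_le_sum μ
    have v2 := msq_le_sum ν
    rcases Nat.lt_or_ge (a + b) n with hlt | hge
    · have hi : b + 1 = p + μ.sum := by omega
      have w : ν.sum = t + 1 + j := by omega
      have H := arith2 k s a b t p q μ.sum j n (msq μ) (msq ν) hn hk hb3 s0.symm (by omega) ht hi hj hpa v1
        (by rw [← w]; exact v2) u1 (by rw [← w]; exact u2) (by rw [← heq, g1, g2]; ring)
      rw [he1, he2]
      exact Or.inr (Or.inl (coreC n k s a b p q t μ.sum j μ ν hn s0.symm (by omega) ht hi hj r1 r2 rfl w H))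
    · have hi : b = p + μ.sum := by omega
      have w : ν.sum = t + j := by omega
      have H := arith1 k s a b t p q μ.sum j n (msq μ) (msq ν) hn hk hb3 s0.symm (by omega) ht hi hj v1
        (by rw [← w]; exact v2) u1 (by rw [← w]; exact u2) (by rw [← heq, g1, g2]; ring)
      rw [he1, he2]
      rcases coreB n k s a b p q t μ.sum j μ ν hn s0.symm (by omega) ht hi hj r1 r2 rfl w H with h | h
      · exact Or.inl h
      · exact Or.inr (Or.inl h)
  · obtain rfl : b = 2 := by omega
    obtain ⟨k', s', h'⟩ := twos e2 p2 (by
      rw [he2]; intro x hx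
      rcases Multiset.mem_cons.1 hx with rfl | hx
      · exact le_rfl
      · exact hb x hx)
    have s2' : 2 * k' + s' = n := by rw [← s2, h', twos_sum]
    have g2' : msq e2 = 4 * k' + s' := by rw [h', twos_sq]
    rcases Nat.lt_or_ge (a + 2) n with hlt | hge
    · exfalso
      have e3 : μ.sum = 3 := by omega
      have v1 := msq_le_sum μ
      rw [e3] at v1
      obtain rfl : n = a + 3 := by omega
      rw [g1, g2'] at heq
      nlinarith
    · have e3 : μ.sum = 2 := by omega
      obtain rfl : n = a + 2 := by omega
      have H : s + s' = 2 + msq μ := by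
        rw [g1, g2'] at heq
        nlinarith
      rw [he1, h']
      rcases coreA (a + 2) k s k' s' μ hn s0.symm s2'.symm q1 e3 H with h | h
      · exact Or.inr (Or.inl h)
      · exact Or.inr (Or.inr h)

end partC2

section partC3
open Matrix BigOperators
open Module

theorem evCounts_cnt {n : ℕ} (d : Fin n → ℂ) :
    ∃ T : Finset ℂ, (∀ z, z ∈ T ↔ ∃ k, d k = z) ∧ evCounts d = T.val.map (cnt d) := by
  classical
  refine ⟨Finset.univ.image d, by simp, ?_⟩
  unfold evCounts cnt
  congr

theorem cnt_pos {n : ℕ} (d : Fin n → ℂ) (k : Fin n) : 1 ≤ cnt d (d k) := by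
  classical
  unfold cnt
  exact Finset.card_pos.2 ⟨k, by simp⟩

theorem ev_pos {n : ℕ} (d : Fin n → ℂ) : ∀ x ∈ evCounts d, 1 ≤ x := by
  obtain ⟨T, hT, h⟩ := evCounts_cnt d
  rw [h]
  intro x hx
  obtain ⟨z, hz, rfl⟩ := Multiset.mem_map.1 hx
  obtain ⟨k, rfl⟩ := (hT z).1 hz
  exact cnt_pos d k

theorem ev_sum {n : ℕ} (d : Fin n → ℂ) : (evCounts d).sum = n := by
  obtain ⟨T, hT, h⟩ := evCounts_cnt d
  rw [h]
  exact sum_cnt d T (fun k => (hT _).2 ⟨k, rfl⟩)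

theorem ev_two {n : ℕ} (d : Fin n → ℂ) (hd : ¬Function.Injective d) : ∃ x ∈ evCounts d, 2 ≤ x := by
  classical
  obtain ⟨T, hT, h⟩ := evCounts_cnt d
  simp only [Function.Injective, not_forall] at hd
  obtain ⟨i, j, hij, hne⟩ := hd
  refine ⟨cnt d (d i), ?_, ?_⟩
  · rw [h]
    exact Multiset.mem_map_of_mem _ ((hT _).2 ⟨i, rfl⟩)
  · unfold cnt
    have : ({i, j} : Finset (Fin n)).card = 2 := Finset.card_pair hne
    rw [← this]
    apply Finset.card_le_card
    intro x hx
    simp only [Finset.mem_insert, Finset.mem_singleton] at hx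
    rcases hx with rfl | rfl
    · simp
    · simp [hij]

theorem card_pairs {n : ℕ} (d : Fin n → ℂ) :
    Nat.card {p : Fin n × Fin n // d p.1 = d p.2} = msq (evCounts d) := by
  classical
  obtain ⟨T, hT, h⟩ := evCounts_cnt d
  rw [h, msq, Multiset.map_map, Nat.card_eq_fintype_card, Fintype.card_subtype]
  rw [Finset.card_eq_sum_card_fiberwise (f := fun p : Fin n × Fin n => d p.1) (t := T)
    (fun p _ => (hT _).2 ⟨p.1, rfl⟩)]
  change _ = ∑ z ∈ T, (cnt d z) ^ 2
  apply Finset.sum_congr rfl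
  intro z _
  rw [sq]
  have : ((Finset.univ.filter fun p : Fin n × Fin n => d p.1 = d p.2).filter fun p => d p.1 = z) =
      (Finset.univ.filter fun k => d k = z) ×ˢ (Finset.univ.filter fun k => d k = z) := by
    ext p
    simp only [Finset.mem_filter, Finset.mem_univ, true_and, Finset.mem_product]
    constructor
    · rintro ⟨h1, h2⟩; exact ⟨h2, h1 ▸ h2⟩
    · rintro ⟨h1, h2⟩; exact ⟨h1.trans h2.symm, h1⟩
  rw [this, Finset.card_product]
  unfold cnt
  congr

open Classical in
/-- parametrisation of the centralizer of a diagonalizable matrix -/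
noncomputable def phiC {n : ℕ} (d : Fin n → ℂ) (S : (Matrix (Fin n) (Fin n) ℂ)ˣ) :
    ({p : Fin n × Fin n // d p.1 = d p.2} → ℂ) →ₗ[ℂ] Matrix (Fin n) (Fin n) ℂ where
  toFun g := S.val * (Matrix.of fun i j => if h : d i = d j then g ⟨(i, j), h⟩ else 0) * (S⁻¹).val
  map_add' g g' := by
    rw [← Matrix.add_mul, ← Matrix.mul_add]
    congr 2
    ext i j
    simp only [Matrix.of_apply, Matrix.add_apply, Pi.add_apply]
    split_ifs <;> simp
  map_smul' c g := by
    rw [RingHom.id_apply, ← Matrix.smul_mul, ← Matrix.mul_smul]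
    congr 2
    ext i j
    simp only [Matrix.of_apply, Matrix.smul_apply, Pi.smul_apply]
    split_ifs <;> simp

open Classical in
theorem phiC_inj {n : ℕ} (d : Fin n → ℂ) (S : (Matrix (Fin n) (Fin n) ℂ)ˣ) :
    Function.Injective (phiC d S) := by
  intro g g' h
  have h1 : S.val * (Matrix.of fun i j => if h : d i = d j then g ⟨(i, j), h⟩ else 0) * (S⁻¹).val =
    S.val * (Matrix.of fun i j => if h : d i = d j then g' ⟨(i, j), h⟩ else 0) * (S⁻¹).val := h
  have h2 := S.isUnit.mul_left_cancel ((S⁻¹).isUnit.mul_right_cancel h1)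
  funext ⟨⟨i, j⟩, hp⟩
  have := congrFun (congrFun h2 i) j
  simpa [Matrix.of_apply, show d i = d j from hp] using this

theorem phiC_range {n : ℕ} (d : Fin n → ℂ) (S : (Matrix (Fin n) (Fin n) ℂ)ˣ) :
    LinearMap.range (phiC d S) = LinearMap.ker
      (LinearMap.mulLeft ℂ (S.val * diagonal d * (S⁻¹).val) - 
        LinearMap.mulRight ℂ (S.val * diagonal d * (S⁻¹).val)) := by
  classical
  ext X
  rw [LinearMap.mem_range, LinearMap.mem_ker, LinearMap.sub_apply, LinearMap.mulLeft_apply,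
    LinearMap.mulRight_apply, sub_eq_zero]
  have key : S.val * diagonal d * (S⁻¹).val * X = X * (S.val * diagonal d * (S⁻¹).val) ↔
      diagonal d * ((S⁻¹).val * X * S.val) = ((S⁻¹).val * X * S.val) * diagonal d := by
    constructor
    · intro h
      have := congrArg (fun Y => (S⁻¹).val * Y * S.val) h
      simpa [mul_assoc] using this
    · intro h
      have := congrArg (fun Y => S.val * Y * (S⁻¹).val) h
      simpa [mul_assoc] using this
  rw [key]
  have key2 : ∀ Z : Matrix (Fin n) (Fin n) ℂ, X = S.val * Z * (S⁻¹).val ↔ (S⁻¹).val * X * S.val = Z := by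
    intro Z
    constructor
    · rintro rfl; simp [mul_assoc]
    · rintro rfl; simp [mul_assoc]
  have hcomm : ∀ Z : Matrix (Fin n) (Fin n) ℂ, diagonal d * Z = Z * diagonal d ↔ ∀ i j, d i ≠ d j → Z i j = 0 := by
    intro Z
    constructor
    · intro h i j hij
      have := congrFun (congrFun h i) j
      rw [Matrix.diagonal_mul, Matrix.mul_diagonal] at this
      have h3 : (d i - d j) * Z i j = 0 := by linear_combination this
      exact (mul_eq_zero.1 h3).resolve_left (sub_ne_zero.2 hij)
    · intro h
      ext i j
      rw [Matrix.diagonal_mul, Matrix.mul_diagonal]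
      by_cases hij : d i = d j
      · rw [hij, mul_comm]
      · rw [h i j hij]; simp
  rw [hcomm]
  constructor
  · rintro ⟨g, hg⟩ i j hij
    have := (key2 _).1 hg.symm
    rw [this]
    simp [hij]
  · intro h
    refine ⟨fun p => ((S⁻¹).val * X * S.val) p.1.1 p.1.2, ?_⟩
    symm
    refine (key2 _).2 ?_
    ext i j
    simp only [Matrix.of_apply]
    split_ifs with hij
    · rfl
    · exact h i j hij

theorem classDim_eq {n : ℕ} (d : Fin n → ℂ) (A : Matrix (Fin n) (Fin n) ℂ)
    (h : MatConj (diagonal d) A) : classDim A = n ^ 2 - msq (evCounts d) := by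
  obtain ⟨S, rfl⟩ := h
  rw [classDim, ← phiC_range, LinearMap.finrank_range_of_inj (phiC_inj d S), ← card_pairs]
  classical
  rw [Module.finrank_fintype_fun_eq_card, Nat.card_eq_fintype_card]

theorem cross_le {n : ℕ} (hn : 2 ≤ n) (A : Fin 3 → Matrix (Fin n) (Fin n) ℂ) (d : Fin 3 → Fin n → ℂ)
    (hA : ∀ j, MatConj (diagonal (d j)) (A j)) (h0 : ∑ j, A j = 0) (hirr : IrreducibleTuple A) :
    ∀ x ∈ evCounts (d 1), ∀ y ∈ evCounts (d 2), x + y ≤ n := by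
  intro x hx y hy
  obtain ⟨T1, hT1, e1⟩ := evCounts_cnt (d 1)
  obtain ⟨T2, hT2, e2⟩ := evCounts_cnt (d 2)
  rw [e1] at hx
  rw [e2] at hy
  obtain ⟨z, -, rfl⟩ := Multiset.mem_map.1 hx
  obtain ⟨w, -, rfl⟩ := Multiset.mem_map.1 hy
  obtain ⟨b1, hb1⟩ := conj_basis (hA 1)
  obtain ⟨b2, hb2⟩ := conj_basis (hA 2)
  rw [← basis_eig _ b1 _ hb1 z, ← basis_eig _ b2 _ hb2 w]
  by_contra hc
  push Not at hc
  have hfr : finrank ℂ (Fin n → ℂ) = n := by simp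
  have hsum := Submodule.finrank_sup_add_finrank_inf_eq (Module.End.eigenspace (A 1).mulVecLin z)
    (Module.End.eigenspace (A 2).mulVecLin w)
  have hle := Submodule.finrank_le (Module.End.eigenspace (A 1).mulVecLin z ⊔
    Module.End.eigenspace (A 2).mulVecLin w)
  rw [hfr] at hle
  have hne : Module.End.eigenspace (A 1).mulVecLin z ⊓ Module.End.eigenspace (A 2).mulVecLin w ≠ ⊥ := by
    intro h
    rw [h, finrank_bot] at hsum
    omega
  obtain ⟨u, hu, hu0⟩ := Submodule.exists_mem_ne_zero_of_ne_bot hne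
  have hu1 := Module.End.mem_eigenspace_iff.1 hu.1
  have hu2 := Module.End.mem_eigenspace_iff.1 hu.2
  have hu3 : (A 0).mulVecLin u = (-z - w) • u := by
    have : A 0 = -(A 1) - A 2 := by
      rw [Fin.sum_univ_three] at h0
      have h3 : A 0 + (A 1 + A 2) = 0 := by rw [← add_assoc]; exact h0
      rw [eq_neg_of_add_eq_zero_left h3, neg_add, sub_eq_add_neg]
    rw [this]
    simp only [Matrix.mulVecLin_apply] at hu1 hu2 ⊢
    rw [Matrix.sub_mulVec, Matrix.neg_mulVec, hu1, hu2, sub_smul, neg_smul]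
  have hinv : ∀ j, (ℂ ∙ u).map (Matrix.mulVecLin (A j)) ≤ ℂ ∙ u := by
    intro j
    rw [Submodule.map_span, Set.image_singleton, Submodule.span_singleton_le_iff_mem,
      Submodule.mem_span_singleton]
    fin_cases j
    · exact ⟨_, hu3.symm⟩
    · exact ⟨_, hu1.symm⟩
    · exact ⟨_, hu2.symm⟩
  have h1 : finrank ℂ (ℂ ∙ u) = 1 := finrank_span_singleton hu0
  rcases hirr _ hinv with h | h
  · rw [h, finrank_bot] at h1; omega
  · rw [h, finrank_top, hfr] at h1; omega

theorem tri_ext {n : ℕ} (d : Fin 3 → Fin n → ℂ) (i j k : Fin 3) (σ : Equiv.Perm (Fin 3))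
    (h0 : σ 0 = i) (h1 : σ 1 = j) (h2 : σ 2 = k)
    (h : TriFam n ![evCounts (d i), evCounts (d j), evCounts (d k)]) :
    ∃ σ : Equiv.Perm (Fin 3), TriFam n fun j => evCounts (d (σ j)) := by
  refine ⟨σ, ?_⟩
  convert h using 1
  funext l
  fin_cases l
  · simp [h0]
  · simp [h1]
  · simp [h2]

theorem first_half (n : ℕ) (hn : 22 ≤ n) (A : Fin 3 → Matrix (Fin n) (Fin n) ℂ)
    (d : Fin 3 → Fin n → ℂ) (hA : ∀ j, MatConj (Matrix.diagonal (d j)) (A j))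
    (h0 : (∑ j, A j) = 0) (hirr : IrreducibleTuple A)
    (hinj : ∀ j, ¬Function.Injective (d j))
    (hdim : (∑ j, classDim (A j)) = 2 * n ^ 2 - 2)
    (hle : ∀ m ∈ evCounts (d 0), m ≤ 2) (h2 : 2 ∈ evCounts (d 0)) :
    ∃ σ : Equiv.Perm (Fin 3), TriFam n fun j => evCounts (d (σ j)) := by
  have hm : ∀ j, msq (evCounts (d j)) ≤ n ^ 2 := fun j => by
    have := msq_le_sum (evCounts (d j)); rwa [ev_sum] at this
  have heq : msq (evCounts (d 0)) + msq (evCounts (d 1)) + msq (evCounts (d 2)) = n ^ 2 + 2 := by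
    rw [Fin.sum_univ_three, classDim_eq _ _ (hA 0), classDim_eq _ _ (hA 1), classDim_eq _ _ (hA 2)] at hdim
    have i0 := hm 0
    have i1 := hm 1
    have i2 := hm 2
    have : 22 ^ 2 ≤ n ^ 2 := Nat.pow_le_pow_left hn 2
    omega
  have hcross := cross_le (by omega) A d hA h0 hirr
  have hmax : ∀ j, ∃ a μ, evCounts (d j) = a ::ₘ μ ∧ (∀ x ∈ μ, x ≤ a) ∧ 2 ≤ a := by
    intro j
    obtain ⟨x, hx, hx2⟩ := ev_two (d j) (hinj j)
    obtain ⟨a, μ, he, ha⟩ := exists_max (evCounts (d j)) (by intro h; rw [h] at hx; simp at hx)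
    refine ⟨a, μ, he, ha, ?_⟩
    rw [he] at hx
    rcases Multiset.mem_cons.1 hx with rfl | hx
    · exact hx2
    · exact hx2.trans (ha x hx)
  obtain ⟨a, μ, he1, ha, ha2⟩ := hmax 1
  obtain ⟨b, ν, he2, hb, hb2⟩ := hmax 2
  rcases le_total b a with hba | hab
  · rcases core n hn _ _ _ (ev_pos (d 0)) (ev_pos (d 1)) (ev_pos (d 2)) (ev_sum _) (ev_sum _) (ev_sum _)
      hcross hle h2 a b ha2 hb2 hba μ ν he1 he2 ha hb heq with h | h | h
    · exact tri_ext d 0 1 2 1 rfl rfl rfl h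
    · exact tri_ext d 0 2 1 (Equiv.swap 1 2) (by decide) (by decide) (by decide) h
    · exact tri_ext d 2 0 1 cyc.symm rfl rfl rfl h
  · rcases core n hn _ _ _ (ev_pos (d 0)) (ev_pos (d 2)) (ev_pos (d 1)) (ev_sum _) (ev_sum _) (ev_sum _)
      (fun x hx y hy => by rw [add_comm]; exact hcross y hy x hx) hle h2 b a hb2 ha2 hab ν μ he2 he1 hb ha
      (by rw [← heq]; ring) with h | h | h
    · exact tri_ext d 0 2 1 (Equiv.swap 1 2) (by decide) (by decide) (by decide) h
    · exact tri_ext d 0 1 2 1 rfl rfl rfl h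
    · exact tri_ext d 1 0 2 (Equiv.swap 0 1) (by decide) (by decide) (by decide) h

end partC3

/-- (Theorem `p = 2` for `n ≥ 22`: classification, up to permutation of the
three matrices, of rigid triples with `u = 2`, none of the matrices scalar or with all
eigenvalues distinct; together with the converse existence for each listed PMV and every
compatible generic eigenvalues). -/
theorem stmt17 (n : ℕ) (hn : 22 ≤ n) :
    (∀ (A : Fin 3 → Matrix (Fin n) (Fin n) ℂ) (d : Fin 3 → Fin n → ℂ),
        (∀ j, MatConj (Matrix.diagonal (d j)) (A j)) →
        (∑ j, A j) = 0 →
        IrreducibleTuple A →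
        GenericAddEV d →
        (∀ j, ¬∃ c : ℂ, A j = c • (1 : Matrix (Fin n) (Fin n) ℂ)) →
        (∀ j, ¬Function.Injective (d j)) →
        (∑ j, classDim (A j)) = 2 * n ^ 2 - 2 →
        (∀ m ∈ evCounts (d 0), m ≤ 2) →
        2 ∈ evCounts (d 0) →
        ∃ σ : Equiv.Perm (Fin 3), TriFam n fun j => evCounts (d (σ j))) ∧
    (∀ d : Fin 3 → Fin n → ℂ,
        TriFam n (fun j => evCounts (d j)) →
        (∑ j, ∑ k, d j k) = 0 →
        GenericAddEV d →
        ∃ A : Fin 3 → Matrix (Fin n) (Fin n) ℂ,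
          (∑ j, A j) = 0 ∧ IrreducibleTuple A ∧
          ∀ j, MatConj (Matrix.diagonal (d j)) (A j)) := by
  exact ⟨fun A d h1 h2 h3 _ _ h6 h7 h8 h9 => first_half n hn A d h1 h2 h3 h6 h7 h8 h9,
    fun d h1 h2 h3 => second_half n hn d h1 h2 h3⟩
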